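/- Let (u,v) be a positive cylindrical weak solution of −Δ_ℍu = f(v), −Δ_ℍv = g(u) on ℍⁿ, where f,g : [0,∞) → ℝ are continuous, nondecreasing on (0,∞), h(t) = f(t)/t^{(Q+2)/(Q−2)} and k(t) = g(t)/t^{(Q+2)/(Q−2)} are nonincreasing on (0,∞), and either h is not constant on (0, sup_{ξ∈ℍⁿ} v(ξ)) or k is not constant on (0, sup_{ξ∈ℍⁿ} u(ξ)). Then the CR inversions ū and v̄ are symmetric with respect to the plane T₀ = {t = 0}; that is, ū and v̄ are even functions in the t-variable: ū(x,y,t) = ū(x,y,−t) and v̄(x,y,t) = v̄(x,y,−t) for all (x,y,t) ≠ 0. -/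

import Mathlib

open MeasureTheory Real Filter Set Topology

noncomputable section

namespace Heisenberg

/-- The underlying space of the Heisenberg group `ℍⁿ`, identified with `ℝⁿ × ℝⁿ × ℝ`
(equipped with Lebesgue measure, which is the Haar measure of `ℍⁿ`). -/
abbrev H (n : ℕ) : Type := (Fin n → ℝ) × (Fin n → ℝ) × ℝ

variable {n : ℕ}

/-- `|x|² + |y|²` for `ξ = (x, y, t)`. -/
def rsq (ξ : H n) : ℝ := ∑ i, (ξ.1 i) ^ 2 + ∑ i, (ξ.2.1 i) ^ 2

/-- The Kaplan gauge `|ξ|_ℍ = ((|x|²+|y|²)² + t²)^{1/4}`. -/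
def gaugeH (ξ : H n) : ℝ := ((rsq ξ) ^ 2 + (ξ.2.2) ^ 2) ^ ((4 : ℝ)⁻¹)

/-- The left-invariant vector field `Xᵢ = ∂_{xᵢ} + 2yᵢ∂_t` applied to `φ`. -/
def Xd (i : Fin n) (φ : H n → ℝ) (ξ : H n) : ℝ :=
  fderiv ℝ φ ξ (Pi.single i 1, 0, 2 * ξ.2.1 i)

/-- The left-invariant vector field `Yᵢ = ∂_{yᵢ} − 2xᵢ∂_t` applied to `φ`. -/
def Yd (i : Fin n) (φ : H n → ℝ) (ξ : H n) : ℝ :=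
  fderiv ℝ φ ξ (0, Pi.single i 1, -(2 * ξ.1 i))

/-- The horizontal gradient `∇_ℍ φ = (X₁φ,…,Xₙφ,Y₁φ,…,Yₙφ)` of a differentiable function. -/
def hGrad (φ : H n → ℝ) (ξ : H n) : (Fin n → ℝ) × (Fin n → ℝ) :=
  (fun i => Xd i φ ξ, fun i => Yd i φ ξ)

/-- Euclidean pairing of two horizontal vectors. -/
def hdot (a b : (Fin n → ℝ) × (Fin n → ℝ)) : ℝ :=
  ∑ i, a.1 i * b.1 i + ∑ i, a.2 i * b.2 i

/-- The (pointwise, classical) sub-Laplacian `Δ_ℍ = ∑ᵢ (Xᵢ² + Yᵢ²)`. -/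
def subLap (u : H n → ℝ) (ξ : H n) : ℝ :=
  ∑ i, Xd i (Xd i u) ξ + ∑ i, Yd i (Yd i u) ξ

/-- `φ ∈ C¹_c(Ω)`. -/
structure IsTest (Ω : Set (H n)) (φ : H n → ℝ) : Prop where
  contDiff : ContDiff ℝ 1 φ
  compactSupport : HasCompactSupport φ
  supportSubset : tsupport φ ⊆ Ω

/-- `G` is a weak horizontal gradient of `u` on `Ω`, with `u` locally integrable on `Ω`
and `G` locally square-integrable on `Ω` (i.e. `u ∈ H¹_loc(Ω)` with horizontal gradient `G`). -/
structure IsWeakHGrad (Ω : Set (H n)) (u : H n → ℝ)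
    (G : H n → (Fin n → ℝ) × (Fin n → ℝ)) : Prop where
  locInt : LocallyIntegrableOn u Ω
  locSq : ∀ K : Set (H n), K ⊆ Ω → IsCompact K → IntegrableOn (fun ξ => ‖G ξ‖ ^ 2) K
  ibpX : ∀ i : Fin n, ∀ φ : H n → ℝ, IsTest Ω φ →
    ∫ ξ, u ξ * Xd i φ ξ = -∫ ξ, (G ξ).1 i * φ ξ
  ibpY : ∀ i : Fin n, ∀ φ : H n → ℝ, IsTest Ω φ →
    ∫ ξ, u ξ * Yd i φ ξ = -∫ ξ, (G ξ).2 i * φ ξ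

/-- `u ∈ H¹_loc(Ω)` is a weak solution of `−Δ_ℍ u = F` on `Ω`:
`∫ ∇_ℍu · ∇_ℍφ = ∫ F φ` for all `φ ∈ C¹_c(Ω)`. -/
def IsWeakSol (Ω : Set (H n)) (u F : H n → ℝ) : Prop :=
  ∃ G : H n → (Fin n → ℝ) × (Fin n → ℝ), IsWeakHGrad Ω u G ∧
    ∀ φ : H n → ℝ, IsTest Ω φ → ∫ ξ, hdot (G ξ) (hGrad φ ξ) = ∫ ξ, F ξ * φ ξ

/-- A function on `ℍⁿ` is cylindrical if it depends only on `r = √(|x|²+|y|²)` and `t`. -/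
def IsCylindrical (u : H n → ℝ) : Prop :=
  ∀ ξ ξ' : H n, rsq ξ = rsq ξ' → ξ.2.2 = ξ'.2.2 → u ξ = u ξ'

/-- The CR-inverted point `ξ̃`. -/
def tilde (ξ : H n) : H n :=
  (fun i => (ξ.1 i * ξ.2.2 + ξ.2.1 i * rsq ξ) / gaugeH ξ ^ 4,
   fun i => (ξ.2.1 i * ξ.2.2 - ξ.1 i * rsq ξ) / gaugeH ξ ^ 4,
   -ξ.2.2 / gaugeH ξ ^ 4)

/-- The CR inversion `ū(ξ) = |ξ|_ℍ^{−(Q−2)} u(ξ̃)`, where `Q − 2 = 2n`. -/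
def crInv (u : H n → ℝ) (ξ : H n) : ℝ := u (tilde ξ) / gaugeH ξ ^ (2 * n)

/-- The critical exponent `τ = (Q+2)/(Q−2)` with `Q = 2n+2`. -/
def tau (n : ℕ) : ℝ := (2 * (n : ℝ) + 4) / (2 * (n : ℝ))

/-- The half space `Σ_λ = {ξ = (x,y,t) : t > λ}`. -/
def Sig (l : ℝ) : Set (H n) := {ξ | l < ξ.2.2}

/-- The H-reflection `ξ_λ = (y, x, 2λ − t)` with respect to the plane `T_λ = {t = λ}`. -/
def hRefl (l : ℝ) (ξ : H n) : H n := (ξ.2.1, ξ.1, 2 * l - ξ.2.2)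

/-- The point `0_λ = (0, 0, 2λ)`. -/
def zl (l : ℝ) : H n := (0, 0, 2 * l)

/-- `U_λ = ū − ū_λ`, where `ū` is the CR inversion of `u` and `ū_λ(ξ) = ū(ξ_λ)`. -/
def Ulam (u : H n → ℝ) (l : ℝ) (ξ : H n) : ℝ := crInv u ξ - crInv u (hRefl l ξ)

/-- `w ∈ L^{τ+1}(Σ_λ) ∩ L^∞(Σ_λ)`. -/
def MemLtau1Linf (l : ℝ) (w : H n → ℝ) : Prop :=
  IntegrableOn (fun ξ => |w ξ| ^ (tau n + 1)) (Sig l) ∧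
    ∃ M : ℝ, ∀ ξ ∈ Sig (n := n) l, |w ξ| ≤ M

/-- `w ∈ H¹(Ω)`: square integrable on `Ω`, with a weak horizontal gradient which is
square integrable on `Ω`. -/
def MemH1 (Ω : Set (H n)) (w : H n → ℝ) : Prop :=
  IntegrableOn (fun ξ => (w ξ) ^ 2) Ω ∧
  ∃ G : H n → (Fin n → ℝ) × (Fin n → ℝ),
    IntegrableOn (fun ξ => ‖G ξ‖ ^ 2) Ω ∧
    (∀ i : Fin n, ∀ φ : H n → ℝ, IsTest Ω φ →
      ∫ ξ, w ξ * Xd i φ ξ = -∫ ξ, (G ξ).1 i * φ ξ) ∧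
    (∀ i : Fin n, ∀ φ : H n → ℝ, IsTest Ω φ →
      ∫ ξ, w ξ * Yd i φ ξ = -∫ ξ, (G ξ).2 i * φ ξ)

end Heisenberg

namespace HP
/-- open half plane -/
def P : Set (ℝ × ℝ) := {z | 0 < z.1}

def d1 (w : ℝ × ℝ → ℝ) (z : ℝ × ℝ) : ℝ := deriv (fun s => w (s, z.2)) z.1
def d2 (w : ℝ × ℝ → ℝ) (z : ℝ × ℝ) : ℝ := deriv (fun s => w (z.1, s)) z.2
def Lop (n : ℕ) (w : ℝ × ℝ → ℝ) (z : ℝ × ℝ) : ℝ :=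
  z.1 * (d1 (d1 w) z + d2 (d2 w) z) + n * d1 w z

lemma isOpen_P : IsOpen P := isOpen_lt continuous_const continuous_fst

lemma hasDerivAt_mk1 (z : ℝ × ℝ) : HasDerivAt (fun s : ℝ => (s, z.2)) ((1 : ℝ), (0 : ℝ)) z.1 :=
  (hasDerivAt_id z.1).prodMk (hasDerivAt_const z.1 z.2)
lemma hasDerivAt_mk2 (z : ℝ × ℝ) : HasDerivAt (fun s : ℝ => (z.1, s)) ((0 : ℝ), (1 : ℝ)) z.2 :=
  (hasDerivAt_const z.2 z.1).prodMk (hasDerivAt_id z.2)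

lemma hasDerivAt_line1 {w : ℝ × ℝ → ℝ} {z : ℝ × ℝ} (h : DifferentiableAt ℝ w z) :
    HasDerivAt (fun s => w (s, z.2)) (fderiv ℝ w z (1, 0)) z.1 :=
  HasFDerivAt.comp_hasDerivAt (f := fun s : ℝ => (s, z.2)) z.1 h.hasFDerivAt (hasDerivAt_mk1 z)
lemma hasDerivAt_line2 {w : ℝ × ℝ → ℝ} {z : ℝ × ℝ} (h : DifferentiableAt ℝ w z) :
    HasDerivAt (fun s => w (z.1, s)) (fderiv ℝ w z (0, 1)) z.2 :=
  HasFDerivAt.comp_hasDerivAt (f := fun s : ℝ => (z.1, s)) z.2 h.hasFDerivAt (hasDerivAt_mk2 z)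

lemma d1_eq {w : ℝ × ℝ → ℝ} {z : ℝ × ℝ} (h : DifferentiableAt ℝ w z) :
    d1 w z = fderiv ℝ w z (1, 0) := (hasDerivAt_line1 h).deriv
lemma d2_eq {w : ℝ × ℝ → ℝ} {z : ℝ × ℝ} (h : DifferentiableAt ℝ w z) :
    d2 w z = fderiv ℝ w z (0, 1) := (hasDerivAt_line2 h).deriv

lemma C2_ev_diff {w : ℝ × ℝ → ℝ} {z : ℝ × ℝ} {m : ℕ} (h : ContDiffAt ℝ (m+1 : ℕ) w z) :
    ∀ᶠ y in 𝓝 z, DifferentiableAt ℝ w y := by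
  filter_upwards [h.eventually (by simp)] with y hy
  exact hy.differentiableAt (by simp)

lemma C2_d1 {w : ℝ × ℝ → ℝ} {z : ℝ × ℝ} {m : ℕ} (h : ContDiffAt ℝ (m+1 : ℕ) w z) :
    ContDiffAt ℝ m (d1 w) z := by
  have h1 : ContDiffAt ℝ m (fun y => fderiv ℝ w y (1,0)) z :=
    (h.fderiv_right (m := m) (by norm_cast)).clm_apply contDiffAt_const
  refine h1.congr_of_eventuallyEq ?_
  filter_upwards [C2_ev_diff h] with y hy using d1_eq hy
lemma C2_d2 {w : ℝ × ℝ → ℝ} {z : ℝ × ℝ} {m : ℕ} (h : ContDiffAt ℝ (m+1 : ℕ) w z) :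
    ContDiffAt ℝ m (d2 w) z := by
  have h1 : ContDiffAt ℝ m (fun y => fderiv ℝ w y (0,1)) z :=
    (h.fderiv_right (m := m) (by norm_cast)).clm_apply contDiffAt_const
  refine h1.congr_of_eventuallyEq ?_
  filter_upwards [C2_ev_diff h] with y hy using d2_eq hy

lemma Lop_contAt {w : ℝ × ℝ → ℝ} {z : ℝ × ℝ} (n : ℕ) (h : ContDiffAt ℝ 2 w z) :
    ContinuousAt (Lop n w) z := by
  have a1 : ContDiffAt ℝ (1:ℕ) (d1 w) z := C2_d1 (m := 1) h
  have a2 : ContDiffAt ℝ (1:ℕ) (d2 w) z := C2_d2 (m := 1) h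
  have b1 := (C2_d1 (m := 0) a1).continuousAt
  have b2 := (C2_d2 (m := 0) a2).continuousAt
  have := a1.continuousAt
  unfold Lop
  fun_prop

/-- partial derivative along lines for C1 functions -/
lemma tend_line1 (z : ℝ × ℝ) : Tendsto (fun s : ℝ => (s, z.2)) (𝓝 z.1) (𝓝 z) := by
  have : Continuous (fun s : ℝ => (s, z.2)) := by fun_prop
  exact this.tendsto z.1
lemma tend_line2 (z : ℝ × ℝ) : Tendsto (fun s : ℝ => (z.1, s)) (𝓝 z.2) (𝓝 z) := by
  have : Continuous (fun s : ℝ => (z.1, s)) := by fun_prop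
  exact this.tendsto z.2

lemma d1_congr {w w' : ℝ × ℝ → ℝ} {z : ℝ × ℝ} (h : w =ᶠ[𝓝 z] w') : d1 w z = d1 w' z :=
  Filter.EventuallyEq.deriv_eq ((tend_line1 z).eventually h)
lemma d2_congr {w w' : ℝ × ℝ → ℝ} {z : ℝ × ℝ} (h : w =ᶠ[𝓝 z] w') : d2 w z = d2 w' z :=
  Filter.EventuallyEq.deriv_eq ((tend_line2 z).eventually h)
lemma d1_congr' {w w' : ℝ × ℝ → ℝ} {z : ℝ × ℝ} (h : w =ᶠ[𝓝 z] w') : d1 w =ᶠ[𝓝 z] d1 w' := by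
  filter_upwards [h.eventually_nhds] with y hy using d1_congr hy
lemma d2_congr' {w w' : ℝ × ℝ → ℝ} {z : ℝ × ℝ} (h : w =ᶠ[𝓝 z] w') : d2 w =ᶠ[𝓝 z] d2 w' := by
  filter_upwards [h.eventually_nhds] with y hy using d2_congr hy
lemma Lop_congr {w w' : ℝ × ℝ → ℝ} {z : ℝ × ℝ} (n : ℕ) (h : w =ᶠ[𝓝 z] w') :
    Lop n w z = Lop n w' z := by
  unfold Lop
  rw [d1_congr h, d1_congr (d1_congr' h), d2_congr (d2_congr' h)]

/-- computing `Lop` from explicit partial derivatives -/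
lemma Lop_eq {w w1 w2 : ℝ × ℝ → ℝ} {w11 w22 : ℝ} {z : ℝ × ℝ} (n : ℕ)
    (h1 : ∀ᶠ y in 𝓝 z, HasDerivAt (fun s => w (s, y.2)) (w1 y) y.1)
    (h2 : ∀ᶠ y in 𝓝 z, HasDerivAt (fun s => w (y.1, s)) (w2 y) y.2)
    (h11 : HasDerivAt (fun s => w1 (s, z.2)) w11 z.1)
    (h22 : HasDerivAt (fun s => w2 (z.1, s)) w22 z.2) :
    Lop n w z = z.1 * (w11 + w22) + n * w1 z := by
  have e1 : d1 w =ᶠ[𝓝 z] w1 := by filter_upwards [h1] with y hy using hy.deriv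
  have e2 : d2 w =ᶠ[𝓝 z] w2 := by filter_upwards [h2] with y hy using hy.deriv
  unfold Lop
  rw [d1_congr e1, d2_congr e2, e1.self_of_nhds]
  rw [show d1 w1 z = w11 from h11.deriv, show d2 w2 z = w22 from h22.deriv]

lemma C2_ders {w : ℝ × ℝ → ℝ} {z : ℝ × ℝ} (h : ContDiffAt ℝ 2 w z) :
    (∀ᶠ y in 𝓝 z, HasDerivAt (fun s => w (s, y.2)) (d1 w y) y.1) ∧
    (∀ᶠ y in 𝓝 z, HasDerivAt (fun s => w (y.1, s)) (d2 w y) y.2) ∧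
    HasDerivAt (fun s => d1 w (s, z.2)) (d1 (d1 w) z) z.1 ∧
    HasDerivAt (fun s => d2 w (z.1, s)) (d2 (d2 w) z) z.2 := by
  have e := C2_ev_diff (m := 1) h
  refine ⟨?_, ?_, ?_, ?_⟩
  · filter_upwards [e] with y hy
    rw [d1_eq hy]; exact hasDerivAt_line1 hy
  · filter_upwards [e] with y hy
    rw [d2_eq hy]; exact hasDerivAt_line2 hy
  · have := (C2_d1 (m := 1) h).differentiableAt (by simp)
    rw [d1_eq this]; exact hasDerivAt_line1 this
  · have := (C2_d2 (m := 1) h).differentiableAt (by simp)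
    rw [d2_eq this]; exact hasDerivAt_line2 this

lemma Lop_lin {w φ : ℝ × ℝ → ℝ} {z : ℝ × ℝ} (n : ℕ) (hw : ContDiffAt ℝ 2 w z)
    (hφ : ContDiffAt ℝ 2 φ z) (c : ℝ) :
    Lop n (fun y => w y + c * φ y) z = Lop n w z + c * Lop n φ z := by
  obtain ⟨a1, a2, a3, a4⟩ := C2_ders hw
  obtain ⟨b1, b2, b3, b4⟩ := C2_ders hφ
  rw [Lop_eq n (w1 := fun y => d1 w y + c * d1 φ y) (w2 := fun y => d2 w y + c * d2 φ y)
    (w11 := d1 (d1 w) z + c * d1 (d1 φ) z) (w22 := d2 (d2 w) z + c * d2 (d2 φ) z)]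
  · unfold Lop; ring
  · filter_upwards [a1, b1] with y h h' using h.add (h'.const_mul c)
  · filter_upwards [a2, b2] with y h h' using h.add (h'.const_mul c)
  · exact a3.add (b3.const_mul c)
  · exact a4.add (b4.const_mul c)

lemma second_deriv_nonpos {f f' : ℝ → ℝ} {x f'' : ℝ} (h1 : ∀ᶠ y in 𝓝 x, HasDerivAt f (f' y) y)
    (h2 : HasDerivAt f' f'' x) (hm : IsLocalMax f x) : f' x = 0 ∧ f'' ≤ 0 := by
  have h0 : f' x = 0 := hm.hasDerivAt_eq_zero h1.self_of_nhds
  refine ⟨h0, ?_⟩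
  by_contra hpos
  push Not at hpos
  have e : deriv f =ᶠ[𝓝 x] f' := by filter_upwards [h1] with y hy using hy.deriv
  have e2 : deriv (deriv f) x = f'' := by rw [e.deriv_eq]; exact h2.deriv
  have hmin : IsLocalMin f x := isLocalMin_of_deriv_deriv_pos (by rw [e2]; exact hpos)
    (by rw [e.self_of_nhds, h0]) h1.self_of_nhds.continuousAt
  have hc : f =ᶠ[𝓝 x] fun _ => f x := by
    filter_upwards [hm, hmin] with y a b using le_antisymm a b
  have : deriv f =ᶠ[𝓝 x] fun _ => 0 := by
    filter_upwards [hc.eventually_nhds] with y hy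
    rw [Filter.EventuallyEq.deriv_eq hy]; simp
  rw [this.deriv_eq] at e2
  simp at e2
  linarith

lemma Lop_le_zero_of_max {w : ℝ × ℝ → ℝ} {z : ℝ × ℝ} (n : ℕ) (h : ContDiffAt ℝ 2 w z)
    (hz : 0 ≤ z.1) (hm : IsLocalMax w z) : Lop n w z ≤ 0 := by
  obtain ⟨a1, a2, a3, a4⟩ := C2_ders h
  have r1 := second_deriv_nonpos (f := fun s => w (s, z.2)) (f' := fun s => d1 w (s, z.2))
    ((tend_line1 z).eventually a1) a3 (hm.comp_tendsto (g := fun s => (s, z.2)) (tend_line1 z))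
  have r2 := second_deriv_nonpos (f := fun s => w (z.1, s)) (f' := fun s => d2 w (z.1, s))
    ((tend_line2 z).eventually a2) a4 (hm.comp_tendsto (g := fun s => (z.1, s)) (tend_line2 z))
  unfold Lop
  have : d1 w z = 0 := r1.1
  rw [this]
  nlinarith [r1.2, r2.2]

end HP

namespace HP
def Visc (n : ℕ) (W G : ℝ × ℝ → ℝ) (E : Set (ℝ × ℝ)) : Prop :=
  ∀ z0 ∈ E, ∀ φ : ℝ × ℝ → ℝ, ContDiffAt ℝ 2 φ z0 → IsLocalMax (fun z => W z - φ z) z0 →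
    -G z0 ≤ Lop n φ z0

def Apx (n : ℕ) (a F : ℝ × ℝ → ℝ) : Prop :=
  ∀ K : Set (ℝ × ℝ), K ⊆ P → IsCompact K → ∀ ε > 0, ∃ w : ℝ × ℝ → ℝ,
    (∀ z ∈ P, ContDiffAt ℝ 2 w z) ∧ ∀ z ∈ K, |w z - a z| ≤ ε ∧ |Lop n w z + F z| ≤ ε

lemma Lop_quad (n : ℕ) (z0 z : ℝ × ℝ) :
    Lop n (fun y => (y.1 - z0.1)^2 + (y.2 - z0.2)^2) z = 4 * z.1 + 2 * n * (z.1 - z0.1) := by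
  rw [Lop_eq n (w1 := fun y => 2 * (y.1 - z0.1)) (w2 := fun y => 2 * (y.2 - z0.2)) (w11 := 2)
    (w22 := 2)]
  · ring
  · refine Eventually.of_forall fun y => ?_
    have := (((hasDerivAt_id y.1).sub_const z0.1).pow 2).add_const ((y.2 - z0.2)^2)
    simpa using this
  · refine Eventually.of_forall fun y => ?_
    have := (((hasDerivAt_id y.2).sub_const z0.2).pow 2).const_add ((y.1 - z0.1)^2)
    simpa using this
  · simpa using ((hasDerivAt_id z.1).sub_const z0.1).const_mul 2
  · simpa using ((hasDerivAt_id z.2).sub_const z0.2).const_mul 2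

lemma Apx.visc {n : ℕ} {a F : ℝ × ℝ → ℝ} (h : Apx n a F) (hF : ContinuousOn F P) :
    Visc n a F P := by
  intro z0 hz0 φ hφ hmax
  by_contra hcon
  push Not at hcon
  have hz0' : 0 < z0.1 := hz0
  set gap := -F z0 - Lop n φ z0 with hgap
  have hgp : 0 < gap := by linarith
  set c := gap / (8 * z0.1) with hc
  have hcpos : 0 < c := by positivity
  set Qd : ℝ × ℝ → ℝ := fun y => (y.1 - z0.1)^2 + (y.2 - z0.2)^2 with hQ
  have hQs : ContDiff ℝ 2 Qd := by rw [hQ]; fun_prop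
  set φ' : ℝ × ℝ → ℝ := fun y => φ y + c * Qd y with hφ'
  have hφ's : ContDiffAt ℝ 2 φ' z0 := hφ.add (contDiffAt_const.mul hQs.contDiffAt)
  have hL0 : Lop n φ' z0 = Lop n φ z0 + gap / 2 := by
    rw [hφ', Lop_lin n hφ hQs.contDiffAt, hQ, Lop_quad, hc]
    field_simp; ring
  have hcont : ContinuousAt (fun z => Lop n φ' z + F z) z0 :=
    (Lop_contAt n hφ's).add (hF.continuousAt (isOpen_P.mem_nhds hz0))
  have ev1 : ∀ᶠ z in 𝓝 z0, Lop n φ' z + F z < -(gap/4) := by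
    refine hcont.eventually_lt continuousAt_const ?_
    show Lop n φ' z0 + F z0 < -(gap/4)
    rw [hL0]; linarith
  have ev2 : ∀ᶠ z in 𝓝 z0, z ∈ P := isOpen_P.mem_nhds hz0
  have ev3 : ∀ᶠ z in 𝓝 z0, ContDiffAt ℝ 2 φ' z := hφ's.eventually (by simp)
  obtain ⟨δ, hδ, hball⟩ := Metric.eventually_nhds_iff_ball.1 (((ev1.and ev2).and ev3).and hmax)
  set K := Metric.closedBall z0 (δ/2) with hK
  have hKs : ∀ z ∈ K, z ∈ Metric.ball z0 δ := fun z hz =>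
    Metric.closedBall_subset_ball (by linarith) hz
  have hKc : IsCompact K := isCompact_closedBall _ _
  obtain ⟨w, hw, hwK⟩ := h K (fun z hz => (hball z (hKs z hz)).1.1.2) hKc
    (min (gap/8) (c * (δ/2)^2 / 4)) (by positivity)
  have hcw : ContinuousOn (fun z => w z - φ' z) K := by
    intro z hz
    have h1 := (hw z (hball z (hKs z hz)).1.1.2).continuousAt
    have h2 := (hball z (hKs z hz)).1.2.continuousAt
    exact (h1.sub h2).continuousWithinAt
  have hz0K : z0 ∈ K := Metric.mem_closedBall_self (by linarith)
  obtain ⟨z1, hz1, hz1m⟩ := hKc.exists_isMaxOn ⟨z0, hz0K⟩ hcw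
  have hz1b := hball z1 (hKs z1 hz1)
  have hlt : dist z1 z0 < δ/2 := by
    by_contra hge
    push Not at hge
    have e0 := hz1m hz0K
    simp only [mem_ofPred_eq] at e0
    have k0 := (hwK z0 hz0K).1
    have k1 := (hwK z1 hz1).1
    have m1 := hz1b.2
    simp only at m1
    have hq : (δ/2)^2 ≤ Qd z1 := by
      rw [Prod.dist_eq, Real.dist_eq, Real.dist_eq] at hge
      rcases le_max_iff.1 hge with h | h
      · have : (δ/2)^2 ≤ (z1.1 - z0.1)^2 := by
          rw [← sq_abs (z1.1 - z0.1)]; exact pow_le_pow_left₀ (by linarith) h 2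
        simp only [hQ]; nlinarith [sq_nonneg (z1.2 - z0.2)]
      · have : (δ/2)^2 ≤ (z1.2 - z0.2)^2 := by
          rw [← sq_abs (z1.2 - z0.2)]; exact pow_le_pow_left₀ (by linarith) h 2
        simp only [hQ]; nlinarith [sq_nonneg (z1.1 - z0.1)]
    have hq0 : Qd z0 = 0 := by simp [hQ]
    have hcq : c * (δ/2)^2 ≤ c * Qd z1 := mul_le_mul_of_nonneg_left hq hcpos.le
    simp only [hφ', hq0] at e0
    have := abs_le.1 k0
    have := abs_le.1 k1
    have hm : min (gap/8) (c * (δ/2)^2 / 4) ≤ c * (δ/2)^2 / 4 := min_le_right _ _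
    have : 0 < c * (δ/2)^2 := by positivity
    linarith
  have hloc : IsLocalMax (fun z => w z - φ' z) z1 := by
    have : K ∈ 𝓝 z1 := Metric.closedBall_mem_nhds_of_mem (Metric.mem_ball.2 hlt)
    filter_upwards [this] with z hz using hz1m hz
  have hs1 := hw z1 hz1b.1.1.2
  have hLle := Lop_le_zero_of_max n (hs1.sub hz1b.1.2) (le_of_lt hz1b.1.1.2) hloc
  have e : (fun z => w z - φ' z) = fun z => w z + (-1) * φ' z := by ext; ring
  rw [e, Lop_lin n hs1 hz1b.1.2] at hLle
  have := abs_le.1 (hwK z1 hz1).2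
  have hm : min (gap/8) (c * (δ/2)^2 / 4) ≤ gap/8 := min_le_left _ _
  have := hz1b.1.1.1
  linarith

lemma Visc.mono {n : ℕ} {W G G' : ℝ × ℝ → ℝ} {E E' : Set (ℝ × ℝ)} (h : Visc n W G E)
    (hE : E' ⊆ E) (hG : ∀ z ∈ E', G z ≤ G' z) : Visc n W G' E' := by
  intro z0 hz φ hφ hm
  have := h z0 (hE hz) φ hφ hm
  linarith [hG z0 hz]

/-- adding a C2 function -/
lemma Visc.add_smooth {n : ℕ} {W G ψ : ℝ × ℝ → ℝ} {E : Set (ℝ × ℝ)} (h : Visc n W G E)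
    (hψ : ∀ z ∈ E, ContDiffAt ℝ 2 ψ z) (c : ℝ) :
    Visc n (fun z => W z + c * ψ z) (fun z => G z - c * Lop n ψ z) E := by
  intro z0 hz φ hφ hm
  have h1 : ContDiffAt ℝ 2 (fun z => φ z + (-c) * ψ z) z0 :=
    hφ.add (contDiffAt_const.mul (hψ z0 hz))
  have := h z0 hz _ h1 (by
    convert hm using 2
    ring)
  rw [Lop_lin n hφ (hψ z0 hz)] at this
  linarith

lemma Lop_log (n : ℕ) {z : ℝ × ℝ} (hz : 0 < z.1) :
    Lop n (fun y => Real.log y.1 + y.1) z = (n - 1) / z.1 + n := by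
  have ev : ∀ᶠ y in 𝓝 z, y ∈ P := isOpen_P.mem_nhds hz
  rw [Lop_eq n (w1 := fun y => (y.1)⁻¹ + 1) (w2 := fun y => 0) (w11 := -(z.1^2)⁻¹)
    (w22 := 0)]
  · field_simp; ring
  · filter_upwards [ev] with y hy
    exact (Real.hasDerivAt_log (ne_of_gt hy)).add (hasDerivAt_id y.1)
  · exact Eventually.of_forall fun y => hasDerivAt_const y.2 (Real.log y.1 + y.1)
  · exact (hasDerivAt_inv (ne_of_gt hz)).add_const 1
  · exact hasDerivAt_const _ _

/-- maximum principle; no boundary condition on the axis -/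
lemma MP {n : ℕ} (hn : 1 ≤ n) {E : Set (ℝ × ℝ)} (hE : IsOpen E) (hEP : E ⊆ P)
    (hEb : Bornology.IsBounded E) {W : ℝ × ℝ → ℝ} (hW : ContinuousOn W (closure E ∩ P))
    (hM : ∃ M, ∀ z ∈ E, W z ≤ M) (hfr : ∀ z ∈ frontier E, z ∈ P → W z ≤ 0)
    (hv : Visc n W (fun _ => 0) E) : ∀ z ∈ E, W z ≤ 0 := by
  intro z1 hz1
  by_contra hpos
  push Not at hpos
  obtain ⟨M0, hM0⟩ := hM
  obtain ⟨R, hR⟩ := hEb.subset_closedBall 0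
  have hcl : closure E ⊆ Metric.closedBall 0 R := closure_minimal hR Metric.isClosed_closedBall
  have hS : ∀ z ∈ closure E, z.1 ≤ R := by
    intro z hz
    have := hcl hz
    rw [Metric.mem_closedBall, dist_zero_right, Prod.norm_def] at this
    exact (le_abs_self _).trans ((le_max_left _ _).trans this)
  set M := max M0 0
  have hMc : ∀ z ∈ closure E, z ∈ P → W z ≤ M := by
    intro z hz hzP
    by_cases h : z ∈ E
    · exact (hM0 z h).trans (le_max_left _ _)
    · exact (hfr z ⟨hz, by rwa [hE.interior_eq]⟩ hzP).trans (le_max_right _ _)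
  have hz1P : 0 < z1.1 := hEP hz1
  have hz1c := subset_closure hz1
  have hRpos : 0 < R := hz1P.trans_le (hS z1 hz1c)
  set ℓ : ℝ × ℝ → ℝ := fun y => Real.log y.1 + y.1 with hℓ
  have hℓle : ∀ z ∈ closure E, z ∈ P → ℓ z ≤ 2 * R := by
    intro z hz hzP
    have := Real.log_le_self (le_of_lt hzP)
    have := hS z hz
    simp only [hℓ]; linarith
  obtain ⟨ε, hε, hεlt⟩ : ∃ ε > 0, 0 < W z1 + ε * (ℓ z1 - 2 * R) := by
    refine ⟨W z1 / (2 * (2 * R - ℓ z1 + 1)), ?_, ?_⟩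
    · have := hℓle z1 hz1c hz1P
      have : 0 < 2 * R - ℓ z1 + 1 := by linarith
      positivity
    · have := hℓle z1 hz1c hz1P
      have h3 : 0 < 2 * R - ℓ z1 + 1 := by linarith
      have : W z1 / (2 * (2 * R - ℓ z1 + 1)) * (ℓ z1 - 2 * R) = - (W z1 / 2) *
        ((2 * R - ℓ z1) / (2 * R - ℓ z1 + 1)) := by field_simp; ring
      rw [this]
      have : (2 * R - ℓ z1) / (2 * R - ℓ z1 + 1) ≤ 1 := by rw [div_le_one h3]; linarith
      nlinarith
  set We : ℝ × ℝ → ℝ := fun z => W z + ε * (ℓ z - 2 * R) with hWe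
  set δ := min (Real.exp (-M/ε)) z1.1 with hδ
  have hδpos : 0 < δ := lt_min (Real.exp_pos _) hz1P
  have hsmall : ∀ z ∈ closure E, z ∈ P → z.1 < δ → We z ≤ 0 := by
    intro z hz hzP hlt
    have h1 := hMc z hz hzP
    have h2 : Real.log z.1 ≤ -M/ε := by
      rw [Real.log_le_iff_le_exp hzP]
      exact hlt.le.trans (min_le_left _ _)
    have h3 := hS z hz
    have h4 : ε * Real.log z.1 ≤ -M := by
      calc ε * Real.log z.1 ≤ ε * (-M/ε) := mul_le_mul_of_nonneg_left h2 hε.le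
        _ = -M := by field_simp
    simp only [hWe, hℓ]
    nlinarith
  set K := closure E ∩ {z | δ ≤ z.1} with hK
  have hKc : IsCompact K :=
    ((isCompact_closedBall (0:ℝ×ℝ) R).of_isClosed_subset isClosed_closure hcl).inter_right
      (isClosed_le continuous_const continuous_fst)
  have hKP : ∀ z ∈ K, z ∈ P := fun z hz => hδpos.trans_le hz.2
  have hcont : ContinuousOn We K := by
    have h1 : ContinuousOn W K := hW.mono fun z hz => ⟨hz.1, hKP z hz⟩
    have h2 : ContinuousOn ℓ K := by
      refine ContinuousOn.add (ContinuousOn.log continuousOn_fst fun z hz => ?_) continuousOn_fst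
      exact ne_of_gt (hKP z hz)
    exact h1.add (continuousOn_const.mul (h2.sub continuousOn_const))
  have hz1K : z1 ∈ K := ⟨hz1c, show δ ≤ z1.1 from min_le_right _ _⟩
  obtain ⟨z0, hz0, hmax⟩ := hKc.exists_isMaxOn ⟨z1, hz1K⟩ hcont
  have hz0pos : 0 < We z0 := lt_of_lt_of_le hεlt (hmax hz1K)
  have hz0P := hKP z0 hz0
  have hz0E : z0 ∈ E := by
    by_contra hne
    have := hfr z0 ⟨hz0.1, by rwa [hE.interior_eq]⟩ hz0P
    have h2 := hℓle z0 hz0.1 hz0P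
    simp only [hWe] at hz0pos
    nlinarith
  have hℓs : ∀ z ∈ E, ContDiffAt ℝ 2 ℓ z := by
    intro z hz
    exact (contDiffAt_fst.log (ne_of_gt (hEP hz))).add contDiffAt_fst
  have hloc : IsLocalMax (fun z => W z - (-ε) * ℓ z) z0 := by
    filter_upwards [hE.mem_nhds hz0E] with z hz
    have : We z ≤ We z0 := by
      by_cases h : δ ≤ z.1
      · exact hmax ⟨subset_closure hz, h⟩
      · push Not at h
        exact (hsmall z (subset_closure hz) (hEP hz) h).trans hz0pos.le
    simp only [hWe] at this
    linarith
  have := hv z0 hz0E _ (contDiffAt_const.mul (hℓs z0 hz0E)) hloc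
  have e : (fun z => (-ε) * ℓ z) = fun z => (fun _ : ℝ × ℝ => (0:ℝ)) z + (-ε) * ℓ z := by ext; simp
  rw [e, Lop_lin n contDiffAt_const (hℓs z0 hz0E), hℓ, Lop_log n hz0P] at this
  have e0 : Lop n (fun _ : ℝ × ℝ => (0:ℝ)) z0 = 0 := by simp [Lop, d1, d2]
  rw [e0] at this
  have hn' : (1:ℝ) ≤ n := by exact_mod_cast hn
  have : 0 ≤ ((n:ℝ) - 1) / z0.1 := div_nonneg (by linarith) hz0P.le
  nlinarith

/-- system maximum principle -/
lemma MPsys {n : ℕ} (hn : 1 ≤ n) {E : Set (ℝ × ℝ)} (hE : IsOpen E) (hEP : E ⊆ P)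
    (hEb : Bornology.IsBounded E) {U V φ : ℝ × ℝ → ℝ} {C : ℝ} (hC : 0 ≤ C)
    (hU : ContinuousOn U (closure E ∩ P)) (hV : ContinuousOn V (closure E ∩ P))
    (hUM : ∃ M, ∀ z ∈ E, U z ≤ M) (hVM : ∃ M, ∀ z ∈ E, V z ≤ M)
    (hUfr : ∀ z ∈ frontier E, z ∈ P → U z ≤ 0) (hVfr : ∀ z ∈ frontier E, z ∈ P → V z ≤ 0)
    (hUv : Visc n U (fun z => C * max (V z) 0) E) (hVv : Visc n V (fun z => C * max (U z) 0) E)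
    (hφs : ∀ z ∈ P, ContDiffAt ℝ 2 φ z) (hφ1 : ∀ z ∈ closure E, z ∈ P → 1 ≤ φ z)
    (hφL : ∀ z ∈ E, 2 * C * φ z ≤ - Lop n φ z) :
    ∀ z ∈ E, U z ≤ 0 ∧ V z ≤ 0 := by
  -- one halving step
  have step : ∀ (A B : ℝ × ℝ → ℝ), ContinuousOn A (closure E ∩ P) → (∃ M, ∀ z ∈ E, A z ≤ M) →
      (∀ z ∈ frontier E, z ∈ P → A z ≤ 0) → Visc n A (fun z => C * max (B z) 0) E →
      ∀ m : ℝ, 0 ≤ m → (∀ z ∈ E, B z ≤ m * φ z) → ∀ z ∈ E, A z ≤ m / 2 * φ z := by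
    intro A B hA hAM hAfr hAv m hm hB
    have hpos : ∀ z ∈ E, 0 ≤ φ z := fun z hz => by
      linarith [hφ1 z (subset_closure hz) (hEP hz)]
    have := MP hn hE hEP hEb (W := fun z => A z + (-(m/2)) * φ z) ?_ ?_ ?_ ?_
    · intro z hz; have := this z hz; linarith
    · refine hA.add (continuousOn_const.mul fun z hz => ?_)
      exact (hφs z hz.2).continuousAt.continuousWithinAt
    · obtain ⟨M, hM⟩ := hAM
      exact ⟨M, fun z hz => by have := hM z hz; have := hpos z hz; nlinarith⟩
    · intro z hz hzP
      have := hAfr z hz hzP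
      have := hφ1 z (frontier_subset_closure hz) hzP
      nlinarith
    · refine (hAv.add_smooth (fun z hz => hφs z (hEP hz)) (-(m/2))).mono subset_rfl ?_
      intro z hz
      have h1 := hB z hz
      have h2 := hφL z hz
      have h3 : max (B z) 0 ≤ m * φ z := max_le h1 (mul_nonneg hm (hpos z hz))
      have h4 : C * max (B z) 0 ≤ C * (m * φ z) := mul_le_mul_of_nonneg_left h3 hC
      have h5 : m/2 * (2 * C * φ z) ≤ m/2 * (-Lop n φ z) := mul_le_mul_of_nonneg_left h2 (by linarith)
      nlinarith
  obtain ⟨M1, hM1⟩ := hUM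
  obtain ⟨M2, hM2⟩ := hVM
  set m := max (max M1 M2) 0
  have hm0 : 0 ≤ m := le_max_right _ _
  have key : ∀ k : ℕ, ∀ z ∈ E, U z ≤ m / 2^k * φ z ∧ V z ≤ m / 2^k * φ z := by
    intro k
    induction k with
    | zero =>
      intro z hz
      have := hφ1 z (subset_closure hz) (hEP hz)
      have h1 : U z ≤ m := (hM1 z hz).trans ((le_max_left _ _).trans (le_max_left _ _))
      have h2 : V z ≤ m := (hM2 z hz).trans ((le_max_right _ _).trans (le_max_left _ _))
      constructor <;> simp <;> nlinarith
    | succ k ih =>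
      intro z hz
      have hk : 0 ≤ m / 2^k := by positivity
      have e : m / 2^(k+1) = m / 2^k / 2 := by rw [pow_succ]; field_simp
      rw [e]
      exact ⟨step U V hU ⟨M1, hM1⟩ hUfr hUv _ hk (fun z hz => (ih z hz).2) z hz,
        step V U hV ⟨M2, hM2⟩ hVfr hVv _ hk (fun z hz => (ih z hz).1) z hz⟩
  intro z hz
  have hlim : Tendsto (fun k : ℕ => m / 2^k * φ z) atTop (𝓝 0) := by
    have : Tendsto (fun k : ℕ => (m * φ z) * (1/2:ℝ)^k) atTop (𝓝 ((m * φ z) * 0)) :=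
      (tendsto_pow_atTop_nhds_zero_of_lt_one (by norm_num) (by norm_num)).const_mul _
    rw [mul_zero] at this
    refine this.congr fun k => ?_
    rw [one_div, inv_pow]; field_simp
  exact ⟨ge_of_tendsto' hlim fun k => (key k z hz).1, ge_of_tendsto' hlim fun k => (key k z hz).2⟩

end HP

namespace HP
def dd (p z : ℝ × ℝ) : ℝ := (z.1 - p.1)^2 + (z.2 - p.2)^2

lemma dd_cont (p : ℝ × ℝ) : Continuous (dd p) := by unfold dd; fun_prop

lemma dd_exp_smooth (p : ℝ × ℝ) (α : ℝ) : ContDiff ℝ 2 (fun z => Real.exp (-α * dd p z)) := by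
  unfold dd; fun_prop

lemma Lop_exp_dd (n : ℕ) (p : ℝ × ℝ) (α : ℝ) (z : ℝ × ℝ) :
    Lop n (fun z => Real.exp (-α * dd p z)) z =
      α * Real.exp (-α * dd p z) * (z.1 * (4 * α * dd p z - 4) - 2 * n * (z.1 - p.1)) := by
  have h1 : ∀ y : ℝ × ℝ, HasDerivAt (fun s => -α * dd p (s, y.2)) (-α * (2 * (y.1 - p.1))) y.1 := by
    intro y
    unfold dd
    have := ((((hasDerivAt_id y.1).sub_const p.1).pow 2).add_const ((y.2 - p.2)^2)).const_mul (-α)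
    simpa using this
  have h2 : ∀ y : ℝ × ℝ, HasDerivAt (fun s => -α * dd p (y.1, s)) (-α * (2 * (y.2 - p.2))) y.2 := by
    intro y
    unfold dd
    have := ((((hasDerivAt_id y.2).sub_const p.2).pow 2).const_add ((y.1 - p.1)^2)).const_mul (-α)
    simpa using this
  rw [Lop_eq n (w1 := fun y => Real.exp (-α * dd p y) * (-α * (2 * (y.1 - p.1))))
    (w2 := fun y => Real.exp (-α * dd p y) * (-α * (2 * (y.2 - p.2))))
    (w11 := Real.exp (-α * dd p z) * (-α * (2 * (z.1 - p.1))) * (-α * (2 * (z.1 - p.1))) +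
      Real.exp (-α * dd p z) * (-α * 2))
    (w22 := Real.exp (-α * dd p z) * (-α * (2 * (z.2 - p.2))) * (-α * (2 * (z.2 - p.2))) +
      Real.exp (-α * dd p z) * (-α * 2))]
  · simp only [dd]; ring
  · exact Eventually.of_forall fun y => (h1 y).exp
  · exact Eventually.of_forall fun y => (h2 y).exp
  · have := (h1 z).exp.mul ((((hasDerivAt_id z.1).sub_const p.1).const_mul 2).const_mul (-α))
    exact this.congr_deriv (by simp)
  · have := (h2 z).exp.mul ((((hasDerivAt_id z.2).sub_const p.2).const_mul 2).const_mul (-α))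
    exact this.congr_deriv (by simp)

lemma spread {n : ℕ} (hn : 1 ≤ n) {E : Set (ℝ × ℝ)} (hE : IsOpen E) (hEP : E ⊆ P)
    {W : ℝ × ℝ → ℝ} (hW : ContinuousOn W E) (hW0 : ∀ z ∈ E, W z ≤ 0)
    (hv : Visc n W (fun _ => 0) E) {p : ℝ × ℝ} {R : ℝ} (hR : 0 < R)
    (hball : ∀ z, dd p z ≤ R^2 → z ∈ E) (hp : W p < 0) : ∀ z, dd p z < R^2 → W z < 0 := by
  have hpE : p ∈ E := hball p (by simp [dd]; positivity)
  have hS1 : 0 < p.1 - R := by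
    have : ((p.1 - R, p.2) : ℝ × ℝ) ∈ P := hEP (hball _ (by simp [dd]))
    exact this
  have hcp : ContinuousAt W p := hW.continuousAt (hE.mem_nhds hpE)
  have ev : ∀ᶠ z in 𝓝 p, W z < W p / 2 :=
    hcp.eventually_lt continuousAt_const (by linarith)
  obtain ⟨s', hs', hs'b⟩ := Metric.eventually_nhds_iff_ball.1 ev
  set s := min (s'/2) (R/2) with hs
  have hspos : 0 < s := by positivity
  have hsR : s < R := (min_le_right _ _).trans_lt (by linarith)
  set μ := -(W p / 2) with hμ
  have hμpos : 0 < μ := by rw [hμ]; linarith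
  have hin : ∀ z, dd p z ≤ s^2 → W z < -μ := by
    intro z hz
    have : z ∈ Metric.ball p s' := by
      rw [Metric.mem_ball, Prod.dist_eq, Real.dist_eq, Real.dist_eq]
      unfold dd at hz
      have h1 : |z.1 - p.1| ≤ s := abs_le_of_sq_le_sq (by nlinarith [sq_nonneg (z.2 - p.2)]) hspos.le
      have h2 : |z.2 - p.2| ≤ s := abs_le_of_sq_le_sq (by nlinarith [sq_nonneg (z.1 - p.1)]) hspos.le
      have h3 : s ≤ s'/2 := min_le_left _ _
      exact max_lt (by linarith) (by linarith)
    have := hs'b z this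
    rw [hμ]; linarith
  set A := {z : ℝ × ℝ | s^2 < dd p z ∧ dd p z < R^2} with hA
  have hAo : IsOpen A := (isOpen_lt continuous_const (dd_cont p)).inter
    (isOpen_lt (dd_cont p) continuous_const)
  have hAcl : closure A ⊆ {z | s^2 ≤ dd p z ∧ dd p z ≤ R^2} := by
    refine closure_minimal (fun z hz => ⟨hz.1.le, hz.2.le⟩) ?_
    exact (isClosed_le continuous_const (dd_cont p)).inter
      (isClosed_le (dd_cont p) continuous_const)
  have hAE : A ⊆ E := fun z hz => hball z hz.2.le
  have hclE : closure A ⊆ E := fun z hz => hball z (hAcl hz).2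
  have hAb : Bornology.IsBounded A := by
    refine (Metric.isBounded_closedBall (x := p) (r := R)).subset fun z hz => ?_
    rw [Metric.mem_closedBall, Prod.dist_eq, Real.dist_eq, Real.dist_eq]
    have hz2 := hz.2
    unfold dd at hz2
    exact max_le (abs_le_of_sq_le_sq (by nlinarith [sq_nonneg (z.2 - p.2)]) hR.le)
      (abs_le_of_sq_le_sq (by nlinarith [sq_nonneg (z.1 - p.1)]) hR.le)
  set S1 := p.1 - R
  set α := (4 + 2 * n * R / S1) / (4 * s^2) with hα
  have hαpos : 0 < α := by positivity
  set ψ : ℝ × ℝ → ℝ := fun z => -Real.exp (-α * R^2) + 1 * Real.exp (-α * dd p z) with hψ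
  have hψs : ∀ z, ContDiffAt ℝ 2 ψ z := fun z =>
    contDiffAt_const.add (contDiffAt_const.mul (dd_exp_smooth p α).contDiffAt)
  have hψL : ∀ z ∈ A, 0 ≤ Lop n ψ z := by
    intro z hz
    rw [hψ, Lop_lin n (w := fun _ => -Real.exp (-α * R^2)) contDiffAt_const
      (dd_exp_smooth p α).contDiffAt, Lop_exp_dd]
    have e0 : Lop n (fun _ : ℝ × ℝ => -Real.exp (-α * R^2)) z = 0 := by simp [Lop, d1, d2]
    rw [e0, zero_add, one_mul]
    have hz2 := hz.2
    unfold dd at hz2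
    have h1 : |z.1 - p.1| ≤ R := abs_le_of_sq_le_sq (by nlinarith [sq_nonneg (z.2 - p.2)]) hR.le
    obtain ⟨h1a, h1b⟩ := abs_le.1 h1
    have hzS : S1 ≤ z.1 := by simp only [S1]; linarith
    have hk : 2 * n * R / S1 ≤ 4 * α * dd p z - 4 := by
      have : 4 * α * s^2 = 4 + 2 * n * R / S1 := by rw [hα]; field_simp
      have : 4 * α * s^2 ≤ 4 * α * dd p z := mul_le_mul_of_nonneg_left hz.1.le (by positivity)
      linarith
    have hk0 : 0 ≤ 2 * n * R / S1 := by positivity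
    have : 2 * n * R ≤ z.1 * (4 * α * dd p z - 4) := by
      calc 2 * n * R = S1 * (2 * n * R / S1) := by field_simp
        _ ≤ z.1 * (4 * α * dd p z - 4) := mul_le_mul hzS hk hk0 (by linarith)
    have hn0 : (0:ℝ) ≤ n := Nat.cast_nonneg n
    have : 2 * n * (z.1 - p.1) ≤ 2 * n * R := mul_le_mul_of_nonneg_left h1b (by positivity)
    have := Real.exp_pos (-α * dd p z)
    exact mul_nonneg (by positivity) (by linarith)
  have hmp := MP hn hAo (hAE.trans hEP) hAb (W := fun z => W z + μ * ψ z) ?_ ?_ ?_ ?_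
  · intro z hz
    by_cases h : dd p z ≤ s^2
    · linarith [hin z h]
    · push Not at h
      have h1 := hmp z ⟨h, hz⟩
      have h2 : 0 < ψ z := by
        have : Real.exp (-α * R^2) < Real.exp (-α * dd p z) := by
          apply Real.exp_lt_exp.2; nlinarith
        simp only [hψ]; linarith
      have := mul_pos hμpos h2
      linarith
  · refine ContinuousOn.add (hW.mono fun z hz => hclE hz.1) (continuousOn_const.mul fun z hz => ?_)
    exact (hψs z).continuousAt.continuousWithinAt
  · refine ⟨μ, fun z hz => ?_⟩
    have h1 := hW0 z (hAE hz)
    have h2 : ψ z ≤ 1 := by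
      have h3 := Real.exp_pos (-α * R^2)
      have h4 : Real.exp (-α * dd p z) ≤ 1 := by
        apply Real.exp_le_one_iff.2
        have : 0 ≤ dd p z := by unfold dd; positivity
        nlinarith
      simp only [hψ]; linarith
    have := mul_le_mul_of_nonneg_left h2 hμpos.le
    linarith
  · intro z hz _
    have hc := hAcl (frontier_subset_closure hz)
    have hnot : z ∉ A := by
      have := hz.2; rwa [hAo.interior_eq] at this
    have h1 := hW0 z (hclE (frontier_subset_closure hz))
    by_cases hs2 : dd p z ≤ s^2
    · have := hin z hs2
      have h2 : ψ z ≤ 1 := by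
        have h3 := Real.exp_pos (-α * R^2)
        have h4 : Real.exp (-α * dd p z) ≤ 1 := by
          apply Real.exp_le_one_iff.2
          have : 0 ≤ dd p z := by unfold dd; positivity
          nlinarith
        simp only [hψ]; linarith
      have := mul_le_mul_of_nonneg_left h2 hμpos.le
      linarith
    · push Not at hs2
      have h3 : dd p z = R^2 := by
        refine le_antisymm hc.2 ?_
        by_contra hlt
        push Not at hlt
        exact hnot ⟨hs2, hlt⟩
      have : ψ z = 0 := by simp only [hψ]; rw [h3]; ring
      rw [this]; linarith
  · refine ((hv.mono hAE (G' := fun _ => 0) fun z hz => le_rfl).add_smooth (fun z _ => hψs z) μ).mono subset_rfl ?_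
    intro z hz
    have := mul_nonneg hμpos.le (hψL z hz)
    linarith

lemma SMP {n : ℕ} (hn : 1 ≤ n) {E : Set (ℝ × ℝ)} (hE : IsOpen E) (hEP : E ⊆ P)
    (hEc : IsPreconnected E)
    {W : ℝ × ℝ → ℝ} (hW : ContinuousOn W E) (hW0 : ∀ z ∈ E, W z ≤ 0)
    (hv : Visc n W (fun _ => 0) E) (hex : ∃ z ∈ E, W z < 0) : ∀ z ∈ E, W z < 0 := by
  set A := {z | z ∈ E ∧ W z < 0} with hA
  set B := {z | z ∈ E ∧ W z = 0} with hB
  have hAo : IsOpen A := by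
    rw [isOpen_iff_mem_nhds]
    intro z hz
    have : ∀ᶠ y in 𝓝 z, W y < 0 :=
      (hW.continuousAt (hE.mem_nhds hz.1)).eventually_lt continuousAt_const hz.2
    filter_upwards [this, hE.mem_nhds hz.1] with y h1 h2 using ⟨h2, h1⟩
  have hBo : IsOpen B := by
    rw [isOpen_iff_mem_nhds]
    intro q hq
    obtain ⟨r, hr, hrb⟩ := Metric.isOpen_iff.1 hE q hq.1
    filter_upwards [Metric.ball_mem_nhds q (show 0 < r/4 by linarith)] with p hp
    have hpE : p ∈ E := hrb (Metric.ball_subset_ball (by linarith) hp)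
    refine ⟨hpE, ?_⟩
    by_contra hne
    have hlt : W p < 0 := lt_of_le_of_ne (hW0 p hpE) hne
    have := spread hn hE hEP hW hW0 hv (p := p) (R := r/2) (by linarith) ?_ hlt q ?_
    · linarith [hq.2]
    · intro z hz
      apply hrb
      rw [Metric.mem_ball, Prod.dist_eq, Real.dist_eq, Real.dist_eq] at hp ⊢
      unfold dd at hz
      have h1 : |z.1 - p.1| ≤ r/2 := abs_le_of_sq_le_sq (by nlinarith [sq_nonneg (z.2 - p.2)]) (by linarith)
      have h2 : |z.2 - p.2| ≤ r/2 := abs_le_of_sq_le_sq (by nlinarith [sq_nonneg (z.1 - p.1)]) (by linarith)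
      have h3 := (max_lt_iff.1 hp).1
      have h4 := (max_lt_iff.1 hp).2
      rw [abs_le] at h1 h2
      rw [abs_lt] at h3 h4
      exact max_lt (abs_lt.2 ⟨by linarith, by linarith⟩) (abs_lt.2 ⟨by linarith, by linarith⟩)
    · rw [Metric.mem_ball, Prod.dist_eq, Real.dist_eq, Real.dist_eq] at hp
      have h3 := (max_lt_iff.1 hp).1
      have h4 := (max_lt_iff.1 hp).2
      have h5 : (p.1 - q.1)^2 < (r/4)^2 := sq_lt_sq' (abs_lt.1 h3).1 (abs_lt.1 h3).2
      have h6 : (p.2 - q.2)^2 < (r/4)^2 := sq_lt_sq' (abs_lt.1 h4).1 (abs_lt.1 h4).2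
      unfold dd
      nlinarith
  have hdis : Disjoint A B := by
    rw [Set.disjoint_left]
    intro z h1 h2
    linarith [h1.2, h2.2]
  obtain ⟨z1, hz1, hz1n⟩ := hex
  have hsub := hEc.subset_left_of_subset_union hAo hBo hdis (fun z hz => by
    rcases lt_or_eq_of_le (hW0 z hz) with h | h
    · exact Or.inl ⟨hz, h⟩
    · exact Or.inr ⟨hz, h⟩) ⟨z1, hz1, ⟨hz1, hz1n⟩⟩
  exact fun z hz => (hsub hz).2

end HP

namespace HP
lemma Apx.sub {n : ℕ} {a F b G : ℝ × ℝ → ℝ} (h : Apx n a F) (h' : Apx n b G) :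
    Apx n (fun z => a z - b z) (fun z => F z - G z) := by
  intro K hK hKc ε hε
  obtain ⟨w, hw, hwK⟩ := h K hK hKc (ε/2) (by linarith)
  obtain ⟨w', hw', hwK'⟩ := h' K hK hKc (ε/2) (by linarith)
  refine ⟨fun z => w z + (-1) * w' z, fun z hz => (hw z hz).add (contDiffAt_const.mul (hw' z hz)),
    fun z hz => ?_⟩
  have a1 := hwK z hz
  have a2 := hwK' z hz
  rw [Lop_lin n (hw z (hK hz)) (hw' z (hK hz))]
  simp only [abs_le] at *
  refine ⟨⟨?_, ?_⟩, ⟨?_, ?_⟩⟩ <;> linarith [a1.1.1, a1.1.2, a1.2.1, a1.2.2, a2.1.1, a2.1.2, a2.2.1, a2.2.2]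

lemma Apx.neg {n : ℕ} {a F : ℝ × ℝ → ℝ} (h : Apx n a F)  :
    Apx n (fun z => - a z) (fun z => - F z) := by
  intro K hK hKc ε hε
  obtain ⟨w, hw, hwK⟩ := h K hK hKc ε hε
  have e : ∀ z, Lop n (fun _ : ℝ × ℝ => (0:ℝ)) z = 0 := fun z => by simp [Lop, d1, d2]
  refine ⟨fun z => (fun _ => (0:ℝ)) z + (-1) * w z, fun z hz => contDiffAt_const.add
    (contDiffAt_const.mul (hw z hz)), fun z hz => ?_⟩
  have a1 := hwK z hz
  rw [Lop_lin n contDiffAt_const (hw z (hK hz)), e]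
  simp only [abs_le] at *
  refine ⟨⟨?_, ?_⟩, ⟨?_, ?_⟩⟩ <;> linarith [a1.1.1, a1.1.2, a1.2.1, a1.2.2]

lemma Lop_trans (n : ℕ) (w : ℝ × ℝ → ℝ) (c : ℝ) (z : ℝ × ℝ) :
    Lop n (fun y => w (y.1, y.2 + c)) z = Lop n w (z.1, z.2 + c) := by
  have e1 : d1 (fun y => w (y.1, y.2 + c)) = fun y => d1 w (y.1, y.2 + c) := by
    ext y; simp [d1]
  have e11 : d1 (fun y => d1 w (y.1, y.2 + c)) = fun y => d1 (d1 w) (y.1, y.2 + c) := by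
    ext y; simp [d1]
  have e2 : ∀ w : ℝ × ℝ → ℝ, d2 (fun y => w (y.1, y.2 + c)) = fun y => d2 w (y.1, y.2 + c) := by
    intro w
    ext y; simp only [d2]
    exact deriv_comp_add_const (fun s => w (y.1, s)) c y.2
  simp only [Lop, e1, e11, e2]

lemma Apx.trans {n : ℕ} {a F : ℝ × ℝ → ℝ} (h : Apx n a F) (c : ℝ) :
    Apx n (fun z => a (z.1, z.2 + c)) (fun z => F (z.1, z.2 + c)) := by
  intro K hK hKc ε hε
  have hcont : Continuous (fun z : ℝ × ℝ => ((z.1, z.2 + c) : ℝ × ℝ)) := by fun_prop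
  obtain ⟨w, hw, hwK⟩ := h ((fun z : ℝ × ℝ => ((z.1, z.2 + c) : ℝ × ℝ)) '' K)
    (by rintro _ ⟨z, hz, rfl⟩; exact (hK hz : z ∈ P)) (hKc.image hcont) ε hε
  refine ⟨fun z => w (z.1, z.2 + c), fun z hz => ?_, fun z hz => ?_⟩
  · have h1 : ContDiffAt ℝ 2 w (z.1, z.2 + c) := hw _ hz
    have h2 : ContDiffAt ℝ 2 (fun z : ℝ × ℝ => ((z.1, z.2 + c) : ℝ × ℝ)) z := by fun_prop
    exact ContDiffAt.comp z h1 h2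
  · rw [Lop_trans]
    exact hwK _ ⟨z, hz, rfl⟩

def qq (z : ℝ × ℝ) : ℝ := z.1^2 + z.2^2
def kap (κ : ℝ) (z : ℝ × ℝ) : ℝ × ℝ := (κ * z.1 / qq z, κ * z.2 / qq z)
def kel (n : ℕ) (κ : ℝ) (w : ℝ × ℝ → ℝ) (z : ℝ × ℝ) : ℝ := (κ / qq z) ^ ((n:ℝ)/2) * w (kap κ z)

lemma qq_pos {z : ℝ × ℝ} (hz : z ∈ P) : 0 < qq z := by
  have : 0 < z.1 := hz
  unfold qq; positivity
lemma qq_cont : Continuous qq := by unfold qq; fun_prop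

lemma chain2 {w : ℝ × ℝ → ℝ} {γ1 γ2 : ℝ → ℝ} {s g1 g2 : ℝ}
    (hw : DifferentiableAt ℝ w (γ1 s, γ2 s)) (h1 : HasDerivAt γ1 g1 s) (h2 : HasDerivAt γ2 g2 s) :
    HasDerivAt (fun s => w (γ1 s, γ2 s)) (d1 w (γ1 s, γ2 s) * g1 + d2 w (γ1 s, γ2 s) * g2) s := by
  have := HasFDerivAt.comp_hasDerivAt (f := fun s : ℝ => (γ1 s, γ2 s)) s hw.hasFDerivAt (h1.prodMk h2)
  refine this.congr_deriv ?_
  rw [d1_eq hw, d2_eq hw]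
  have e : ((g1, g2) : ℝ × ℝ) = g1 • ((1:ℝ), (0:ℝ)) + g2 • ((0:ℝ), (1:ℝ)) := by simp
  rw [e, map_add, map_smul, map_smul]
  simp [mul_comm]

lemma chain_second {w : ℝ × ℝ → ℝ} {γ1 γ2 g1 g2 M M' : ℝ → ℝ} {s M'' g11 g22 : ℝ}
    (hw : ContDiffAt ℝ 2 w (γ1 s, γ2 s)) (h1 : HasDerivAt γ1 (g1 s) s) (h2 : HasDerivAt γ2 (g2 s) s)
    (h11 : HasDerivAt g1 g11 s) (h22 : HasDerivAt g2 g22 s)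
    (hM : HasDerivAt M (M' s) s) (hM' : HasDerivAt M' M'' s) :
    HasDerivAt (fun s => M' s * w (γ1 s, γ2 s) +
        M s * (d1 w (γ1 s, γ2 s) * g1 s + d2 w (γ1 s, γ2 s) * g2 s))
      (M'' * w (γ1 s, γ2 s) + 2 * M' s * (d1 w (γ1 s, γ2 s) * g1 s + d2 w (γ1 s, γ2 s) * g2 s)
       + M s * (d1 (d1 w) (γ1 s, γ2 s) * g1 s ^2 + (d2 (d1 w) (γ1 s, γ2 s) + d1 (d2 w) (γ1 s, γ2 s))
          * (g1 s * g2 s) + d2 (d2 w) (γ1 s, γ2 s) * g2 s ^2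
          + d1 w (γ1 s, γ2 s) * g11 + d2 w (γ1 s, γ2 s) * g22)) s := by
  have k0 := chain2 (hw.differentiableAt (by simp)) h1 h2
  have k1 := chain2 ((C2_d1 (m := 1) hw).differentiableAt (by simp)) h1 h2
  have k2 := chain2 ((C2_d2 (m := 1) hw).differentiableAt (by simp)) h1 h2
  refine ((hM'.mul k0).add (hM.mul ((k1.mul h11).add (k2.mul h22)))).congr_deriv ?_
  simp only [Pi.add_apply, Pi.mul_apply]
  ring

/-- derivative facts for Kelvin data along a line; `s` moving coordinate, `t` fixed -/
lemma kd_M (p κ t s : ℝ) (hκ : 0 < κ) (hq : 0 < s^2 + t^2) :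
    HasDerivAt (fun s => (κ / (s^2+t^2)) ^ p) (-(2 * p * s / (s^2+t^2)) * (κ / (s^2+t^2)) ^ p) s := by
  have h0 : HasDerivAt (fun s : ℝ => s^2 + t^2) (2 * s) s := by
    simpa using (hasDerivAt_pow 2 s).add_const (t^2)
  have h1 : HasDerivAt (fun s : ℝ => κ / (s^2 + t^2)) (-(κ * (2 * s)) / (s^2+t^2)^2) s := by
    have := (hasDerivAt_const s κ).div h0 hq.ne'
    exact this.congr_deriv (by ring)
  have hpos : 0 < κ / (s^2+t^2) := by positivity
  refine (h1.rpow_const (p := p) (Or.inl hpos.ne')).congr_deriv ?_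
  rw [Real.rpow_sub hpos, Real.rpow_one]
  field_simp

lemma kd_M2 (p κ t s : ℝ) (hκ : 0 < κ) (hq : 0 < s^2 + t^2) :
    HasDerivAt (fun s => -(2 * p * s / (s^2+t^2)) * (κ / (s^2+t^2)) ^ p)
      ((-(2 * p / (s^2+t^2)) + 4 * p * s^2 / (s^2+t^2)^2 + 4 * p^2 * s^2/(s^2+t^2)^2)
        * (κ / (s^2+t^2)) ^ p) s := by
  have h0 : HasDerivAt (fun s : ℝ => s^2 + t^2) (2 * s) s := by
    simpa using (hasDerivAt_pow 2 s).add_const (t^2)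
  have h1 := (((hasDerivAt_id s).const_mul (2 * p)).div h0 hq.ne').neg.mul (kd_M p κ t s hκ hq)
  refine h1.congr_deriv ?_
  simp only [Pi.neg_apply, Pi.div_apply, id]
  field_simp; ring

lemma kd_a (κ t s : ℝ) (hq : 0 < s^2 + t^2) :
    HasDerivAt (fun s => κ * s / (s^2+t^2)) (κ * (t^2 - s^2) / (s^2+t^2)^2) s := by
  have h0 : HasDerivAt (fun s : ℝ => s^2 + t^2) (2 * s) s := by
    simpa using (hasDerivAt_pow 2 s).add_const (t^2)
  refine (((hasDerivAt_id s).const_mul κ).div h0 hq.ne').congr_deriv ?_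
  simp only [id]; field_simp; ring
lemma kd_b (κ t s : ℝ) (hq : 0 < s^2 + t^2) :
    HasDerivAt (fun s => κ * t / (s^2+t^2)) (κ * (-2 * s * t) / (s^2+t^2)^2) s := by
  have h0 : HasDerivAt (fun s : ℝ => s^2 + t^2) (2 * s) s := by
    simpa using (hasDerivAt_pow 2 s).add_const (t^2)
  refine ((hasDerivAt_const s (κ * t)).div h0 hq.ne').congr_deriv ?_
  field_simp; ring
lemma kd_aa (κ t s : ℝ) (hq : 0 < s^2 + t^2) :
    HasDerivAt (fun s => κ * (t^2 - s^2) / (s^2+t^2)^2)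
      (κ * (2 * s^3 - 6 * s * t^2) / (s^2+t^2)^3) s := by
  have h0 : HasDerivAt (fun s : ℝ => s^2 + t^2) (2 * s) s := by
    simpa using (hasDerivAt_pow 2 s).add_const (t^2)
  have h1 : HasDerivAt (fun s : ℝ => κ * (t^2 - s^2)) (κ * (-(2 * s))) s := by
    simpa using ((hasDerivAt_pow 2 s).const_sub (t^2)).const_mul κ
  refine (h1.div (h0.pow 2) (by simp; positivity)).congr_deriv ?_
  simp only [Pi.pow_apply]; field_simp; ring
lemma kd_bb (κ t s : ℝ) (hq : 0 < s^2 + t^2) :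
    HasDerivAt (fun s => κ * (-2 * s * t) / (s^2+t^2)^2)
      (κ * t * (6 * s^2 - 2 * t^2) / (s^2+t^2)^3) s := by
  have h0 : HasDerivAt (fun s : ℝ => s^2 + t^2) (2 * s) s := by
    simpa using (hasDerivAt_pow 2 s).add_const (t^2)
  have h1 : HasDerivAt (fun s : ℝ => κ * (-2 * s * t)) (κ * (-2 * t)) s := by
    simpa using (((hasDerivAt_id s).const_mul (-2)).mul_const t).const_mul κ
  refine (h1.div (h0.pow 2) (by simp; positivity)).congr_deriv ?_
  simp only [Pi.pow_apply]; field_simp; ring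

lemma kap_mem {κ : ℝ} (hκ : 0 < κ) {z : ℝ × ℝ} (hz : z ∈ P) : kap κ z ∈ P := by
  have h1 := qq_pos hz
  have h2 : 0 < z.1 := hz
  show 0 < κ * z.1 / qq z
  positivity

lemma kap_smooth {κ : ℝ} {z : ℝ × ℝ} (hz : 0 < qq z) : ContDiffAt ℝ 2 (kap κ) z := by
  have : ContDiffAt ℝ 2 qq z := by unfold qq; fun_prop
  unfold kap
  exact ((contDiffAt_const.mul contDiffAt_fst).div this hz.ne').prodMk
    ((contDiffAt_const.mul contDiffAt_snd).div this hz.ne')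

lemma kel_smooth {n : ℕ} {κ : ℝ} (hκ : 0 < κ) {w : ℝ × ℝ → ℝ} {z : ℝ × ℝ} (hz : 0 < qq z)
    (hw : ContDiffAt ℝ 2 w (kap κ z)) : ContDiffAt ℝ 2 (kel n κ w) z := by
  have : ContDiffAt ℝ 2 qq z := by unfold qq; fun_prop
  unfold kel
  refine ContDiffAt.mul ?_ (ContDiffAt.comp z hw (kap_smooth hz))
  exact (contDiffAt_const.div this hz.ne').rpow_const_of_ne (by have := div_pos hκ hz; exact this.ne')

lemma Lop_kel (n : ℕ) {κ : ℝ} (hκ : 0 < κ) {w : ℝ × ℝ → ℝ} {z : ℝ × ℝ} (hz : 0 < qq z)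
    (hw : ContDiffAt ℝ 2 w (kap κ z)) :
    Lop n (kel n κ w) z = (κ / qq z) ^ ((n:ℝ)/2) * (κ / qq z) * Lop n w (kap κ z) := by
  have ev : ∀ᶠ y in 𝓝 z, 0 < qq y ∧ DifferentiableAt ℝ w (kap κ y) :=
    (continuousAt_const.eventually_lt qq_cont.continuousAt hz).and
      ((kap_smooth hz).continuousAt.eventually (C2_ev_diff (m := 1) hw))
  set p : ℝ := (n:ℝ)/2 with hp
  have hq2 : 0 < z.2^2 + z.1^2 := by unfold qq at hz; linarith
  set w1 : ℝ × ℝ → ℝ := fun y => (-(2 * p * y.1 / (y.1^2+y.2^2)) * (κ / (y.1^2+y.2^2)) ^ p) * w (kap κ y)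
      + (κ / (y.1^2+y.2^2)) ^ p * (d1 w (kap κ y) * (κ * (y.2^2 - y.1^2) / (y.1^2+y.2^2)^2) +
        d2 w (kap κ y) * (κ * (-2 * y.1 * y.2) / (y.1^2+y.2^2)^2)) with hw1
  set w2 : ℝ × ℝ → ℝ := fun y => (-(2 * p * y.2 / (y.2^2+y.1^2)) * (κ / (y.2^2+y.1^2)) ^ p) * w (kap κ y)
      + (κ / (y.2^2+y.1^2)) ^ p * (d1 w (kap κ y) * (κ * (-2 * y.2 * y.1) / (y.2^2+y.1^2)^2) +
        d2 w (kap κ y) * (κ * (y.1^2 - y.2^2) / (y.2^2+y.1^2)^2)) with hw2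
  have H1 : ∀ᶠ y in 𝓝 z, HasDerivAt (fun s => kel n κ w (s, y.2)) (w1 y) y.1 := by
    filter_upwards [ev] with y hy
    have h := chain2 (γ1 := fun s => κ * s / (s^2+y.2^2)) (γ2 := fun s => κ * y.2 / (s^2+y.2^2))
      (s := y.1) hy.2 (kd_a κ y.2 y.1 hy.1) (kd_b κ y.2 y.1 hy.1)
    exact (kd_M p κ y.2 y.1 hκ hy.1).mul h
  have H2 : ∀ᶠ y in 𝓝 z, HasDerivAt (fun s => kel n κ w (y.1, s)) (w2 y) y.2 := by
    filter_upwards [ev] with y hy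
    have hq : 0 < y.2^2 + y.1^2 := by have := hy.1; unfold qq at this; linarith
    have e1 : kap κ y = (κ * y.1 / (y.2^2+y.1^2), κ * y.2 / (y.2^2+y.1^2)) := by
      simp only [kap, qq]; rw [add_comm (y.1^2)]
    have h := chain2 (γ1 := fun s => κ * y.1 / (s^2+y.1^2)) (γ2 := fun s => κ * s / (s^2+y.1^2))
      (s := y.2) (e1 ▸ hy.2) (kd_b κ y.1 y.2 hq) (kd_a κ y.1 y.2 hq)
    have h2 := (kd_M p κ y.1 y.2 hκ hq).mul h
    simp only [← e1] at h2
    refine h2.congr_of_eventuallyEq (Eventually.of_forall fun s => ?_)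
    simp only [kel, kap, qq, Pi.mul_apply, hp]
    rw [add_comm (y.1^2)]
  have H11 := chain_second (w := w) (γ1 := fun s => κ * s / (s^2+z.2^2)) (γ2 := fun s => κ * z.2 / (s^2+z.2^2))
      (g1 := fun s => κ * (z.2^2 - s^2) / (s^2+z.2^2)^2)
      (g2 := fun s => κ * (-2 * s * z.2) / (s^2+z.2^2)^2)
      (M := fun s => (κ / (s^2+z.2^2)) ^ p)
      (M' := fun s => -(2 * p * s / (s^2+z.2^2)) * (κ / (s^2+z.2^2)) ^ p)
      (s := z.1) hw (kd_a κ z.2 z.1 hz) (kd_b κ z.2 z.1 hz)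
      (kd_aa κ z.2 z.1 hz) (kd_bb κ z.2 z.1 hz) (kd_M p κ z.2 z.1 hκ hz) (kd_M2 p κ z.2 z.1 hκ hz)
  have e1 : ∀ s, kap κ (z.1, s) = (κ * z.1 / (s^2+z.1^2), κ * s / (s^2+z.1^2)) := by
    intro s; simp only [kap, qq]; rw [add_comm (z.1^2)]
  have H22 := chain_second (w := w) (γ1 := fun s => κ * z.1 / (s^2+z.1^2)) (γ2 := fun s => κ * s / (s^2+z.1^2))
    (g1 := fun s => κ * (-2 * s * z.1) / (s^2+z.1^2)^2)
    (g2 := fun s => κ * (z.1^2 - s^2) / (s^2+z.1^2)^2)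
    (M := fun s => (κ / (s^2+z.1^2)) ^ p)
    (M' := fun s => -(2 * p * s / (s^2+z.1^2)) * (κ / (s^2+z.1^2)) ^ p)
    (s := z.2) (by rw [← e1]; exact hw) (kd_b κ z.1 z.2 hq2) (kd_a κ z.1 z.2 hq2)
    (kd_bb κ z.1 z.2 hq2) (kd_aa κ z.1 z.2 hq2) (kd_M p κ z.1 z.2 hκ hq2) (kd_M2 p κ z.1 z.2 hκ hq2)
  simp only [← e1] at H22
  rw [Lop_eq (w1 := w1) (w2 := w2) n H1 H2 H11 H22]
  have e2 : z.2^2 + z.1^2 = z.1^2 + z.2^2 := add_comm _ _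
  have e3 : ((κ * z.1 / (z.1^2+z.2^2), κ * z.2 / (z.1^2+z.2^2)) : ℝ × ℝ) = kap κ z := rfl
  have hq' : 0 < z.1^2 + z.2^2 := hz
  have e4 : (n:ℝ) = 2 * p := by rw [hp]; ring
  simp only [hw1, e2, e3, Lop, e4]
  simp only [qq, kap]
  set M := (κ / (z.1^2+z.2^2)) ^ p
  generalize d1 (d1 w) _ = A11
  generalize d2 (d2 w) _ = A22
  generalize d2 (d1 w) _ = A12
  generalize d1 (d2 w) _ = A21
  generalize d1 w _ = A1
  generalize d2 w _ = A2
  field_simp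
  ring

lemma Apx.kel {n : ℕ} {a F : ℝ × ℝ → ℝ} (h : Apx n a F) {κ : ℝ} (hκ : 0 < κ) :
    Apx n (kel n κ a) (fun z => (κ / qq z) ^ ((n:ℝ)/2) * (κ / qq z) * F (kap κ z)) := by
  intro K hK hKc ε hε
  have hkc : ContinuousOn (kap κ) K := fun z hz =>
    (kap_smooth (qq_pos (hK hz))).continuousAt.continuousWithinAt
  have hMc : ContinuousOn (fun z => (κ / qq z) ^ ((n:ℝ)/2) + (κ / qq z) ^ ((n:ℝ)/2) * (κ / qq z)) K := by
    have h1 : ContinuousOn (fun z => κ / qq z) K :=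
      continuousOn_const.div qq_cont.continuousOn fun z hz => (qq_pos (hK hz)).ne'
    have h2 : ContinuousOn (fun z => (κ / qq z) ^ ((n:ℝ)/2)) K :=
      h1.rpow_const fun z hz => Or.inl (by have := qq_pos (hK hz); positivity)
    exact h2.add (h2.mul h1)
  obtain ⟨B, hB⟩ := (hKc.bddAbove_image hMc)
  have hB' : ∀ z ∈ K, (κ / qq z) ^ ((n:ℝ)/2) + (κ / qq z) ^ ((n:ℝ)/2) * (κ / qq z) ≤ |B| + 1 :=
    fun z hz => (hB ⟨z, hz, rfl⟩).trans ((le_abs_self B).trans (by linarith))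
  obtain ⟨w, hw, hwK⟩ := h (kap κ '' K) (by rintro _ ⟨z, hz, rfl⟩; exact kap_mem hκ (hK hz))
    (hKc.image_of_continuousOn hkc) (ε / (|B|+1)) (by positivity)
  refine ⟨HP.kel n κ w, fun z hz => kel_smooth hκ (qq_pos hz) (hw _ (kap_mem hκ hz)), fun z hz => ?_⟩
  have hq := qq_pos (hK hz)
  rw [Lop_kel n hκ hq (hw _ (kap_mem hκ (hK hz)))]
  have h1 := hwK _ ⟨z, hz, rfl⟩
  have h2 := hB' z hz
  have h3 : 0 < (κ / qq z) ^ ((n:ℝ)/2) := by positivity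
  have h4 : 0 < (κ / qq z) ^ ((n:ℝ)/2) * (κ / qq z) := by positivity
  have hBp : 0 < |B| + 1 := by positivity
  have e : (|B|+1) * (ε / (|B|+1)) = ε := by field_simp
  constructor
  · unfold HP.kel
    rw [← mul_sub, abs_mul, abs_of_pos h3, ← e]
    exact mul_le_mul (by linarith) h1.1 (abs_nonneg _) hBp.le
  · rw [← mul_add, abs_mul, abs_of_pos h4, ← e]
    exact mul_le_mul (by linarith) h1.2 (abs_nonneg _) hBp.le

end HP

namespace HP
def ta (n : ℕ) : ℝ := (2 * (n : ℝ) + 4) / (2 * (n : ℝ))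

structure NL (n : ℕ) (f : ℝ → ℝ) : Prop where
  cont : ContinuousOn f (Set.Ici 0)
  mono : ∀ s t : ℝ, 0 < s → s ≤ t → f s ≤ f t
  anti : ∀ s t : ℝ, 0 < s → s ≤ t → f t / t ^ ta n ≤ f s / s ^ ta n

lemma ta_one {n : ℕ} (hn : 1 ≤ n) : 1 < ta n := by
  have : (1:ℝ) ≤ n := by exact_mod_cast hn
  unfold ta
  rw [lt_div_iff₀ (by linarith)]; linarith

lemma NL.nonneg {n : ℕ} (hn : 1 ≤ n) {f : ℝ → ℝ} (h : NL n f) {s : ℝ} (hs : 0 < s) : 0 ≤ f s := by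
  by_contra hneg
  push Not at hneg
  have h1 := h.mono (s/2) s (by linarith) (by linarith)
  have h2 := h.anti (s/2) s (by linarith) (by linarith)
  have h3 : 0 < (s/2) ^ ta n := by positivity
  have h4 : (s/2) ^ ta n < s ^ ta n :=
    Real.rpow_lt_rpow (by linarith) (by linarith) (by linarith [ta_one hn])
  have h5 : f (s/2) / (s/2) ^ ta n ≤ f s / (s/2) ^ ta n := by gcongr
  have h6 : f s / (s/2) ^ ta n < f s / s ^ ta n := by
    rw [div_lt_div_iff₀ h3 (by linarith)]
    nlinarith
  linarith

lemma NL.dich {n : ℕ} (hn : 1 ≤ n) {f : ℝ → ℝ} (h : NL n f) :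
    (∀ s, 0 < s → 0 < f s) ∨ (∀ s, 0 < s → f s = 0) := by
  by_cases h0 : ∃ s0, 0 < s0 ∧ f s0 = 0
  · right
    obtain ⟨s0, hs0, hf⟩ := h0
    intro s hs
    refine le_antisymm ?_ (h.nonneg hn hs)
    rcases le_total s s0 with hle | hle
    · rw [← hf]; exact h.mono s s0 hs hle
    · have := h.anti s0 s hs0 hle
      rw [hf, zero_div] at this
      have hp : 0 < s ^ ta n := by positivity
      by_contra hc
      push Not at hc
      have := div_pos hc hp
      linarith
  · left
    push Not at h0
    intro s hs
    exact lt_of_le_of_ne (h.nonneg hn hs) (Ne.symm (h0 s hs))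

lemma NL.scale {n : ℕ} {f : ℝ → ℝ} (h : NL n f) {r y : ℝ} (hr : 1 ≤ r) (hy : 0 < y) :
    f (r * y) ≤ r ^ ta n * f y := by
  have h1 := h.anti y (r * y) hy (by nlinarith)
  have hp : 0 < y ^ ta n := by positivity
  have hrp : 0 < r ^ ta n := by positivity
  rw [Real.mul_rpow (by linarith) hy.le, div_le_div_iff₀ (by positivity) hp] at h1
  have : f (r * y) * y ^ ta n ≤ (r ^ ta n * f y) * y ^ ta n := by linarith
  exact le_of_mul_le_mul_right this hp

lemma NL.lip {n : ℕ} (hn : 1 ≤ n) {f : ℝ → ℝ} (h : NL n f) {c0 : ℝ} (hc0 : 0 < c0) (B : ℝ) :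
    ∃ C, 0 ≤ C ∧ ∀ x y, 0 < x → c0 ≤ y → x ≤ B → f x - f y ≤ C * max (x - y) 0 := by
  have hτ := ta_one hn
  have hf0 := h.nonneg hn hc0
  refine ⟨f c0 / c0 ^ ta n * (ta n * |B| ^ ta n / c0), by positivity, ?_⟩
  intro x y hx hy hxB
  have hypos : 0 < y := by linarith
  rcases le_total x y with hxy | hxy
  · rw [max_eq_right (by linarith), mul_zero]
    linarith [h.mono x y hx hxy]
  · rw [max_eq_left (by linarith)]
    have hfy := h.nonneg hn hypos
    have hyp : 0 < y ^ ta n := by positivity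
    have hxp : 0 < x ^ ta n := by positivity
    have hA := h.anti y x hypos hxy
    have hA2 := h.anti c0 y hc0 hy
    set H := f y / y ^ ta n with hH
    have e1 : f y = H * y ^ ta n := by rw [hH]; field_simp
    have e2 : f x ≤ H * x ^ ta n := by
      rw [div_le_iff₀ hxp] at hA; exact hA
    have hH0 : 0 ≤ H := by positivity
    have hb := one_add_mul_self_le_rpow_one_add (s := y / x - 1) (by
      have : 0 ≤ y / x := by positivity
      linarith) hτ.le
    have e3 : (1 + (y/x - 1)) ^ ta n = y ^ ta n / x ^ ta n := by
      rw [add_sub_cancel, Real.div_rpow hypos.le hx.le]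
    rw [e3, le_div_iff₀ hxp] at hb
    have e4 : x ^ ta n - y ^ ta n ≤ ta n * |B| ^ ta n / c0 * (x - y) := by
      have k1 : x ^ ta n - y ^ ta n ≤ ta n * (x ^ ta n * ((x - y) / x)) := by
        have : (1 + ta n * (y / x - 1)) * x ^ ta n = x ^ ta n - ta n * (x ^ ta n * ((x - y) / x)) := by
          field_simp; ring
        linarith
      have k2 : x ^ ta n ≤ |B| ^ ta n :=
        Real.rpow_le_rpow hx.le (hxB.trans (le_abs_self B)) (by linarith)
      have k3 : (x - y) / x ≤ (x - y) / c0 := by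
        apply div_le_div_of_nonneg_left (by linarith) hc0 (by linarith)
      have k4 : x ^ ta n * ((x - y) / x) ≤ |B| ^ ta n * ((x - y) / c0) :=
        mul_le_mul k2 k3 (div_nonneg (by linarith) hx.le) (by positivity)
      have k5 := mul_le_mul_of_nonneg_left k4 (show 0 ≤ ta n by linarith)
      calc _ ≤ _ := k1
        _ ≤ _ := k5
        _ = _ := by ring
    have e5 : f x - f y ≤ H * (x ^ ta n - y ^ ta n) := by rw [e1]; linarith
    have e6 : 0 ≤ ta n * |B| ^ ta n / c0 * (x - y) :=
      mul_nonneg (by positivity) (by linarith)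
    calc f x - f y ≤ H * (x ^ ta n - y ^ ta n) := e5
      _ ≤ H * (ta n * |B| ^ ta n / c0 * (x - y)) := mul_le_mul_of_nonneg_left e4 hH0
      _ ≤ f c0 / c0 ^ ta n * (ta n * |B| ^ ta n / c0 * (x - y)) := mul_le_mul_of_nonneg_right hA2 e6
      _ = _ := by ring

lemma Lop_exp_S (n : ℕ) (b : ℝ) (z : ℝ × ℝ) :
    Lop n (fun z => Real.exp (-b * z.1)) z = -(b * Real.exp (-b * z.1) * (n - b * z.1)) := by
  have h1 : ∀ s : ℝ, HasDerivAt (fun s => Real.exp (-b * s)) (Real.exp (-b * s) * (-b)) s := by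
    intro s
    have := ((hasDerivAt_id s).const_mul (-b)).exp
    simpa using this
  rw [Lop_eq n (w1 := fun y => Real.exp (-b * y.1) * (-b)) (w2 := fun y => 0)
    (w11 := Real.exp (-b * z.1) * (-b) * (-b)) (w22 := 0)]
  · ring
  · exact Eventually.of_forall fun y => h1 y.1
  · exact Eventually.of_forall fun y => hasDerivAt_const y.2 (Real.exp (-b * y.1))
  · exact (h1 z.1).mul_const (-b)
  · exact hasDerivAt_const _ _

set_option maxHeartbeats 1000000 in
/-- barrier -/
lemma narrow {n : ℕ} (hn : 1 ≤ n) {C : ℝ} (hC : 0 ≤ C) : ∃ δ > 0, ∃ η > 0, ∀ q0 : ℝ, 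
    ∃ φ : ℝ × ℝ → ℝ, (∀ z, ContDiffAt ℝ 2 φ z) ∧
      (∀ z ∈ P, qq z ≤ q0 + η → 1 ≤ φ z) ∧
      ∀ z ∈ P, qq z ≤ q0 + η → (z.1 < δ ∨ q0 < qq z) → 2 * C * φ z ≤ - Lop n φ z := by
  have hn' : (1:ℝ) ≤ n := by exact_mod_cast hn
  set b : ℝ := 40 * C + 1 with hb
  have hbpos : 0 < b := by positivity
  set M : ℝ := (b + 10 * C) * b with hM
  have hMpos : 0 < M := by positivity
  refine ⟨1/(2*b), by positivity, 1/M, by positivity, fun q0 => ?_⟩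
  set c : ℝ := Real.exp (-M * q0) with hc
  refine ⟨fun z => (4 + 1 * Real.exp (-b * z.1)) + (-c) * Real.exp (-(-M) * dd 0 z), ?_, ?_, ?_⟩
  · intro z
    exact (contDiffAt_const.add (contDiffAt_const.mul (by fun_prop))).add
      (contDiffAt_const.mul (dd_exp_smooth 0 (-M)).contDiffAt)
  · intro z hz hq
    have e : c * Real.exp (-(-M) * dd 0 z) = Real.exp (M * (qq z - q0)) := by
      rw [hc, ← Real.exp_add]; congr 1; simp [dd, qq]; ring
    have h1 : M * (qq z - q0) ≤ 1 := by
      have : M * (qq z - q0) ≤ M * (1/M) := mul_le_mul_of_nonneg_left (by linarith) hMpos.le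
      have e : M * (1/M) = 1 := by field_simp
      linarith
    have h2 : Real.exp (M * (qq z - q0)) ≤ 3 :=
      (Real.exp_le_exp.2 h1).trans (by linarith [Real.exp_one_lt_d9])
    have := Real.exp_pos (-b * z.1)
    linarith
  · intro z hz hq hcase
    have hz' : 0 < z.1 := hz
    rw [Lop_lin n (contDiffAt_const.add (contDiffAt_const.mul (by fun_prop)))
      (dd_exp_smooth 0 (-M)).contDiffAt, Lop_lin n contDiffAt_const (by fun_prop), Lop_exp_S,
      Lop_exp_dd]
    have e0 : Lop n (fun _ : ℝ × ℝ => (4:ℝ)) z = 0 := by simp [Lop, d1, d2]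
    rw [e0]
    have edd : dd 0 z = qq z := by simp [dd, qq]
    set T := Real.exp (-(-M) * dd 0 z) with hT
    set X := Real.exp (-b * z.1) with hX
    have e : c * T = Real.exp (M * (qq z - q0)) := by
      rw [hc, hT, ← Real.exp_add]; congr 1; rw [edd]; ring
    have hTp : 0 < c * T := by rw [e]; exact Real.exp_pos _
    have hX1 : X ≤ 1 := Real.exp_le_one_iff.2 (by nlinarith)
    have hXp : 0 < X := Real.exp_pos _
    have hphi : 2 * C * ((4 + 1 * X) + (-c) * T) ≤ 10 * C := by nlinarith
    have hq0 : 0 < qq z := qq_pos hz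
    set Y := z.1 * (4 * M^2 * qq z + (2 * n + 4) * M) with hY
    have hYp : 6 * M * z.1 ≤ Y := by
      rw [hY]
      have : 0 ≤ 4 * M^2 * qq z := by positivity
      have h3 : 6 * M ≤ (2 * n + 4) * M := by nlinarith
      nlinarith
    have eL : -(0 + 1 * -(b * X * (n - b * z.1)) + -c * (-M * T * (z.1 * (4 * -M * dd 0 z - 4)
        - 2 * n * (z.1 - (0:ℝ×ℝ).1)))) = b * X * (n - b * z.1) + (c * T) * Y := by
      rw [hY, edd]; simp; ring
    rw [eL]
    refine hphi.trans ?_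
    have hY0 : 0 ≤ Y := by
      have : 0 < 6 * M * z.1 := by positivity
      linarith
    by_cases hs : z.1 < 1/(2*b)
    · have h1 : b * z.1 < 1/2 := by
        have := mul_lt_mul_of_pos_left hs hbpos
        have e : b * (1/(2*b)) = 1/2 := by field_simp
        linarith
      have h2 : 1/2 ≤ X := by
        have := Real.add_one_le_exp (-b * z.1)
        rw [hX]; linarith
      have h3 : 1/2 * (1/2) ≤ X * (n - b * z.1) := mul_le_mul h2 (by linarith) (by norm_num) hXp.le
      have h4 : b * (1/2 * (1/2)) ≤ b * (X * (n - b * z.1)) := mul_le_mul_of_nonneg_left h3 hbpos.le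
      have h5 : 0 ≤ c * T * Y := mul_nonneg hTp.le hY0
      have : b * X * (n - b * z.1) = b * (X * (n - b * z.1)) := by ring
      rw [hb] at h4
      rw [this]
      linarith
    · have hq1 : q0 < qq z := by
        rcases hcase with h | h
        · exact absurd h hs
        · exact h
      push Not at hs
      have h1 : 1 ≤ c * T := by
        rw [e]; exact Real.one_le_exp (by nlinarith)
      have h2 : -1 ≤ X * (n - b * z.1) := by
        have h3 : b * z.1 * X ≤ 1 := by
          have := Real.add_one_le_exp (b * z.1)
          have e5 : X * Real.exp (b * z.1) = 1 := by rw [hX, ← Real.exp_add]; simp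
          nlinarith
        nlinarith
      have h4 : b * (-1) ≤ b * (X * (n - b * z.1)) := mul_le_mul_of_nonneg_left h2 hbpos.le
      have h5 : 6 * M * (1/(2*b)) ≤ 6 * M * z.1 := mul_le_mul_of_nonneg_left hs (by positivity)
      have h6 : 6 * M * (1/(2*b)) = 3 * (b + 10 * C) := by rw [hM]; field_simp; ring
      have h7 : Y ≤ c * T * Y := by nlinarith
      have : b * X * (n - b * z.1) = b * (X * (n - b * z.1)) := by ring
      rw [this]
      linarith

end HP

namespace HP
structure Sys (n : ℕ) (f g : ℝ → ℝ) (a b : ℝ × ℝ → ℝ) : Prop where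
  hn : 1 ≤ n
  nf : NL n f
  ng : NL n g
  ca : Continuous a
  cb : Continuous b
  pa : ∀ z, 0 < a z
  pb : ∀ z, 0 < b z
  ha : Apx n a (fun z => f (b z) / 4)
  hb : Apx n b (fun z => g (a z) / 4)

lemma Sys.symm {n : ℕ} {f g : ℝ → ℝ} {a b : ℝ × ℝ → ℝ} (h : Sys n f g a b) : Sys n g f b a :=
  ⟨h.hn, h.ng, h.nf, h.cb, h.ca, h.pb, h.pa, h.hb, h.ha⟩

lemma Sys.trans {n : ℕ} {f g : ℝ → ℝ} {a b : ℝ × ℝ → ℝ} (h : Sys n f g a b) (c : ℝ) :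
    Sys n f g (fun z => a (z.1, z.2 + c)) (fun z => b (z.1, z.2 + c)) :=
  ⟨h.hn, h.nf, h.ng, h.ca.comp (by fun_prop), h.cb.comp (by fun_prop), fun _ => h.pa _,
    fun _ => h.pb _, h.ha.trans c, h.hb.trans c⟩

lemma Sys.cF {n : ℕ} {f g : ℝ → ℝ} {a b : ℝ × ℝ → ℝ} (h : Sys n f g a b) :
    Continuous (fun z => f (b z) / 4) := by
  have : Continuous (fun z => f (b z)) := by
    rw [← continuousOn_univ]
    exact h.nf.cont.comp h.cb.continuousOn fun z _ => (h.pb z).le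
  exact this.div_const 4

def DD (κ : ℝ) : Set (ℝ × ℝ) := {z | z ∈ P ∧ qq z < κ}

lemma DD_P (κ : ℝ) : DD κ ⊆ P := fun _ hz => hz.1
lemma DD_open (κ : ℝ) : IsOpen (DD κ) := isOpen_P.inter (isOpen_lt qq_cont continuous_const)
lemma DD_closure (κ : ℝ) : closure (DD κ) ⊆ {z | qq z ≤ κ} :=
  closure_minimal (fun _ hz => le_of_lt hz.2) (isClosed_le qq_cont continuous_const)
lemma qq_bdd (κ : ℝ) : Bornology.IsBounded {z | qq z ≤ κ} := by
  refine (Metric.isBounded_closedBall (x := (0:ℝ×ℝ)) (r := |κ| + 1)).subset fun z hz => ?_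
  have hz : z.1^2 + z.2^2 ≤ κ := hz
  rw [Metric.mem_closedBall, Prod.dist_eq, Real.dist_eq, Real.dist_eq]
  have h1 := abs_nonneg κ
  have h2 := le_abs_self κ
  refine max_le (abs_le_of_sq_le_sq ?_ (by linarith)) (abs_le_of_sq_le_sq ?_ (by linarith))
  · simp only [Prod.fst_zero, sub_zero]; nlinarith [sq_nonneg z.2]
  · simp only [Prod.snd_zero, sub_zero]; nlinarith [sq_nonneg z.1]
lemma qq_compact (κ : ℝ) : IsCompact {z | qq z ≤ κ} :=
  Metric.isCompact_of_isClosed_isBounded (isClosed_le qq_cont continuous_const) (qq_bdd κ)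
lemma DD_bdd (κ : ℝ) : Bornology.IsBounded (DD κ) := (qq_bdd κ).subset fun _ hz => le_of_lt hz.2
lemma DD_conn (κ : ℝ) : IsPreconnected (DD κ) := by
  have hc : Convex ℝ (DD κ) := by
    intro x hx y hy s t hs ht hst
    have hx1 : 0 < x.1 := hx.1
    have hy1 : 0 < y.1 := hy.1
    have hx2 : x.1^2 + x.2^2 < κ := hx.2
    have hy2 : y.1^2 + y.2^2 < κ := hy.2
    constructor
    · show 0 < s * x.1 + t * y.1
      rcases hs.eq_or_lt with h | h
      · subst h; have : t = 1 := by linarith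
        subst this; simpa using hy1
      · have := mul_pos h hx1
        have := mul_nonneg ht hy1.le
        linarith
    · show (s * x.1 + t * y.1)^2 + (s * x.2 + t * y.2)^2 < κ
      have ht' : t = 1 - s := by linarith
      have k : (s * x.1 + t * y.1)^2 + (s * x.2 + t * y.2)^2 =
        s * (x.1^2 + x.2^2) + t * (y.1^2+y.2^2) - s * t * ((x.1-y.1)^2 + (x.2-y.2)^2) := by
        rw [ht']; ring
      have k2 : 0 ≤ s * t * ((x.1-y.1)^2 + (x.2-y.2)^2) := by positivity
      rw [k]
      rcases hs.eq_or_lt with h | h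
      · subst h; have : t = 1 := by linarith
        subst this; linarith
      · have := mul_lt_mul_of_pos_left hx2 h
        have := mul_le_mul_of_nonneg_left hy2.le ht
        nlinarith
  exact hc.isPreconnected

lemma qq_kap {κ : ℝ} {z : ℝ × ℝ} (hz : 0 < qq z) : qq (kap κ z) = κ^2 / qq z := by
  simp only [qq, kap] at *
  field_simp

lemma kap_kap {κ : ℝ} (hκ : 0 < κ) {z : ℝ × ℝ} (hz : 0 < qq z) : kap κ (kap κ z) = z := by
  have h := qq_kap (κ := κ) hz
  ext
  · show κ * (κ * z.1 / qq z) / qq (kap κ z) = z.1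
    rw [h]; field_simp
  · show κ * (κ * z.2 / qq z) / qq (kap κ z) = z.2
    rw [h]; field_simp

lemma kap_self {κ : ℝ} (hκ : 0 < κ) {z : ℝ × ℝ} (hz : qq z = κ) : kap κ z = z := by
  ext
  · show κ * z.1 / qq z = z.1
    rw [hz]; field_simp
  · show κ * z.2 / qq z = z.2
    rw [hz]; field_simp

lemma kel_self (n : ℕ) {κ : ℝ} (hκ : 0 < κ) (w : ℝ × ℝ → ℝ) {z : ℝ × ℝ} (hz : qq z = κ) :
    kel n κ w z = w z := by
  unfold kel
  rw [kap_self hκ hz, hz, div_self hκ.ne', Real.one_rpow, one_mul]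

lemma kel_cont2 (n : ℕ) {w : ℝ × ℝ → ℝ} (hw : Continuous w) {κ : ℝ} {z : ℝ × ℝ} (hκ : 0 < κ) (hz : 0 < qq z) :
    ContinuousAt (fun y : ℝ × (ℝ × ℝ) => kel n y.1 w y.2) (κ, z) := by
  have h1 : ContinuousAt (fun y : ℝ × (ℝ × ℝ) => y.1 / qq y.2) (κ, z) :=
    continuousAt_fst.div (qq_cont.comp continuous_snd).continuousAt hz.ne'
  have h2 : ContinuousAt (fun y : ℝ × (ℝ × ℝ) => (y.1 / qq y.2) ^ ((n:ℝ)/2)) (κ, z) :=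
    h1.rpow_const (Or.inl (div_pos hκ hz).ne')
  have h3 : ContinuousAt (fun y : ℝ × (ℝ × ℝ) => kap y.1 y.2) (κ, z) := by
    unfold kap
    have hq : ContinuousAt (fun y : ℝ × (ℝ × ℝ) => qq y.2) (κ, z) := (qq_cont.comp continuous_snd).continuousAt
    refine ContinuousAt.prodMk ?_ ?_
    · exact ContinuousAt.div (by fun_prop) hq hz.ne'
    · exact ContinuousAt.div (by fun_prop) hq hz.ne'
  exact h2.mul (ContinuousAt.comp (f := fun y : ℝ × (ℝ × ℝ) => kap y.1 y.2) hw.continuousAt h3)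

lemma kel_cont (n : ℕ) {w : ℝ × ℝ → ℝ} (hw : Continuous w) {κ : ℝ} (hκ : 0 < κ) :
    ContinuousOn (kel n κ w) P := by
  intro z hz
  have := ContinuousAt.comp (f := fun z : ℝ × ℝ => (κ, z)) (x := z) (kel_cont2 n hw hκ (qq_pos hz)) (by fun_prop)
  exact this.continuousWithinAt

lemma kel_pos {n : ℕ} {w : ℝ × ℝ → ℝ} (hw : ∀ z, 0 < w z) {κ : ℝ} (hκ : 0 < κ) {z : ℝ × ℝ} (hz : 0 < qq z) :
    0 < kel n κ w z := by
  unfold kel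
  have := hw (kap κ z)
  positivity

/-- fundamental lower bound -/
lemma Sys.lower {n : ℕ} {f g : ℝ → ℝ} {a b : ℝ × ℝ → ℝ} (h : Sys n f g a b) :
    ∃ c > 0, ∀ z ∈ P, 1 ≤ qq z → c * (1 / qq z) ^ ((n:ℝ)/2) ≤ b z := by
  obtain ⟨z1, hz1, hmin⟩ := (qq_compact 1).exists_isMinOn ⟨0, by simp [qq]⟩ h.cb.continuousOn
  set m := b z1 with hm
  have hmpos : 0 < m := h.pb z1
  set ψ : ℝ × ℝ → ℝ := kel n 1 (fun _ => 1) with hψ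
  have hψe : ∀ z, ψ z = (1 / qq z) ^ ((n:ℝ)/2) := fun z => by simp [hψ, kel]
  have hψs : ∀ z ∈ P, ContDiffAt ℝ 2 ψ z := fun z hz => kel_smooth one_pos (qq_pos hz) contDiffAt_const
  have hψL : ∀ z ∈ P, Lop n ψ z = 0 := fun z hz => by
    rw [hψ, Lop_kel n one_pos (qq_pos hz) contDiffAt_const]
    simp [Lop, d1, d2]
  have hn2 : (0:ℝ) < (n:ℝ)/2 := by
    have := h.hn
    have : (1:ℝ) ≤ n := by exact_mod_cast this
    linarith
  have key : ∀ R : ℝ, 1 < R → ∀ z ∈ P, 1 < qq z → qq z < R → 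
      -b z + m * ((-((1/R) ^ ((n:ℝ)/2))) + 1 * ψ z) ≤ 0 := by
    intro R hR
    set r := (1/R) ^ ((n:ℝ)/2) with hr
    have hrp : 0 < r := by positivity
    have hΨs : ∀ z ∈ P, ContDiffAt ℝ 2 (fun z => -r + 1 * ψ z) z := fun z hz =>
      contDiffAt_const.add (contDiffAt_const.mul (hψs z hz))
    set E := {z | (z ∈ P ∧ 1 < qq z) ∧ qq z < R} with hE
    have hEo : IsOpen E := (isOpen_P.inter (isOpen_lt continuous_const qq_cont)).inter
      (isOpen_lt qq_cont continuous_const)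
    have hEP : E ⊆ P := fun z hz => hz.1.1
    have hcl : closure E ⊆ {z | 1 ≤ qq z ∧ qq z ≤ R} :=
      closure_minimal (fun z hz => ⟨hz.1.2.le, hz.2.le⟩)
        ((isClosed_le continuous_const qq_cont).inter (isClosed_le qq_cont continuous_const))
    have := MP h.hn hEo hEP ((qq_bdd R).subset fun z hz => hz.2.le)
      (W := fun z => -b z + m * (-r + 1 * ψ z)) ?_ ?_ ?_ ?_
    · intro z hz h1 h2
      exact this z ⟨⟨hz, h1⟩, h2⟩
    · refine h.cb.continuousOn.neg.add (continuousOn_const.mul fun z hz => ?_)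
      exact (hΨs z hz.2).continuousAt.continuousWithinAt
    · refine ⟨m, fun z hz => ?_⟩
      have h1 : ψ z ≤ 1 := by
        rw [hψe]
        have := hz.1.2
        exact Real.rpow_le_one (by positivity) (by rw [div_le_one (by linarith)]; exact this.le) hn2.le
      have := h.pb z
      nlinarith
    · intro z hz hzP
      have h1 := hcl (frontier_subset_closure hz)
      have hnot : z ∉ E := by
        have := hz.2; rwa [hEo.interior_eq] at this
      have hbz := h.pb z
      by_cases h2 : 1 < qq z
      · have h3 : qq z = R := le_antisymm h1.2 (by
          by_contra hlt; push Not at hlt; exact hnot ⟨⟨hzP, h2⟩, hlt⟩)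
        have : ψ z = r := by rw [hψe, h3]
        rw [this]; linarith
      · have h3 : qq z = 1 := le_antisymm (not_lt.1 h2) h1.1
        have h4 : ψ z = 1 := by rw [hψe, h3]; simp
        have h5 : m ≤ b z := hmin (show qq z ≤ 1 from h3.le)
        rw [h4]
        nlinarith
    · have hv := (h.hb.neg.visc (h.symm.cF.neg.continuousOn)).mono hEP (G' := fun _ => 0) (by
        intro z hz
        have := h.ng.nonneg h.hn (h.pa z)
        show -(g (a z) / 4) ≤ 0
        linarith)
      refine (hv.add_smooth (fun z hz => hΨs z (hEP hz)) m).mono subset_rfl ?_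
      intro z hz
      rw [Lop_lin n contDiffAt_const (hψs z (hEP hz)), hψL z (hEP hz)]
      have e0 : Lop n (fun _ : ℝ × ℝ => -r) z = 0 := by simp [Lop, d1, d2]
      rw [e0]; simp
  refine ⟨m, hmpos, fun z hz hq => ?_⟩
  rcases hq.eq_or_lt with h1 | h1
  · rw [← h1]; simp
    exact hmin (show qq z ≤ 1 from h1.ge)
  · have hlim : Tendsto (fun R : ℝ => -b z + m * ((-((1/R) ^ ((n:ℝ)/2))) + 1 * ψ z)) atTop
        (𝓝 (-b z + m * ((-0) + 1 * ψ z))) := by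
      refine tendsto_const_nhds.add (tendsto_const_nhds.mul (Tendsto.add (Tendsto.neg ?_) tendsto_const_nhds))
      have h2 : Tendsto (fun R : ℝ => 1 / R) atTop (𝓝 0) := tendsto_const_nhds.div_atTop tendsto_id
      have := h2.rpow_const (p := (n:ℝ)/2) (Or.inr hn2.le)
      rwa [Real.zero_rpow hn2.ne'] at this
    have := le_of_tendsto hlim (by
      filter_upwards [eventually_gt_atTop (max 1 (qq z))] with R hR
      exact key R ((le_max_left _ _).trans_lt hR) z hz h1 ((le_max_right _ _).trans_lt hR))
    rw [hψe] at this
    linarith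

lemma Sys.lower_kel {n : ℕ} {f g : ℝ → ℝ} {a b : ℝ × ℝ → ℝ} (h : Sys n f g a b) {κm : ℝ} (hκm : 0 < κm) :
    ∃ c > 0, ∀ κ, 0 < κ → κ ≤ κm → ∀ z ∈ DD κ, c ≤ kel n κ b z := by
  obtain ⟨c, hc, hcb⟩ := h.lower
  obtain ⟨z1, hz1, hmin⟩ := (qq_compact 1).exists_isMinOn ⟨0, by simp [qq]⟩ h.cb.continuousOn
  set m := b z1 with hm
  have hmpos : 0 < m := h.pb z1
  refine ⟨min m (c * (1/κm) ^ ((n:ℝ)/2)), by positivity, fun κ hκ hκκ z hz => ?_⟩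
  have hq := qq_pos hz.1
  have hqk := qq_kap (κ := κ) hq
  have hn2 : (0:ℝ) ≤ (n:ℝ)/2 := by positivity
  have hr : 1 ≤ (κ / qq z) ^ ((n:ℝ)/2) :=
    Real.one_le_rpow ((one_le_div hq).2 hz.2.le) hn2
  by_cases h1 : 1 ≤ qq (kap κ z)
  · refine (min_le_right _ _).trans ?_
    have h2 := hcb _ (kap_mem hκ hz.1) h1
    unfold kel
    calc c * (1/κm) ^ ((n:ℝ)/2) ≤ c * (1/κ) ^ ((n:ℝ)/2) := by gcongr
      _ = (κ / qq z) ^ ((n:ℝ)/2) * (c * (1 / qq (kap κ z)) ^ ((n:ℝ)/2)) := by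
        rw [mul_left_comm, ← Real.mul_rpow (by positivity) (by rw [hqk]; positivity), hqk]
        congr 2
        field_simp
      _ ≤ _ := mul_le_mul_of_nonneg_left h2 (by positivity)
  · push Not at h1
    refine (min_le_left _ _).trans ?_
    have h2 : m ≤ b (kap κ z) := hmin h1.le
    unfold kel
    nlinarith

lemma kel_fac {n : ℕ} (hn : 1 ≤ n) {r : ℝ} (hr : 0 < r) : (r ^ ((n:ℝ)/2)) ^ ta n = r ^ ((n:ℝ)/2) * r := by
  have : (n:ℝ) ≠ 0 := by
    have : (1:ℝ) ≤ n := by exact_mod_cast hn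
    linarith
  rw [← Real.rpow_mul hr.le]
  nth_rewrite 3 [← Real.rpow_one r]
  rw [← Real.rpow_add hr]
  congr 1
  unfold ta; field_simp; ring

/-- basic Apx / visc for difference -/
lemma Sys.visc0 {n : ℕ} {f g : ℝ → ℝ} {a b : ℝ × ℝ → ℝ} (h : Sys n f g a b) {κ : ℝ} (hκ : 0 < κ) :
    Visc n (fun z => a z - kel n κ a z)
      (fun z => f (b z) / 4 - (κ / qq z) ^ ((n:ℝ)/2) * (κ / qq z) * (f (b (kap κ z)) / 4)) P ∧
    Visc n (fun z => -(a z - kel n κ a z))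
      (fun z => -(f (b z) / 4 - (κ / qq z) ^ ((n:ℝ)/2) * (κ / qq z) * (f (b (kap κ z)) / 4))) P := by
  have hc : ContinuousOn (fun z => f (b z) / 4 - (κ / qq z) ^ ((n:ℝ)/2) * (κ / qq z) * (f (b (kap κ z)) / 4)) P := by
    have h1 : ContinuousOn (fun z => κ / qq z) P :=
      continuousOn_const.div qq_cont.continuousOn fun z hz => (qq_pos hz).ne'
    have h2 : ContinuousOn (fun z => (κ / qq z) ^ ((n:ℝ)/2)) P :=
      h1.rpow_const fun z hz => Or.inl (by have := qq_pos hz; positivity)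
    have h3 : ContinuousOn (fun z => f (b (kap κ z)) / 4) P := fun z hz =>
      (ContinuousAt.comp (f := kap κ) (g := fun z => f (b z) / 4) h.cF.continuousAt
        (kap_smooth (qq_pos hz)).continuousAt).continuousWithinAt
    exact h.cF.continuousOn.sub ((h2.mul h1).mul h3)
  exact ⟨(h.ha.sub (h.ha.kel hκ)).visc hc, (h.ha.sub (h.ha.kel hκ)).neg.visc hc.neg⟩

lemma Sys.Fk {n : ℕ} {f g : ℝ → ℝ} {a b : ℝ × ℝ → ℝ} (h : Sys n f g a b) {κ : ℝ} (hκ : 0 < κ) {z : ℝ × ℝ}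
    (hz : z ∈ DD κ) : f (kel n κ b z) ≤ (κ / qq z) ^ ((n:ℝ)/2) * (κ / qq z) * f (b (kap κ z)) := by
  have hq := qq_pos hz.1
  rw [← kel_fac h.hn (div_pos hκ hq)]
  exact h.nf.scale (Real.one_le_rpow ((one_le_div hq).2 hz.2.le) (by positivity)) (h.pb _)

lemma Sys.visc1 {n : ℕ} {f g : ℝ → ℝ} {a b : ℝ × ℝ → ℝ} (h : Sys n f g a b) {κ : ℝ} (hκ : 0 < κ) :
    Visc n (fun z => a z - kel n κ a z) (fun z => (f (b z) - f (kel n κ b z)) / 4) (DD κ) := by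
  refine (h.visc0 hκ).1.mono (DD_P κ) fun z hz => ?_
  have := h.Fk hκ hz
  linarith

lemma Sys.visc2 {n : ℕ} {f g : ℝ → ℝ} {a b : ℝ × ℝ → ℝ} (h : Sys n f g a b) {κm : ℝ} (hκm : 0 < κm) :
    ∃ C, 0 ≤ C ∧ ∀ κ, 0 < κ → κ ≤ κm →
      Visc n (fun z => a z - kel n κ a z) (fun z => C * max (b z - kel n κ b z) 0) (DD κ) := by
  obtain ⟨c0, hc0, hlow⟩ := h.lower_kel hκm
  obtain ⟨B, hB⟩ := (qq_compact κm).bddAbove_image h.cb.continuousOn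
  obtain ⟨C, hC, hlip⟩ := h.nf.lip h.hn hc0 B
  refine ⟨C, hC, fun κ hκ hκκ => (h.visc1 hκ).mono subset_rfl fun z hz => ?_⟩
  have hb : b z ≤ B := hB ⟨z, show qq z ≤ κm from hz.2.le.trans hκκ, rfl⟩
  have := hlip (b z) (kel n κ b z) (h.pb z) (hlow κ hκ hκκ z hz) hb
  have h0 : 0 ≤ C * max (b z - kel n κ b z) 0 := by positivity
  linarith

lemma Sys.visc3 {n : ℕ} {f g : ℝ → ℝ} {a b : ℝ × ℝ → ℝ} (h : Sys n f g a b) {κm : ℝ} (hκm : 0 < κm) :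
    ∃ C, 0 ≤ C ∧ ∀ κ, 0 < κ → κ ≤ κm →
      Visc n (fun z => a z - kel n κ a z) (fun z => C * max (b z - kel n κ b z) 0) (DD κ) ∧
      Visc n (fun z => b z - kel n κ b z) (fun z => C * max (a z - kel n κ a z) 0) (DD κ) := by
  obtain ⟨C1, h1, h1'⟩ := h.visc2 hκm
  obtain ⟨C2, h2, h2'⟩ := h.symm.visc2 hκm
  refine ⟨max C1 C2, le_max_of_le_left h1, fun κ a1 a2 => ⟨(h1' κ a1 a2).mono subset_rfl ?_,
    (h2' κ a1 a2).mono subset_rfl ?_⟩⟩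
  · intro z hz
    exact mul_le_mul_of_nonneg_right (le_max_left _ _) (le_max_right _ _)
  · intro z hz
    exact mul_le_mul_of_nonneg_right (le_max_right _ _) (le_max_right _ _)

def Claim (n : ℕ) (a b : ℝ × ℝ → ℝ) (κ : ℝ) : Prop :=
  ∀ z ∈ DD κ, a z ≤ kel n κ a z ∧ b z ≤ kel n κ b z

/-- sweeping on a subset of `DD κ` -/
lemma Sys.sweep {n : ℕ} {f g : ℝ → ℝ} {a b : ℝ × ℝ → ℝ} (h : Sys n f g a b) {κ C : ℝ} (hκ : 0 < κ)
    (hC : 0 ≤ C)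
    (hv : Visc n (fun z => a z - kel n κ a z) (fun z => C * max (b z - kel n κ b z) 0) (DD κ) ∧
      Visc n (fun z => b z - kel n κ b z) (fun z => C * max (a z - kel n κ a z) 0) (DD κ))
    {E : Set (ℝ × ℝ)} (hE : IsOpen E) (hED : E ⊆ DD κ)
    (hout : ∀ z ∈ DD κ, z ∉ E → a z ≤ kel n κ a z ∧ b z ≤ kel n κ b z)
    {φ : ℝ × ℝ → ℝ} (hφs : ∀ z, ContDiffAt ℝ 2 φ z) (hφ1 : ∀ z ∈ P, qq z ≤ κ → 1 ≤ φ z)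
    (hφL : ∀ z ∈ E, 2 * C * φ z ≤ - Lop n φ z) : Claim n a b κ := by
  have hcl : ∀ z ∈ closure E, qq z ≤ κ := fun z hz => DD_closure κ (closure_mono hED hz)
  have hfr : ∀ z ∈ frontier E, z ∈ P → a z ≤ kel n κ a z ∧ b z ≤ kel n κ b z := by
    intro z hz hzP
    have hnot : z ∉ E := by
      have := hz.2; rwa [hE.interior_eq] at this
    have h1 := hcl z (frontier_subset_closure hz)
    rcases h1.eq_or_lt with h2 | h2
    · rw [kel_self n hκ a h2, kel_self n hκ b h2]; exact ⟨le_rfl, le_rfl⟩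
    · exact hout z ⟨hzP, h2⟩ hnot
  have hbd : ∀ w : ℝ × ℝ → ℝ, Continuous w → (∀ z, 0 < w z) →
      ∃ M, ∀ z ∈ E, w z - kel n κ w z ≤ M := by
    intro w hw hwp
    obtain ⟨B, hB⟩ := (qq_compact κ).bddAbove_image hw.continuousOn
    refine ⟨B, fun z hz => ?_⟩
    have h1 : w z ≤ B := hB ⟨z, show qq z ≤ κ from (hED hz).2.le, rfl⟩
    have := kel_pos (n := n) hwp hκ (qq_pos (hED hz).1)
    linarith
  have := MPsys h.hn hE (hED.trans (DD_P κ)) ((DD_bdd κ).subset hED) hC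
    (U := fun z => a z - kel n κ a z) (V := fun z => b z - kel n κ b z) (φ := φ)
    (h.ca.continuousOn.sub ((kel_cont n h.ca hκ).mono inter_subset_right))
    (h.cb.continuousOn.sub ((kel_cont n h.cb hκ).mono inter_subset_right))
    (hbd a h.ca h.pa) (hbd b h.cb h.pb)
    (fun z hz hzP => by linarith [(hfr z hz hzP).1]) (fun z hz hzP => by linarith [(hfr z hz hzP).2])
    (hv.1.mono hED fun _ _ => le_rfl) (hv.2.mono hED fun _ _ => le_rfl)
    (fun z _ => hφs z) (fun z hz hzP => hφ1 z hzP (hcl z hz)) hφL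
  intro z hz
  by_cases hzE : z ∈ E
  · have := this z hzE
    exact ⟨by linarith [this.1], by linarith [this.2]⟩
  · exact hout z hz hzE

lemma Sys.start {n : ℕ} {f g : ℝ → ℝ} {a b : ℝ × ℝ → ℝ} (h : Sys n f g a b) :
    ∃ κ0 > 0, ∀ κ, 0 < κ → κ ≤ κ0 → Claim n a b κ := by
  obtain ⟨C, hC, hv⟩ := h.visc3 one_pos
  obtain ⟨δ, hδ, η, hη, hφ⟩ := narrow h.hn hC
  obtain ⟨φ, h1, h2, h3⟩ := hφ 0
  refine ⟨min 1 η, by positivity, fun κ hκ hκ' => ?_⟩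
  have k1 := hκ'.trans (min_le_left _ _)
  have k2 := hκ'.trans (min_le_right _ _)
  refine h.sweep hκ hC (hv κ hκ k1) (DD_open κ) subset_rfl (fun z hz hn => absurd hz hn) h1 ?_ ?_
  · intro z hz hq
    exact h2 z hz (by linarith)
  · intro z hz
    exact h3 z hz.1 (by linarith [hz.2]) (Or.inr (qq_pos hz.1))

lemma Sys.cont_step {n : ℕ} {f g : ℝ → ℝ} {a b : ℝ × ℝ → ℝ} (h : Sys n f g a b) {κ : ℝ} (hκ : 0 < κ)
    (hs : ∀ z ∈ DD κ, a z < kel n κ a z ∧ b z < kel n κ b z) :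
    ∀ᶠ κ' in 𝓝 κ, Claim n a b κ' := by
  obtain ⟨C, hC, hv⟩ := h.visc3 (show 0 < κ + 1 by linarith)
  obtain ⟨δ, hδ, η, hη, hφ⟩ := narrow h.hn hC
  set q0 := κ - η/2 with hq0
  obtain ⟨φ, h1, h2, h3⟩ := hφ q0
  set K := {z : ℝ × ℝ | qq z ≤ q0} ∩ {z | δ ≤ z.1} with hK
  have hKc : IsCompact K := (qq_compact q0).inter_right (isClosed_le continuous_const continuous_fst)
  have hev : ∀ᶠ κ' in 𝓝 κ, ∀ z ∈ K, a z < kel n κ' a z ∧ b z < kel n κ' b z := by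
    refine hKc.eventually_forall_of_forall_eventually fun z hz => ?_
    have hzP : z ∈ P := hδ.trans_le hz.2
    have hzD : z ∈ DD κ := ⟨hzP, lt_of_le_of_lt hz.1 (by linarith)⟩
    have hq := qq_pos hzP
    exact (((h.ca.comp continuous_snd).continuousAt.eventually_lt (kel_cont2 n h.ca hκ hq) (hs z hzD).1)).and
      (((h.cb.comp continuous_snd).continuousAt.eventually_lt (kel_cont2 n h.cb hκ hq) (hs z hzD).2))
  filter_upwards [hev, Ioo_mem_nhds hκ (show κ < κ + min 1 (η/2) by linarith [show 0 < min 1 (η/2) by positivity])]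
    with κ' he hκ'
  have k1 : κ' < κ + 1 := hκ'.2.trans_le (by linarith [min_le_left 1 (η/2)])
  have k2 : κ' < κ + η/2 := hκ'.2.trans_le (by linarith [min_le_right 1 (η/2)])
  refine h.sweep hκ'.1 hC (hv κ' hκ'.1 k1.le) (E := DD κ' ∩ ({z | z.1 < δ} ∪ {z | q0 < qq z})) ?_
    inter_subset_left ?_ h1 ?_ ?_
  · exact (DD_open κ').inter ((isOpen_lt continuous_fst continuous_const).union
      (isOpen_lt continuous_const qq_cont))
  · intro z hz hn
    have : z ∈ K := by
      by_contra hc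
      apply hn
      refine ⟨hz, ?_⟩
      by_contra hd
      apply hc
      simp only [mem_union, mem_setOf_eq, not_or, not_lt] at hd
      exact ⟨hd.2, hd.1⟩
    exact ⟨(he z this).1.le, (he z this).2.le⟩
  · intro z hz hq
    exact h2 z hz (by linarith)
  · intro z hz
    exact h3 z hz.1.1 (by linarith [hz.1.2]) hz.2

end HP

namespace HP
lemma Sys.rig_eq {n : ℕ} {f g : ℝ → ℝ} {a b : ℝ × ℝ → ℝ} (h : Sys n f g a b) {κ : ℝ} (hκ : 0 < κ)
    (hU : ∀ z ∈ DD κ, a z = kel n κ a z) {z : ℝ × ℝ} (hz : z ∈ DD κ) :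
    f (b z) = (κ / qq z) ^ ((n:ℝ)/2) * (κ / qq z) * f (b (kap κ z)) := by
  have hL : Lop n (fun _ : ℝ × ℝ => (0:ℝ)) z = 0 := by simp [Lop, d1, d2]
  have hev : ∀ᶠ y in 𝓝 z, y ∈ DD κ := (DD_open κ).mem_nhds hz
  have h1 := (h.visc0 hκ).1 z hz.1 (fun _ => 0) contDiffAt_const (by
    filter_upwards [hev] with y hy
    have e1 : a y - kel n κ a y = 0 := sub_eq_zero.2 (hU y hy)
    have e2 : a z - kel n κ a z = 0 := sub_eq_zero.2 (hU z hz)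
    simp only [e1, e2, le_refl])
  have h2 := (h.visc0 hκ).2 z hz.1 (fun _ => 0) contDiffAt_const (by
    filter_upwards [hev] with y hy
    have e1 : a y - kel n κ a y = 0 := sub_eq_zero.2 (hU y hy)
    have e2 : a z - kel n κ a z = 0 := sub_eq_zero.2 (hU z hz)
    simp only [e1, e2, le_refl])
  rw [hL] at h1 h2
  linarith

lemma n2pos {n : ℕ} (hn : 1 ≤ n) : (0:ℝ) < (n:ℝ)/2 := by
  have : (1:ℝ) ≤ n := by exact_mod_cast hn
  linarith

lemma Sys.decay {n : ℕ} {f g : ℝ → ℝ} {a b : ℝ × ℝ → ℝ} (h : Sys n f g a b) {κ : ℝ} (hκ : 0 < κ)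
    (hU : ∀ z ∈ DD κ, a z = kel n κ a z) (hf : ∀ s, 0 < s → f s = 0) : False := by
  have hn2 := n2pos h.hn
  obtain ⟨M, hM⟩ := (qq_compact κ).bddAbove_image h.ca.continuousOn
  have key : ∀ R, κ < R → 1 < R → a (1, 0) ≤ (κ / R) ^ ((n:ℝ)/2) * M := by
    intro R hR hR1
    set m := (κ / R) ^ ((n:ℝ)/2) * M with hm
    have hR0 : 0 < R := hκ.trans hR
    have hv : Visc n a (fun _ => 0) (DD R) := (h.ha.visc h.cF.continuousOn).mono (DD_P R) (by
      intro z hz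
      show f (b z) / 4 ≤ 0
      rw [hf _ (h.pb z)]; simp)
    have hv2 := (hv.add_smooth (ψ := fun _ => 1) (fun z _ => contDiffAt_const) (-m)).mono subset_rfl
      (G' := fun _ => 0) (by intro z hz; simp [Lop, d1, d2])
    have := MP h.hn (DD_open R) (DD_P R) (DD_bdd R) (W := fun z => a z + -m * 1)
      (by have := h.ca; fun_prop) ?_ ?_ hv2 (1, 0) ⟨show (0:ℝ) < 1 by norm_num, by simp [qq]; exact hR1⟩
    · simpa using this
    · obtain ⟨B, hB⟩ := (qq_compact R).bddAbove_image h.ca.continuousOn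
      refine ⟨B - m, fun z hz => ?_⟩
      have : a z ≤ B := hB ⟨z, show qq z ≤ R from hz.2.le, rfl⟩
      linarith
    · intro z hz hzP
      have h1 := DD_closure R (frontier_subset_closure hz)
      have hnot : z ∉ DD R := by
        have := hz.2; rwa [(DD_open R).interior_eq] at this
      have hq : qq z = R := le_antisymm h1 (by
        by_contra hlt; push Not at hlt; exact hnot ⟨hzP, hlt⟩)
      have hq0 := qq_pos hzP
      have hqk := qq_kap (κ := κ) hq0
      have hy : kap κ z ∈ DD κ := ⟨kap_mem hκ hzP, by
        rw [hqk, hq, div_lt_iff₀ hR0]; nlinarith⟩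
      have e := hU _ hy
      unfold kel at e
      rw [kap_kap hκ hq0, hqk, hq] at e
      have e2 : κ / (κ ^ 2 / R) = (κ / R)⁻¹ := by field_simp
      rw [e2, Real.inv_rpow (by positivity)] at e
      have e3 : a z = (κ / R) ^ ((n:ℝ)/2) * a (kap κ z) := by
        rw [e, ← mul_assoc, mul_inv_cancel₀ (by positivity), one_mul]
      have : a (kap κ z) ≤ M := hM ⟨_, show qq _ ≤ κ from hy.2.le, rfl⟩
      have : a z ≤ m := by rw [e3, hm]; gcongr
      linarith
  have hlim : Tendsto (fun R : ℝ => (κ / R) ^ ((n:ℝ)/2) * M) atTop (𝓝 (0 * M)) := by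
    refine Tendsto.mul_const _ ?_
    have h2 : Tendsto (fun R : ℝ => κ / R) atTop (𝓝 0) := tendsto_const_nhds.div_atTop tendsto_id
    have := h2.rpow_const (p := (n:ℝ)/2) (Or.inr hn2.le)
    rwa [Real.zero_rpow hn2.ne'] at this
  have := ge_of_tendsto hlim (by
    filter_upwards [eventually_gt_atTop κ, eventually_gt_atTop 1] with R h1 h2 using key R h1 h2)
  have := h.pa (1, 0)
  linarith

lemma fac_gt {n : ℕ} (hn : 1 ≤ n) {κ : ℝ} {z : ℝ × ℝ} (hz : z ∈ DD κ) :
    1 < (κ / qq z) ^ ((n:ℝ)/2) :=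
  Real.one_lt_rpow ((one_lt_div (qq_pos hz.1)).2 hz.2) (n2pos hn)

lemma Sys.rig_step {n : ℕ} {f g : ℝ → ℝ} {a b : ℝ × ℝ → ℝ} (h : Sys n f g a b) {κ : ℝ} (hκ : 0 < κ)
    (hU : ∀ z ∈ DD κ, a z = kel n κ a z) (hb : ∀ z ∈ DD κ, b z ≤ kel n κ b z)
    (hf : ∀ s, 0 < s → 0 < f s) : ∀ z ∈ DD κ, b z = kel n κ b z ∧
      f (b z) / (b z) ^ ta n = f (b (kap κ z)) / (b (kap κ z)) ^ ta n := by
  intro z hz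
  have hq := qq_pos hz.1
  have hta : 0 < ta n := one_pos.trans (ta_one h.hn)
  have e := h.rig_eq hκ hU hz
  have hR := fac_gt h.hn hz
  have hbz := hb z hz
  have hfac := kel_fac h.hn (div_pos hκ hq)
  rw [← hfac] at e
  unfold kel at *
  set R0 := (κ / qq z) ^ ((n:ℝ)/2) with hR0
  set y0 := b (kap κ z) with hy0
  have hy0p : 0 < y0 := h.pb _
  have hbp := h.pb z
  have hw : y0 < R0 * y0 := by nlinarith
  have f1 := h.nf.mono _ _ hbp hbz
  have f2 := h.nf.scale hR.le hy0p
  have f3 : f (R0 * y0) = f (b z) := le_antisymm (f2.trans e.ge) f1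
  have hhw : f (R0 * y0) / (R0 * y0) ^ ta n = f y0 / y0 ^ ta n := by
    rw [f3, e, Real.mul_rpow (by linarith) hy0p.le]
    have : 0 < R0 ^ ta n := Real.rpow_pos_of_pos (by linarith) _
    have : 0 < y0 ^ ta n := by positivity
    field_simp
  have hbe : b z = R0 * y0 := by
    by_contra hne
    have hlt : b z < R0 * y0 := lt_of_le_of_ne hbz hne
    set y := max (b z) y0 with hy
    have hyw : y < R0 * y0 := max_lt hlt hw
    have hyp : 0 < y := lt_max_of_lt_left hbp
    have g1 := h.nf.mono _ _ hbp (le_max_left (b z) y0)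
    have g2 := h.nf.mono _ _ hyp hyw.le
    have g3 : f y = f (R0 * y0) := le_antisymm g2 (f3.le.trans g1)
    have g4 := h.nf.anti _ _ hyp hyw.le
    have g5 := h.nf.anti _ _ hy0p (le_max_right (b z) y0)
    have g6 : f y / y ^ ta n = f (R0*y0) / (R0 * y0) ^ ta n := le_antisymm (g5.trans hhw.ge) g4
    rw [g3] at g6
    have hfp := hf (R0 * y0) (by linarith)
    have hp1 : y ^ ta n < (R0 * y0) ^ ta n := Real.rpow_lt_rpow hyp.le hyw hta
    have hp2 : 0 < y ^ ta n := by positivity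
    have := div_lt_div_of_pos_left hfp hp2 hp1
    linarith
  refine ⟨hbe, ?_⟩
  rw [hbe]; exact hhw

lemma Sys.hconst {n : ℕ} {f g : ℝ → ℝ} {a b : ℝ × ℝ → ℝ} (h : Sys n f g a b) {κ : ℝ} (hκ : 0 < κ)
    (hb : ∀ z ∈ DD κ, b z = kel n κ b z ∧
      f (b z) / (b z) ^ ta n = f (b (kap κ z)) / (b (kap κ z)) ^ ta n) :
    ∃ c, ∀ z : ℝ × ℝ, 0 ≤ z.1 → ∀ s, 0 < s → s < b z → f s / s ^ ta n = c := by
  have hn2 := n2pos h.hn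
  have hInt0 : ∀ z ∈ DD κ, ∀ s, b (kap κ z) ≤ s → s ≤ b z → f s / s ^ ta n = f (b z) / (b z) ^ ta n := by
    intro z hz s h1 h2
    have k1 := h.nf.anti _ _ (h.pb _) h1
    have k2 := h.nf.anti _ _ ((h.pb _).trans_le h1) h2
    exact le_antisymm (k1.trans (hb z hz).2.ge) k2
  have hlt : ∀ z ∈ DD κ, b (kap κ z) < b z := by
    intro z hz
    rw [(hb z hz).1]; unfold kel
    have := fac_gt h.hn hz
    have := h.pb (kap κ z)
    nlinarith
  have hloc : ∀ z ∈ DD κ, ∀ y ∈ DD κ, f (b z) / (b z) ^ ta n = f (b y) / (b y) ^ ta n := by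
    refine fun z hz y hy => (DD_conn κ).induction₂ (fun z y => f (b z) / (b z) ^ ta n = f (b y) / (b y) ^ ta n)
      ?_ (fun x y z _ _ _ h1 h2 => h1.trans h2) (fun x y _ _ h => h.symm) hz hy
    intro z hz
    have c1 : ContinuousAt (fun y => b (kap κ y)) z :=
      h.cb.continuousAt.comp (kap_smooth (qq_pos hz.1)).continuousAt
    have e1 : ∀ᶠ y in 𝓝 z, b (kap κ y) < b z := c1.eventually_lt continuousAt_const (hlt z hz)
    have e2 : ∀ᶠ y in 𝓝 z, b (kap κ z) < b y := continuousAt_const.eventually_lt h.cb.continuousAt (hlt z hz)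
    filter_upwards [nhdsWithin_le_nhds e1, nhdsWithin_le_nhds e2, self_mem_nhdsWithin] with y h1 h2 hy
    rcases le_total (b y) (b z) with hc | hc
    · exact (hInt0 z hz _ h2.le hc).symm
    · exact hInt0 y hy _ h1.le hc
  have hz0 : ((min 1 (κ/2), 0) : ℝ × ℝ) ∈ DD κ := by
    refine ⟨show 0 < min 1 (κ/2) by positivity, ?_⟩
    show (min 1 (κ/2))^2 + (0:ℝ)^2 < κ
    have h1 := min_le_left 1 (κ/2)
    have h2 := min_le_right 1 (κ/2)
    have h3 : 0 < min 1 (κ/2) := by positivity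
    nlinarith
  set c := f (b (min 1 (κ/2), 0)) / (b (min 1 (κ/2), 0)) ^ ta n with hc
  have hcD : ∀ z ∈ DD κ, f (b z) / (b z) ^ ta n = c := fun z hz => hloc z hz _ hz0
  have hD : ∀ z ∈ DD κ, ∀ s, 0 < s → s < b z → f s / s ^ ta n = c := by
    intro z hz s hs hsb
    have hlim : Tendsto (fun ε : ℝ => (ε^2 / κ) ^ ((n:ℝ)/2) * b (ε, 0)) (𝓝 0) (𝓝 ((0^2/κ) ^ ((n:ℝ)/2) * b (0,0))) := by
      have h1 : ContinuousAt (fun ε : ℝ => (ε^2 / κ) ^ ((n:ℝ)/2)) 0 :=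
        ContinuousAt.rpow_const (by fun_prop) (Or.inr hn2.le)
      have h2 : ContinuousAt (fun ε : ℝ => b (ε, 0)) 0 := (h.cb.comp (by fun_prop : Continuous fun ε : ℝ => ((ε, 0):ℝ×ℝ))).continuousAt
      exact (h1.mul h2).tendsto
    have e0 : ((0:ℝ)^2/κ) ^ ((n:ℝ)/2) * b (0,0) = 0 := by
      rw [zero_pow two_ne_zero, zero_div, Real.zero_rpow hn2.ne', zero_mul]
    rw [e0] at hlim
    have ev1 := hlim.eventually (gt_mem_nhds hs)
    have ev2 : ∀ᶠ ε : ℝ in 𝓝 0, ε^2 < κ := (by fun_prop : Continuous fun ε : ℝ => ε^2).continuousAt.eventually_lt continuousAt_const (by simpa using hκ)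
    obtain ⟨ε, ⟨k1, k2⟩, k3⟩ := (((ev1.and ev2).filter_mono (nhdsWithin_le_nhds (s := Ioi (0:ℝ)))).and self_mem_nhdsWithin).exists
    have k3 : 0 < ε := k3
    have hy : ((ε, 0) : ℝ × ℝ) ∈ DD κ := ⟨k3, by simpa [qq] using k2⟩
    set y : ℝ × ℝ := (ε, 0) with hyd
    have hqy : qq y = ε^2 := by simp [hyd, qq]
    have hky : b (kap κ y) < s := by
      have := (hb y hy).1
      unfold kel at this
      rw [hqy] at this
      have e4 : κ / ε^2 = (ε^2/κ)⁻¹ := by field_simp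
      rw [e4, Real.inv_rpow (by positivity)] at this
      rw [this, ← mul_assoc, mul_inv_cancel₀ (by positivity), one_mul] at k1
      exact k1
    rcases le_total s (b y) with hc1 | hc1
    · rw [hInt0 y hy s hky.le hc1, hcD y hy]
    · have l1 := h.nf.anti _ _ (h.pb y) hc1
      have l2 := h.nf.anti _ _ hs hsb.le
      rw [hcD y hy] at l1
      rw [hcD z hz] at l2
      exact le_antisymm l1 l2
  have hP : ∀ z ∈ P, qq z ≠ κ → ∀ s, 0 < s → s < b z → f s / s ^ ta n = c := by
    intro z hz hne s hs hsb
    rcases lt_or_gt_of_ne hne with hl | hl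
    · exact hD z ⟨hz, hl⟩ s hs hsb
    · have hq := qq_pos hz
      have hk : kap κ z ∈ DD κ := ⟨kap_mem hκ hz, by
        rw [qq_kap hq, div_lt_iff₀ hq]; nlinarith⟩
      have := hlt _ hk
      rw [kap_kap hκ hq] at this
      exact hD _ hk s hs (hsb.trans this)
  refine ⟨c, fun z hz s hs hsb => ?_⟩
  have ev1 : ∀ᶠ ε : ℝ in 𝓝 0, s < b (z.1 + ε, z.2) :=
    continuousAt_const.eventually_lt (h.cb.comp (by fun_prop : Continuous fun ε : ℝ => ((z.1 + ε, z.2):ℝ×ℝ))).continuousAt (by simpa using hsb)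
  have ev2 : ∀ᶠ ε : ℝ in 𝓝[>] 0, qq (z.1 + ε, z.2) ≠ κ := by
    by_cases hq : qq z < κ
    · have : ∀ᶠ ε : ℝ in 𝓝 0, qq (z.1 + ε, z.2) < κ :=
        (qq_cont.comp (by fun_prop : Continuous fun ε : ℝ => ((z.1 + ε, z.2):ℝ×ℝ))).continuousAt.eventually_lt continuousAt_const (by simpa using hq)
      filter_upwards [nhdsWithin_le_nhds this] with ε he using he.ne
    · filter_upwards [self_mem_nhdsWithin] with ε he
      have he : 0 < ε := he
      have : qq z < qq (z.1 + ε, z.2) := by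
        simp only [qq]; nlinarith
      push Not at hq
      exact (hq.trans_lt this).ne'
  obtain ⟨ε, ⟨k1, k2⟩, k3⟩ := (((ev1.filter_mono (nhdsWithin_le_nhds (s := Ioi (0:ℝ)))).and ev2).and self_mem_nhdsWithin).exists
  have k3 : 0 < ε := k3
  exact hP (z.1 + ε, z.2) (show 0 < z.1 + ε by linarith) k2 s hs k1

def NC1 (n : ℕ) (f : ℝ → ℝ) (b : ℝ × ℝ → ℝ) : Prop :=
  ∃ s t, 0 < s ∧ 0 < t ∧ (∃ z : ℝ × ℝ, 0 ≤ z.1 ∧ s < b z) ∧ (∃ z : ℝ × ℝ, 0 ≤ z.1 ∧ t < b z) ∧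
    f s / s ^ ta n ≠ f t / t ^ ta n

lemma Sys.rigid {n : ℕ} {f g : ℝ → ℝ} {a b : ℝ × ℝ → ℝ} (h : Sys n f g a b)
    (hnc : NC1 n f b ∨ NC1 n g a) {κ : ℝ} (hκ : 0 < κ)
    (hcl : Claim n a b κ) (hU : ∀ z ∈ DD κ, a z = kel n κ a z) : False := by
  rcases h.nf.dich h.hn with hf | hf
  swap
  · exact h.decay hκ hU hf
  have hV := h.rig_step hκ hU (fun z hz => (hcl z hz).2) hf
  rcases h.ng.dich h.hn with hg | hg
  swap
  · exact h.symm.decay hκ (fun z hz => (hV z hz).1) hg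
  have hU2 := h.symm.rig_step hκ (fun z hz => (hV z hz).1) (fun z hz => (hcl z hz).1) hg
  rcases hnc with ⟨s, t, hs, ht, ⟨z, hz, hsz⟩, ⟨y, hy, hty⟩, hne⟩ | ⟨s, t, hs, ht, ⟨z, hz, hsz⟩, ⟨y, hy, hty⟩, hne⟩
  · obtain ⟨c, hc⟩ := h.hconst hκ hV
    exact hne ((hc z hz s hs hsz).trans (hc y hy t ht hty).symm)
  · obtain ⟨c, hc⟩ := h.symm.hconst hκ hU2
    exact hne ((hc z hz s hs hsz).trans (hc y hy t ht hty).symm)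

lemma Claim.symm {n : ℕ} {a b : ℝ × ℝ → ℝ} {κ : ℝ} (h : Claim n a b κ) : Claim n b a κ :=
  fun z hz => ⟨(h z hz).2, (h z hz).1⟩

lemma Sys.strict1 {n : ℕ} {f g : ℝ → ℝ} {a b : ℝ × ℝ → ℝ} (h : Sys n f g a b)
    (hnc : NC1 n f b ∨ NC1 n g a) {κ : ℝ} (hκ : 0 < κ)
    (hcl : Claim n a b κ) : ∀ z ∈ DD κ, a z < kel n κ a z := by
  have key : ∀ z ∈ DD κ, a z - kel n κ a z < 0 := by
    refine SMP h.hn (DD_open κ) (DD_P κ) (DD_conn κ)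
      (h.ca.continuousOn.sub ((kel_cont n h.ca hκ).mono (DD_P κ))) (fun z hz => by linarith [(hcl z hz).1]) ?_ ?_
    · refine (h.visc1 hκ).mono subset_rfl fun z hz => ?_
      have := h.nf.mono _ _ (h.pb z) (hcl z hz).2
      linarith
    · by_contra hcon
      push Not at hcon
      exact h.rigid hnc hκ hcl fun z hz => le_antisymm (hcl z hz).1 (by linarith [hcon z hz])
  exact fun z hz => by linarith [key z hz]

theorem Sys.all {n : ℕ} {f g : ℝ → ℝ} {a b : ℝ × ℝ → ℝ} (h : Sys n f g a b)
    (hnc : NC1 n f b ∨ NC1 n g a) : ∀ κ, 0 < κ → Claim n a b κ := by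
  by_contra hcon
  push Not at hcon
  obtain ⟨κ1, hκ1, hn1⟩ := hcon
  set A := {κ : ℝ | 0 < κ ∧ ¬ Claim n a b κ} with hA
  have hne : A.Nonempty := ⟨κ1, hκ1, hn1⟩
  obtain ⟨κ0, hκ0, hst⟩ := h.start
  have hlb : ∀ κ ∈ A, κ0 ≤ κ := fun κ hκ => by
    by_contra hlt; push Not at hlt; exact hκ.2 (hst κ hκ.1 hlt.le)
  have hbd : BddBelow A := ⟨κ0, hlb⟩
  set κb := sInf A with hκb
  have hb0 : 0 < κb := hκ0.trans_le (le_csInf hne hlb)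
  have hlow : ∀ κ, 0 < κ → κ < κb → Claim n a b κ := fun κ h1 h2 => by
    by_contra hc; exact absurd (csInf_le hbd (show κ ∈ A from ⟨h1, hc⟩)) (not_le.2 h2)
  have hcl : Claim n a b κb := by
    intro z hz
    have hq := qq_pos hz.1
    have hev : ∀ᶠ κ in 𝓝[<] κb, a z ≤ kel n κ a z ∧ b z ≤ kel n κ b z := by
      have h1 : ∀ᶠ κ in 𝓝 κb, qq z < κ := lt_mem_nhds hz.2
      filter_upwards [nhdsWithin_le_nhds h1, self_mem_nhdsWithin] with κ h1 h2
      exact hlow κ (hq.trans h1) h2 z ⟨hz.1, h1⟩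
    have hc : ∀ w : ℝ × ℝ → ℝ, Continuous w → Tendsto (fun κ => kel n κ w z) (𝓝[<] κb) (𝓝 (kel n κb w z)) :=
      fun w hw => (ContinuousAt.comp (f := fun κ : ℝ => (κ, z)) (x := κb) (kel_cont2 n hw hb0 hq)
        (by fun_prop)).tendsto.mono_left nhdsWithin_le_nhds
    exact ⟨ge_of_tendsto (hc a h.ca) (hev.mono fun _ h => h.1), ge_of_tendsto (hc b h.cb) (hev.mono fun _ h => h.2)⟩
  have hs := h.cont_step hb0 fun z hz => ⟨h.strict1 hnc hb0 hcl z hz, h.symm.strict1 hnc.symm hb0 hcl.symm z hz⟩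
  obtain ⟨δ, hδ, hball⟩ := Metric.eventually_nhds_iff.1 hs
  obtain ⟨κ, hκA, hκlt⟩ := exists_lt_of_csInf_lt hne (show sInf A < κb + δ by linarith)
  have := csInf_le hbd hκA
  exact hκA.2 (hball (by rw [Real.dist_eq, abs_of_nonneg (by linarith)]; linarith))

lemma NC1.trans {n : ℕ} {f : ℝ → ℝ} {b : ℝ × ℝ → ℝ} (h : NC1 n f b) (c : ℝ) :
    NC1 n f (fun z => b (z.1, z.2 + c)) := by
  obtain ⟨s, t, hs, ht, ⟨z, hz, hsz⟩, ⟨y, hy, hty⟩, hne⟩ := h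
  exact ⟨s, t, hs, ht, ⟨(z.1, z.2 - c), hz, by simpa using hsz⟩, ⟨(y.1, y.2 - c), hy, by simpa using hty⟩, hne⟩

/-- one-sided comparison, `σ = ±1` chooses the side. -/
lemma Sys.side {n : ℕ} {f g : ℝ → ℝ} {a b : ℝ × ℝ → ℝ} (h : Sys n f g a b)
    (hnc : NC1 n f b ∨ NC1 n g a) (σ : ℝ) (hσ : σ^2 = 1) {S t : ℝ} (hS : 0 < S) (ht : 0 < σ * t) :
    a (S, t) ≤ a (S, -t) := by
  have key : ∀ᶠ R : ℝ in atTop, a (S, t) ≤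
      (R^2 / (S^2 + (t - σ*R)^2)) ^ ((n:ℝ)/2) *
        a (R^2 * S / (S^2 + (t - σ*R)^2), R^2 * (t - σ*R) / (S^2 + (t - σ*R)^2) + σ*R) := by
    filter_upwards [eventually_gt_atTop 0, eventually_gt_atTop ((S^2 + t^2) / (2 * (σ * t)))] with R hR0 hR
    have := (h.trans (σ * R)).all (hnc.imp (fun k => k.trans _) (fun k => k.trans _)) (R^2) (by positivity)
      (S, t - σ * R) ⟨hS, by
        rw [div_lt_iff₀ (by positivity)] at hR
        show S^2 + (t - σ*R)^2 < R^2
        nlinarith⟩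
    have := this.1
    simpa [kel, kap, qq] using this
  have l1 : Tendsto (fun R : ℝ => 1/R) atTop (𝓝 0) := tendsto_const_nhds.div_atTop tendsto_id
  -- substitute x = 1/R
  have c1 : ContinuousAt (fun x : ℝ => ((1 / (S^2 * x^2 + (t * x - σ)^2)) ^ ((n:ℝ)/2) *
        a (S / (S^2 * x^2 + (t * x - σ)^2), (-t + σ * x * (S^2+t^2)) / (S^2 * x^2 + (t * x - σ)^2)))) 0 := by
    have hne : S^2 * (0:ℝ)^2 + (t * 0 - σ)^2 ≠ 0 := by simp [hσ]
    have d0 : ContinuousAt (fun x : ℝ => S^2 * x^2 + (t * x - σ)^2) 0 := by fun_prop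
    have d1 : ContinuousAt (fun x : ℝ => 1 / (S^2 * x^2 + (t * x - σ)^2)) 0 := continuousAt_const.div d0 hne
    refine (d1.rpow_const (Or.inl (one_div_ne_zero hne))).mul ?_
    exact ContinuousAt.comp (f := fun x : ℝ => (S / (S^2 * x^2 + (t * x - σ)^2), (-t + σ * x * (S^2+t^2)) / (S^2 * x^2 + (t * x - σ)^2)))
      h.ca.continuousAt ((continuousAt_const.div d0 hne).prodMk (ContinuousAt.div (by fun_prop) d0 hne))
  have l2 := c1.tendsto.comp l1
  have e0 : (S^2 * (0:ℝ)^2 + (t * 0 - σ)^2) = 1 := by simp [hσ]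
  rw [e0, mul_zero, zero_mul, add_zero, div_one, div_one, div_one, Real.one_rpow, one_mul] at l2
  refine ge_of_tendsto l2 ?_
  filter_upwards [key, eventually_gt_atTop 0] with R hk hR
  refine hk.trans_eq ?_
  have hD : 0 < S^2 + (t - σ*R)^2 := by positivity
  have hD' : S^2 * (1/R)^2 + (t * (1/R) - σ)^2 = (S^2 + (t - σ*R)^2) / R^2 := by field_simp
  show _ = ((1 / (S^2 * (1/R)^2 + (t * (1/R) - σ)^2)) ^ ((n:ℝ)/2) *
        a (S / (S^2 * (1/R)^2 + (t * (1/R) - σ)^2), (-t + σ * (1/R) * (S^2+t^2)) / (S^2 * (1/R)^2 + (t * (1/R) - σ)^2)))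
  rw [hD']
  have e1 : 1 / ((S^2 + (t - σ*R)^2) / R^2) = R^2 / (S^2 + (t - σ*R)^2) := by field_simp
  have e2 : S / ((S^2 + (t - σ*R)^2) / R^2) = R^2 * S / (S^2 + (t - σ*R)^2) := by field_simp
  have e3 : (-t + σ * (1/R) * (S^2+t^2)) / ((S^2 + (t - σ*R)^2) / R^2) = R^2 * (t - σ*R) / (S^2 + (t - σ*R)^2) + σ*R := by
    field_simp
    linear_combination (2 * t * R - σ * R^2) * hσ
  rw [e1, e2, e3]

theorem Sys.even {n : ℕ} {f g : ℝ → ℝ} {a b : ℝ × ℝ → ℝ} (h : Sys n f g a b)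
    (hnc : NC1 n f b ∨ NC1 n g a) : ∀ S t : ℝ, 0 ≤ S → a (S, t) = a (S, -t) := by
  have hpos : ∀ S t : ℝ, 0 < S → 0 < t → a (S, t) = a (S, -t) := fun S t hS ht =>
    le_antisymm (h.side hnc 1 (by norm_num) hS (by linarith))
      (by simpa using h.side hnc (-1) (by norm_num) hS (t := -t) (by linarith))
  have hP : ∀ S t : ℝ, 0 < S → a (S, t) = a (S, -t) := by
    intro S t hS
    rcases lt_trichotomy t 0 with ht | ht | ht
    · have := hpos S (-t) hS (by linarith)
      rw [neg_neg] at this; exact this.symm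
    · rw [ht]; simp
    · exact hpos S t hS ht
  intro S t hS
  have c1 : Tendsto (fun ε : ℝ => a (S + ε, t)) (𝓝[>] 0) (𝓝 (a (S, t))) := by
    have := (h.ca.comp (by fun_prop : Continuous fun ε : ℝ => ((S + ε, t):ℝ×ℝ))).tendsto 0
    simp only [Function.comp_def, add_zero] at this
    exact this.mono_left nhdsWithin_le_nhds
  have c2 : Tendsto (fun ε : ℝ => a (S + ε, -t)) (𝓝[>] 0) (𝓝 (a (S, -t))) := by
    have := (h.ca.comp (by fun_prop : Continuous fun ε : ℝ => ((S + ε, -t):ℝ×ℝ))).tendsto 0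
    simp only [Function.comp_def, add_zero] at this
    exact this.mono_left nhdsWithin_le_nhds
  refine tendsto_nhds_unique (c1.congr' ?_) c2
  filter_upwards [self_mem_nhdsWithin] with ε he
  have he : 0 < ε := he
  exact hP _ _ (by linarith)

end HP

namespace HP
open scoped ContDiff
/-- kernels smooth in both variables, with locally uniformly compact support -/
def Good (k : (ℝ × ℝ) → (ℝ × ℝ) → ℝ) : Prop :=
  (∀ z ∈ P, ∀ x, ContDiffAt ℝ ∞ (fun p : (ℝ × ℝ) × (ℝ × ℝ) => k p.1 p.2) (z, x)) ∧
  ∀ z ∈ P, ∃ K : Set (ℝ × ℝ), IsCompact K ∧ ∀ᶠ y in 𝓝 z, ∀ x, x ∉ K → k y x = 0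

lemma Good.fd {k : (ℝ × ℝ) → (ℝ × ℝ) → ℝ} (h : Good k) {z x : ℝ × ℝ} (hz : z ∈ P) :
    HasFDerivAt (fun y => k y x) ((fderiv ℝ (fun p : (ℝ × ℝ) × (ℝ × ℝ) => k p.1 p.2) (z, x)).comp
      (ContinuousLinearMap.inl ℝ (ℝ × ℝ) (ℝ × ℝ))) z := by
  have h1 := ((h.1 z hz x).differentiableAt (by simp)).hasFDerivAt
  exact HasFDerivAt.comp (f := fun y : ℝ × ℝ => (y, x)) z h1 (hasFDerivAt_prodMk_left z x)

lemma Good.dv {k : (ℝ × ℝ) → (ℝ × ℝ) → ℝ} (h : Good k) (v : ℝ × ℝ) :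
    Good (fun z x => fderiv ℝ (fun y => k y x) z v) := by
  refine ⟨fun z hz x => ?_, fun z hz => ?_⟩
  · have h1 : ContDiffAt ℝ ∞ (fun p => fderiv ℝ (fun p : (ℝ × ℝ) × (ℝ × ℝ) => k p.1 p.2) p (v, 0)) (z, x) :=
      ((h.1 z hz x).fderiv_right (m := ∞) (by simp)).clm_apply contDiffAt_const
    refine h1.congr_of_eventuallyEq ?_
    have : ∀ᶠ p : (ℝ × ℝ) × (ℝ × ℝ) in 𝓝 (z, x), p.1 ∈ P :=
      continuousAt_fst.eventually (isOpen_P.mem_nhds hz)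
    filter_upwards [this] with p hp
    rw [(h.fd hp).fderiv]; simp
  · obtain ⟨K, hK, hev⟩ := h.2 z hz
    refine ⟨K, hK, ?_⟩
    filter_upwards [hev.eventually_nhds] with y hy x hx
    have : (fun y => k y x) =ᶠ[𝓝 y] fun _ => 0 := by
      filter_upwards [hy] with w hw using hw x hx
    rw [this.fderiv_eq]; simp

lemma Good.contx {k : (ℝ × ℝ) → (ℝ × ℝ) → ℝ} (h : Good k) {z : ℝ × ℝ} (hz : z ∈ P) :
    Continuous (k z) := by
  rw [continuous_iff_continuousAt]
  intro x
  exact ContinuousAt.comp (f := fun x : ℝ × ℝ => (z, x)) (h.1 z hz x).continuousAt (by fun_prop)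

lemma Good.int {k : (ℝ × ℝ) → (ℝ × ℝ) → ℝ} (h : Good k) {A : ℝ × ℝ → ℝ} (hA : Continuous A)
    {z : ℝ × ℝ} (hz : z ∈ P) : Integrable (fun x => A x * k z x) := by
  obtain ⟨K, hK, hev⟩ := h.2 z hz
  refine (hA.mul (h.contx hz)).integrable_of_hasCompactSupport ?_
  refine HasCompactSupport.intro hK fun x hx => ?_
  show A x * k z x = 0
  rw [hev.self_of_nhds x hx, mul_zero]

lemma Good.hasFD {k : (ℝ × ℝ) → (ℝ × ℝ) → ℝ} (h : Good k) {A : ℝ × ℝ → ℝ} (hA : Continuous A)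
    {z : ℝ × ℝ} (hz : z ∈ P) :
    HasFDerivAt (fun z => ∫ x, A x * k z x)
      ((∫ x, A x * fderiv ℝ (fun y => k y x) z (1,0)) • ContinuousLinearMap.fst ℝ ℝ ℝ +
       (∫ x, A x * fderiv ℝ (fun y => k y x) z (0,1)) • ContinuousLinearMap.snd ℝ ℝ ℝ) z := by
  set D : (ℝ × ℝ) → (ℝ × ℝ) → (ℝ × ℝ →L[ℝ] ℝ) := fun z x =>
    (A x * fderiv ℝ (fun y => k y x) z (1,0)) • ContinuousLinearMap.fst ℝ ℝ ℝ +
    (A x * fderiv ℝ (fun y => k y x) z (0,1)) • ContinuousLinearMap.snd ℝ ℝ ℝ with hD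
  have g1 := h.dv (1,0)
  have g2 := h.dv (0,1)
  have i1 := g1.int hA hz
  have i2 := g2.int hA hz
  have j1 := i1.smul_const (ContinuousLinearMap.fst ℝ ℝ ℝ)
  have j2 := i2.smul_const (ContinuousLinearMap.snd ℝ ℝ ℝ)
  have hDi : Integrable (D z) := j1.add j2
  have hDe : (∫ x, D z x) = (∫ x, A x * fderiv ℝ (fun y => k y x) z (1,0)) • ContinuousLinearMap.fst ℝ ℝ ℝ +
       (∫ x, A x * fderiv ℝ (fun y => k y x) z (0,1)) • ContinuousLinearMap.snd ℝ ℝ ℝ := by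
    rw [hD, integral_add j1 j2, integral_smul_const, integral_smul_const]
  rw [← hDe]
  obtain ⟨K, hK, hev⟩ := h.2 z hz
  obtain ⟨K1, hK1, hev1⟩ := g1.2 z hz
  obtain ⟨K2, hK2, hev2⟩ := g2.2 z hz
  have hall : ∀ᶠ y in 𝓝 z, (∀ x, x ∉ K1 ∪ K2 → D y x = 0) ∧ y ∈ P := by
    filter_upwards [hev1, hev2, isOpen_P.mem_nhds hz] with y h1 h2 h3
    refine ⟨fun x hx => ?_, h3⟩
    simp only [mem_union, not_or] at hx
    simp only [hD]
    rw [h1 x hx.1, h2 x hx.2]; simp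
  obtain ⟨r, hr, hball⟩ := Metric.eventually_nhds_iff_ball.1 hall
  set C := Metric.closedBall z (r/2) with hC
  have hCb : C ⊆ Metric.ball z r := Metric.closedBall_subset_ball (by linarith)
  have hCc : IsCompact C := isCompact_closedBall z _
  have hDc : ContinuousOn (fun p : (ℝ × ℝ) × (ℝ × ℝ) => D p.1 p.2) (C ×ˢ (K1 ∪ K2)) := by
    intro p hp
    have hpP := (hball p.1 (hCb hp.1)).2
    have c1 := (g1.1 p.1 hpP p.2).continuousAt
    have c2 := (g2.1 p.1 hpP p.2).continuousAt
    have cA : ContinuousAt (fun p : (ℝ × ℝ) × (ℝ × ℝ) => A p.2) p := (hA.comp continuous_snd).continuousAt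
    exact ((((cA.mul c1).smul continuousAt_const).add ((cA.mul c2).smul continuousAt_const))).continuousWithinAt
  obtain ⟨M, hM⟩ := (hCc.prod (hK1.union hK2)).exists_bound_of_continuousOn hDc
  refine hasFDerivAt_integral_of_dominated_of_fderiv_le (F' := D) (s := C)
    (bound := (K1 ∪ K2).indicator fun _ => M) (Metric.closedBall_mem_nhds z (by linarith)) ?_ (h.int hA hz)
    hDi.aestronglyMeasurable ?_ ?_ ?_
  · filter_upwards [isOpen_P.mem_nhds hz] with y hy
    exact (h.int hA hy).aestronglyMeasurable
  · refine ae_of_all _ fun x y hy => ?_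
    by_cases hx : x ∈ K1 ∪ K2
    · rw [indicator_of_mem hx]; exact hM (y, x) ⟨hy, hx⟩
    · rw [indicator_of_notMem hx, (hball y (hCb hy)).1 x hx]; simp
  · refine (integrable_indicator_iff (hK1.union hK2).measurableSet).2 ?_
    exact integrableOn_const (hK1.union hK2).measure_lt_top.ne
  · refine ae_of_all _ fun x y hy => ?_
    have hyP := (hball y (hCb hy)).2
    have := (h.fd (x := x) hyP).differentiableAt.hasFDerivAt.const_mul (A x)
    refine this.congr_fderiv ?_
    refine ContinuousLinearMap.ext fun p => ?_
    have hp : p = p.1 • ((1:ℝ), (0:ℝ)) + p.2 • ((0:ℝ), (1:ℝ)) := by ext <;> simp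
    show A x * fderiv ℝ (fun y => k y x) y p = (A x * fderiv ℝ (fun y => k y x) y (1,0)) * p.1
      + (A x * fderiv ℝ (fun y => k y x) y (0,1)) * p.2
    conv_lhs => rw [hp, map_add, map_smul, map_smul, smul_eq_mul, smul_eq_mul]
    ring

lemma Good.cd {k : (ℝ × ℝ) → (ℝ × ℝ) → ℝ} (h : Good k) {A : ℝ × ℝ → ℝ} (hA : Continuous A) (m : ℕ) :
    ContDiffOn ℝ m (fun z => ∫ x, A x * k z x) P := by
  induction m generalizing k with
  | zero => exact contDiffOn_zero.2 fun z hz => (h.hasFD hA hz).continuousAt.continuousWithinAt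
  | succ m ih =>
    push_cast
    rw [contDiffOn_succ_iff_fderiv_of_isOpen isOpen_P]
    refine ⟨fun z hz => (h.hasFD hA hz).differentiableAt.differentiableWithinAt, by simp, ?_⟩
    refine ContDiffOn.congr ?_ fun z hz => (h.hasFD hA hz).fderiv
    exact ((ih (h.dv (1,0))).smul contDiffOn_const).add ((ih (h.dv (0,1))).smul contDiffOn_const)

lemma Good.d1 {k : (ℝ × ℝ) → (ℝ × ℝ) → ℝ} (h : Good k) {A : ℝ × ℝ → ℝ} (hA : Continuous A)
    {z : ℝ × ℝ} (hz : z ∈ P) :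
    d1 (fun z => ∫ x, A x * k z x) z = ∫ x, A x * fderiv ℝ (fun y => k y x) z (1,0) := by
  have := h.hasFD hA hz
  rw [d1_eq this.differentiableAt, this.fderiv]; simp
lemma Good.d2 {k : (ℝ × ℝ) → (ℝ × ℝ) → ℝ} (h : Good k) {A : ℝ × ℝ → ℝ} (hA : Continuous A)
    {z : ℝ × ℝ} (hz : z ∈ P) :
    d2 (fun z => ∫ x, A x * k z x) z = ∫ x, A x * fderiv ℝ (fun y => k y x) z (0,1) := by
  have := h.hasFD hA hz
  rw [d2_eq this.differentiableAt, this.fderiv]; simp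

lemma Good.Lop {k : (ℝ × ℝ) → (ℝ × ℝ) → ℝ} (h : Good k) {A : ℝ × ℝ → ℝ} (hA : Continuous A)
    {z : ℝ × ℝ} (hz : z ∈ P) (n : ℕ) :
    Lop n (fun z => ∫ x, A x * k z x) z = ∫ x, A x * Lop n (fun y => k y x) z := by
  have hPz := isOpen_P.mem_nhds hz
  have g1 := h.dv (1,0)
  have g2 := h.dv (0,1)
  have g11 := g1.dv (1,0)
  have g22 := g2.dv (0,1)
  unfold HP.Lop
  rw [d1_congr (show HP.d1 (fun z => ∫ x, A x * k z x) =ᶠ[𝓝 z] _ from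
      eventually_of_mem hPz fun y hy => h.d1 hA hy),
    d2_congr (show HP.d2 (fun z => ∫ x, A x * k z x) =ᶠ[𝓝 z] _ from
      eventually_of_mem hPz fun y hy => h.d2 hA hy), h.d1 hA hz, g1.d1 hA hz, g2.d2 hA hz]
  have e1 : ∀ x, ∀ y ∈ P, HP.d1 (fun y => k y x) y = fderiv ℝ (fun y => k y x) y (1,0) := fun x y hy =>
    d1_eq (h.fd hy).differentiableAt
  have e2 : ∀ x, ∀ y ∈ P, HP.d2 (fun y => k y x) y = fderiv ℝ (fun y => k y x) y (0,1) := fun x y hy =>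
    d2_eq (h.fd hy).differentiableAt
  have e11 : ∀ x, HP.d1 (HP.d1 (fun y => k y x)) z = fderiv ℝ (fun y => fderiv ℝ (fun y => k y x) y (1,0)) z (1,0) :=
    fun x => by
      rw [d1_congr (eventually_of_mem hPz (e1 x)), d1_eq (g1.fd hz).differentiableAt]
  have e22 : ∀ x, HP.d2 (HP.d2 (fun y => k y x)) z = fderiv ℝ (fun y => fderiv ℝ (fun y => k y x) y (0,1)) z (0,1) :=
    fun x => by
      rw [d2_congr (eventually_of_mem hPz (e2 x)), d2_eq (g2.fd hz).differentiableAt]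
  have hfun : (fun x => A x * (z.1 * (HP.d1 (HP.d1 (fun y => k y x)) z + HP.d2 (HP.d2 (fun y => k y x)) z)
      + n * HP.d1 (fun y => k y x) z)) = fun x => z.1 * (A x * fderiv ℝ (fun y => fderiv ℝ (fun y => k y x) y (1,0)) z (1,0)
        + A x * fderiv ℝ (fun y => fderiv ℝ (fun y => k y x) y (0,1)) z (0,1)) + n * (A x * fderiv ℝ (fun y => k y x) z (1,0)) := by
    funext x
    rw [e11, e22, e1 x z hz]; ring
  rw [hfun]
  have jj : Integrable (fun x => A x * fderiv ℝ (fun y => fderiv ℝ (fun y => k y x) y (1,0)) z (1,0)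
        + A x * fderiv ℝ (fun y => fderiv ℝ (fun y => k y x) y (0,1)) z (0,1)) := (g11.int hA hz).add (g22.int hA hz)
  rw [integral_add (jj.const_mul z.1) ((g1.int hA hz).const_mul _),
    integral_const_mul, integral_const_mul, integral_add (g11.int hA hz) (g22.int hA hz)]

end HP

namespace HP
open scoped ContDiff
def kern (n : ℕ) (α β : ℝ → ℝ) (z x : ℝ × ℝ) : ℝ :=
  x.1 ^ (n-1) * ((z.1 ^ n)⁻¹ * (α (x.1 / z.1) * β (x.1 * z.2 / z.1 - x.2)))
def tst (n : ℕ) (α β : ℝ → ℝ) (z x : ℝ × ℝ) : ℝ :=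
  (z.1 ^ n)⁻¹ / z.1 * (x.1 * (α (x.1 / z.1) * β (x.1 * z.2 / z.1 - x.2)))

lemma hd_invpow (n : ℕ) {s : ℝ} (hs : s ≠ 0) :
    HasDerivAt (fun s : ℝ => (s^n)⁻¹) (-(n * (s^n)⁻¹ / s)) s := by
  have := (hasDerivAt_pow n s).inv (pow_ne_zero n hs)
  refine this.congr_deriv ?_
  rcases n with _ | n
  · simp
  · rw [Nat.add_sub_cancel]; field_simp; ring

lemma hd_div (x c : ℝ) {s : ℝ} (hs : s ≠ 0) : HasDerivAt (fun s : ℝ => x / s - c) (-(x / s / s)) s := by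
  have := ((hasDerivAt_inv hs).const_mul x).sub_const c
  refine (this.congr_of_eventuallyEq (Eventually.of_forall fun s => ?_)).congr_deriv ?_
  · show x / s - c = x * s⁻¹ - c
    rw [div_eq_mul_inv]
  · field_simp

lemma kern_Lop (n : ℕ) {α β α1 α2 β1 β2 : ℝ → ℝ} (a1 : ∀ s, HasDerivAt α (α1 s) s)
    (a2 : ∀ s, HasDerivAt α1 (α2 s) s) (b1 : ∀ s, HasDerivAt β (β1 s) s)
    (b2 : ∀ s, HasDerivAt β1 (β2 s) s) {z : ℝ × ℝ} (hz : z ∈ P) (x : ℝ × ℝ) :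
    Lop n (fun y => kern n α β y x) z = x.1 ^ (n-1) * Lop n (tst n α β z) x := by
  have hz0 : z.1 ≠ 0 := (show 0 < z.1 from hz).ne'
  have hPz := isOpen_P.mem_nhds hz
  set c := x.1 ^ (n-1) with hc
  -- composite derivatives in z.1
  have CA : ∀ {γ γ1 : ℝ → ℝ} (_ : ∀ s, HasDerivAt γ (γ1 s) s) {s : ℝ} (_ : s ≠ 0),
      HasDerivAt (fun s => γ (x.1 / s)) (γ1 (x.1 / s) * (-(x.1 / s / s))) s := by
    intro γ γ1 hγ s hs
    have := hd_div x.1 0 hs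
    simp only [sub_zero] at this
    exact (hγ _).comp s this
  have CB : ∀ {γ γ1 : ℝ → ℝ} (_ : ∀ s, HasDerivAt γ (γ1 s) s) (t : ℝ) {s : ℝ} (_ : s ≠ 0),
      HasDerivAt (fun s => γ (x.1 * t / s - x.2)) (γ1 (x.1 * t / s - x.2) * (-(x.1 * t / s / s))) s := by
    intro γ γ1 hγ t s hs
    exact (hγ _).comp s (hd_div (x.1 * t) x.2 hs)
  have CT : ∀ {γ γ1 : ℝ → ℝ} (_ : ∀ s, HasDerivAt γ (γ1 s) s) (S t : ℝ),
      HasDerivAt (fun t => γ (x.1 * t / S - x.2)) (γ1 (x.1 * t / S - x.2) * (x.1 * 1 / S)) t := by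
    intro γ γ1 hγ S t
    exact (hγ _).comp t ((((hasDerivAt_id t).const_mul x.1).div_const S).sub_const x.2)
  have H1 : ∀ᶠ y in 𝓝 z, HasDerivAt (fun s => kern n α β (s, y.2) x)
      ((fun y : ℝ × ℝ => c * ((y.1^n)⁻¹ * ((1 / y.1) * (-(n * (α (x.1 / y.1) * β (x.1 * y.2 / y.1 - x.2)))
        - (x.1 / y.1) * (α1 (x.1 / y.1) * β (x.1 * y.2 / y.1 - x.2))
        - (x.1 / y.1) * (y.2 * (α (x.1 / y.1) * β1 (x.1 * y.2 / y.1 - x.2))))))) y) y.1 := by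
    filter_upwards [hPz] with y hy
    have hy0 : y.1 ≠ 0 := (show 0 < y.1 from hy).ne'
    have := ((hd_invpow n hy0).mul ((CA a1 hy0).mul (CB b1 y.2 hy0))).const_mul c
    refine this.congr_deriv ?_
    simp only [Pi.mul_apply]
    field_simp
    ring
  have H2 : ∀ᶠ y in 𝓝 z, HasDerivAt (fun s => kern n α β (y.1, s) x)
      ((fun y : ℝ × ℝ => c * ((y.1^n)⁻¹ * (α (x.1 / y.1) * (β1 (x.1 * y.2 / y.1 - x.2) * (x.1 / y.1))))) y) y.2 := by
    filter_upwards [hPz] with y hy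
    have := (((CT b1 y.1 y.2).const_mul (α (x.1 / y.1))).const_mul ((y.1^n)⁻¹)).const_mul c
    refine this.congr_deriv ?_
    ring
  have H11 : HasDerivAt (fun s => (fun y : ℝ × ℝ => c * ((y.1^n)⁻¹ * ((1 / y.1) * (-(n * (α (x.1 / y.1) * β (x.1 * y.2 / y.1 - x.2)))
        - (x.1 / y.1) * (α1 (x.1 / y.1) * β (x.1 * y.2 / y.1 - x.2))
        - (x.1 / y.1) * (y.2 * (α (x.1 / y.1) * β1 (x.1 * y.2 / y.1 - x.2))))))) (s, z.2))
      (c * ((z.1^n)⁻¹ / z.1^2 * (n * (n+1) * (α (x.1 / z.1) * β (x.1 * z.2 / z.1 - x.2))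
        + (2 * n + 2) * (x.1 / z.1) * (α1 (x.1 / z.1) * β (x.1 * z.2 / z.1 - x.2) + z.2 * (α (x.1 / z.1) * β1 (x.1 * z.2 / z.1 - x.2)))
        + (x.1 / z.1)^2 * (α2 (x.1 / z.1) * β (x.1 * z.2 / z.1 - x.2) + 2 * z.2 * (α1 (x.1 / z.1) * β1 (x.1 * z.2 / z.1 - x.2))
          + z.2^2 * (α (x.1 / z.1) * β2 (x.1 * z.2 / z.1 - x.2)))))) z.1 := by
    have dd1 : HasDerivAt (fun s : ℝ => 1 / s) (-(1 / z.1 / z.1)) z.1 := by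
      have := hd_div 1 0 hz0
      simpa only [sub_zero] using this
    have ddx : HasDerivAt (fun s : ℝ => x.1 / s) (-(x.1 / z.1 / z.1)) z.1 := by
      have := hd_div x.1 0 hz0
      simpa only [sub_zero] using this
    have T1 := (((CA a1 hz0).mul (CB b1 z.2 hz0)).const_mul (n:ℝ)).neg
    have T2 := ddx.mul ((CA a2 hz0).mul (CB b1 z.2 hz0))
    have T3 := ddx.mul (((CA a1 hz0).mul (CB b2 z.2 hz0)).const_mul z.2)
    have := ((hd_invpow n hz0).mul (dd1.mul ((T1.sub T2).sub T3))).const_mul c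
    refine this.congr_deriv ?_
    simp only [Pi.mul_apply, Pi.sub_apply, Pi.neg_apply]
    field_simp
    ring
  have H22 : HasDerivAt (fun s => (fun y : ℝ × ℝ => c * ((y.1^n)⁻¹ * (α (x.1 / y.1) * (β1 (x.1 * y.2 / y.1 - x.2) * (x.1 / y.1))))) (z.1, s))
      (c * ((z.1^n)⁻¹ * (α (x.1 / z.1) * (β2 (x.1 * z.2 / z.1 - x.2) * (x.1 / z.1)^2)))) z.2 := by
    have := ((((CT b2 z.1 z.2).mul_const (x.1 / z.1)).const_mul (α (x.1 / z.1))).const_mul ((z.1^n)⁻¹)).const_mul c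
    refine this.congr_deriv ?_
    ring
  rw [Lop_eq n H1 H2 H11 H22]
  -- the test side
  set J := (z.1 ^ n)⁻¹ / z.1 with hJ
  have XA : ∀ {γ γ1 : ℝ → ℝ} (_ : ∀ s, HasDerivAt γ (γ1 s) s) (s : ℝ),
      HasDerivAt (fun s => γ (s / z.1)) (γ1 (s / z.1) * (1 / z.1)) s := fun hγ s =>
    (hγ _).comp s ((hasDerivAt_id s).div_const z.1)
  have XB : ∀ {γ γ1 : ℝ → ℝ} (_ : ∀ s, HasDerivAt γ (γ1 s) s) (u s : ℝ),
      HasDerivAt (fun s => γ (s * z.2 / z.1 - u)) (γ1 (s * z.2 / z.1 - u) * (1 * z.2 / z.1)) s := fun hγ u s =>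
    (hγ _).comp s ((((hasDerivAt_id s).mul_const z.2).div_const z.1).sub_const u)
  have XT : ∀ {γ γ1 : ℝ → ℝ} (_ : ∀ s, HasDerivAt γ (γ1 s) s) (s u : ℝ),
      HasDerivAt (fun u => γ (s * z.2 / z.1 - u)) (γ1 (s * z.2 / z.1 - u) * (-1)) u := fun hγ s u =>
    (hγ _).comp u ((hasDerivAt_id u).const_sub _)
  have K1 : ∀ᶠ y in 𝓝 x, HasDerivAt (fun s => tst n α β z (s, y.2))
      ((fun y : ℝ × ℝ => J * (α (y.1 / z.1) * β (y.1 * z.2 / z.1 - y.2)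
        + y.1 * ((1 / z.1) * (α1 (y.1 / z.1) * β (y.1 * z.2 / z.1 - y.2) + z.2 * (α (y.1 / z.1) * β1 (y.1 * z.2 / z.1 - y.2)))))) y) y.1 := by
    refine Eventually.of_forall fun y => ?_
    have := ((hasDerivAt_id y.1).mul ((XA a1 y.1).mul (XB b1 y.2 y.1))).const_mul J
    refine this.congr_deriv ?_
    simp only [Pi.mul_apply, id]
    ring
  have K2 : ∀ᶠ y in 𝓝 x, HasDerivAt (fun s => tst n α β z (y.1, s))
      ((fun y : ℝ × ℝ => J * (y.1 * (α (y.1 / z.1) * (β1 (y.1 * z.2 / z.1 - y.2) * (-1))))) y) y.2 := by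
    refine Eventually.of_forall fun y => ?_
    exact (((XT b1 y.1 y.2).const_mul (α (y.1 / z.1))).const_mul y.1).const_mul J
  have K11 : HasDerivAt (fun s => (fun y : ℝ × ℝ => J * (α (y.1 / z.1) * β (y.1 * z.2 / z.1 - y.2)
        + y.1 * ((1 / z.1) * (α1 (y.1 / z.1) * β (y.1 * z.2 / z.1 - y.2) + z.2 * (α (y.1 / z.1) * β1 (y.1 * z.2 / z.1 - y.2)))))) (s, x.2))
      (J * (2 / z.1 * (α1 (x.1 / z.1) * β (x.1 * z.2 / z.1 - x.2) + z.2 * (α (x.1 / z.1) * β1 (x.1 * z.2 / z.1 - x.2)))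
        + x.1 / z.1^2 * (α2 (x.1 / z.1) * β (x.1 * z.2 / z.1 - x.2) + 2 * z.2 * (α1 (x.1 / z.1) * β1 (x.1 * z.2 / z.1 - x.2))
          + z.2^2 * (α (x.1 / z.1) * β2 (x.1 * z.2 / z.1 - x.2))))) x.1 := by
    have T1 := (XA a1 x.1).mul (XB b1 x.2 x.1)
    have T2 := (XA a2 x.1).mul (XB b1 x.2 x.1)
    have T3 := ((XA a1 x.1).mul (XB b2 x.2 x.1)).const_mul z.2
    have := (T1.add ((hasDerivAt_id x.1).mul ((T2.add T3).const_mul (1 / z.1)))).const_mul J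
    refine this.congr_deriv ?_
    simp only [Pi.mul_apply, Pi.add_apply, id]
    field_simp
    ring
  have K22 : HasDerivAt (fun s => (fun y : ℝ × ℝ => J * (y.1 * (α (y.1 / z.1) * (β1 (y.1 * z.2 / z.1 - y.2) * (-1))))) (x.1, s))
      (J * (x.1 * (α (x.1 / z.1) * (β2 (x.1 * z.2 / z.1 - x.2))))) x.2 := by
    have := ((((XT b2 x.1 x.2).mul_const (-1)).const_mul (α (x.1 / z.1))).const_mul x.1).const_mul J
    refine this.congr_deriv ?_
    ring
  rw [Lop_eq n K1 K2 K11 K22, hJ]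
  field_simp
  ring

end HP

namespace HP
open scoped ContDiff
structure Bmp (δ c : ℝ) (α : ℝ → ℝ) : Prop where
  sm : ContDiff ℝ ∞ α
  nn : ∀ s, 0 ≤ α s
  sup : ∀ s, δ < |s - c| → α s = 0
  pos : 0 < α c

lemma exists_Bmp {δ : ℝ} (hδ : 0 < δ) (c : ℝ) : ∃ α, Bmp δ c α := by
  let β : ContDiffBump c := ⟨δ/2, δ, by linarith, by linarith⟩
  refine ⟨β, β.contDiff, fun s => β.nonneg, fun s hs => ?_, ?_⟩
  · exact β.zero_of_le_dist (by rw [Real.dist_eq]; exact hs.le)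
  · exact β.pos_of_mem_ball (by simp [β, hδ])

lemma Bmp.hd {δ c : ℝ} {α : ℝ → ℝ} (h : Bmp δ c α) :
    (∀ s, HasDerivAt α (deriv α s) s) ∧ (∀ s, HasDerivAt (deriv α) (deriv (deriv α) s) s) := by
  have h2 : ContDiff ℝ 2 α := contDiff_infty.1 h.sm 2
  refine ⟨fun s => (h2.differentiable (by simp) s).hasDerivAt, fun s => ?_⟩
  have : ContDiff ℝ 1 (deriv α) := by
    have h3 : ContDiff ℝ (1+1) α := by simpa [one_add_one_eq_two] using h2
    exact (contDiff_succ_iff_deriv.1 h3).2.2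
  exact (this.differentiable (by simp) s).hasDerivAt

lemma bmp_supp {δ : ℝ} {α β : ℝ → ℝ} (hδ : δ ≤ 1/2) (ha : Bmp δ 1 α) (hb : Bmp δ 0 β)
    {y x : ℝ × ℝ} (hy : 0 < y.1) (h : α (x.1 / y.1) * β (x.1 * y.2 / y.1 - x.2) ≠ 0) :
    y.1 / 2 ≤ x.1 ∧ x.1 ≤ 3 / 2 * y.1 ∧ |x.2| ≤ 3 / 2 * |y.2| + 1 := by
  have h1 : |x.1 / y.1 - 1| ≤ δ := by
    by_contra hc; push Not at hc; exact h (by rw [ha.sup _ hc, zero_mul])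
  have h2 : |x.1 * y.2 / y.1 - x.2 - 0| ≤ δ := by
    by_contra hc; push Not at hc; exact h (by rw [hb.sup _ hc, mul_zero])
  rw [sub_zero] at h2
  have h3 := abs_le.1 h1
  have e1 : 1/2 ≤ x.1 / y.1 := by linarith
  have e2 : x.1 / y.1 ≤ 3/2 := by linarith
  refine ⟨?_, ?_, ?_⟩
  · rw [le_div_iff₀ hy] at e1; linarith
  · rwa [div_le_iff₀ hy] at e2
  · have e : x.2 = x.1 / y.1 * y.2 - (x.1 * y.2 / y.1 - x.2) := by ring
    have e3 : |x.1 / y.1 * y.2| ≤ 3/2 * |y.2| := by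
      rw [abs_mul, abs_of_nonneg (by linarith : 0 ≤ x.1 / y.1)]
      exact mul_le_mul_of_nonneg_right e2 (abs_nonneg _)
    have := abs_sub (x.1 / y.1 * y.2) (x.1 * y.2 / y.1 - x.2)
    rw [← e] at this
    linarith

lemma good_kern (n : ℕ) {δ : ℝ} {α β : ℝ → ℝ} (hδ : δ ≤ 1/2) (ha : Bmp δ 1 α) (hb : Bmp δ 0 β) :
    Good (kern n α β) := by
  refine ⟨fun z hz x => ?_, fun z hz => ?_⟩
  · have hz0 : z.1 ≠ 0 := (show 0 < z.1 from hz).ne'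
    have d1 : ContDiffAt ℝ ∞ (fun p : (ℝ × ℝ) × (ℝ × ℝ) => p.2.1 / p.1.1) (z, x) :=
      ContDiffAt.div (n := ∞) (f := fun p : (ℝ × ℝ) × (ℝ × ℝ) => p.2.1) (g := fun p => p.1.1) (by fun_prop) (by fun_prop) hz0
    have d2 : ContDiffAt ℝ ∞ (fun p : (ℝ × ℝ) × (ℝ × ℝ) => p.2.1 * p.1.2 / p.1.1 - p.2.2) (z, x) :=
      (ContDiffAt.div (n := ∞) (f := fun p : (ℝ × ℝ) × (ℝ × ℝ) => p.2.1 * p.1.2) (g := fun p => p.1.1) (by fun_prop) (by fun_prop) hz0).sub (by fun_prop)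
    have d3 : ContDiffAt ℝ ∞ (fun p : (ℝ × ℝ) × (ℝ × ℝ) => (p.1.1 ^ n)⁻¹) (z, x) :=
      ContDiffAt.inv (by fun_prop) (pow_ne_zero n hz0)
    have d4 : ContDiffAt ℝ ∞ (fun p : (ℝ × ℝ) × (ℝ × ℝ) => p.2.1 ^ (n-1)) (z, x) := by fun_prop
    exact d4.mul (d3.mul ((ha.sm.contDiffAt.comp _ d1).mul (hb.sm.contDiffAt.comp _ d2)))
  · have hz0 : 0 < z.1 := hz
    refine ⟨Icc 0 (3 * z.1) ×ˢ Icc (-(3/2 * (|z.2| + 1) + 1)) (3/2 * (|z.2| + 1) + 1),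
      isCompact_Icc.prod isCompact_Icc, ?_⟩
    have e1 : ∀ᶠ y : ℝ × ℝ in 𝓝 z, 0 < y.1 := isOpen_P.mem_nhds hz
    have e2 : ∀ᶠ y : ℝ × ℝ in 𝓝 z, y.1 < 2 * z.1 :=
      continuousAt_fst.eventually (gt_mem_nhds (by linarith))
    have e3 : ∀ᶠ y : ℝ × ℝ in 𝓝 z, |y.2| < |z.2| + 1 :=
      (continuousAt_snd.abs).eventually (gt_mem_nhds (by linarith))
    filter_upwards [e1, e2, e3] with y h1 h2 h3 x hx
    by_contra hne
    have hne' : α (x.1 / y.1) * β (x.1 * y.2 / y.1 - x.2) ≠ 0 := by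
      intro h0; exact hne (by simp [kern, h0])
    obtain ⟨q1, q2, q3⟩ := bmp_supp hδ ha hb h1 hne'
    apply hx
    have := abs_le.1 q3
    exact ⟨⟨by linarith, by linarith⟩, ⟨by linarith, by linarith⟩⟩

lemma tst_test (n : ℕ) {δ : ℝ} {α β : ℝ → ℝ} (hδ : δ ≤ 1/2) (ha : Bmp δ 1 α) (hb : Bmp δ 0 β)
    {z : ℝ × ℝ} (hz : z ∈ P) : ContDiff ℝ ∞ (tst n α β z) ∧ HasCompactSupport (tst n α β z) ∧
      tsupport (tst n α β z) ⊆ P := by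
  have hz0 : 0 < z.1 := hz
  set K : Set (ℝ × ℝ) := Icc (z.1/2) (3/2 * z.1) ×ˢ Icc (-(3/2 * |z.2| + 1)) (3/2 * |z.2| + 1)
  have hK : IsCompact K := isCompact_Icc.prod isCompact_Icc
  have h0 : ∀ x, x ∉ K → tst n α β z x = 0 := by
    intro x hx
    by_contra hne
    have hne' : α (x.1 / z.1) * β (x.1 * z.2 / z.1 - x.2) ≠ 0 := by
      intro h0; exact hne (by simp [tst, h0])
    obtain ⟨q1, q2, q3⟩ := bmp_supp hδ ha hb hz0 hne'
    apply hx
    have := abs_le.1 q3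
    exact ⟨⟨by linarith, by linarith⟩, ⟨by linarith, by linarith⟩⟩
  refine ⟨?_, HasCompactSupport.intro hK h0, ?_⟩
  · have d1 : ContDiff ℝ ∞ (fun x : ℝ × ℝ => x.1 / z.1) := contDiff_fst.div_const _
    have d2 : ContDiff ℝ ∞ (fun x : ℝ × ℝ => x.1 * z.2 / z.1 - x.2) :=
      ((contDiff_fst.mul contDiff_const).div_const _).sub contDiff_snd
    exact contDiff_const.mul (contDiff_fst.mul ((ha.sm.comp d1).mul (hb.sm.comp d2)))
  · have : tsupport (tst n α β z) ⊆ K := by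
      refine closure_minimal ?_ hK.isClosed
      intro x hx
      by_contra hc
      exact hx (h0 x hc)
    intro x hx
    have := (this hx).1.1
    show 0 < x.1
    linarith

lemma cvar {S t : ℝ} (hS : 0 < S) {Φ : ℝ × ℝ → ℝ} (h1 : Integrable Φ)
    (h2 : Integrable (fun x : ℝ × ℝ => Φ (x.1 / S, x.1 * t / S - x.2))) :
    ∫ x : ℝ × ℝ, Φ (x.1 / S, x.1 * t / S - x.2) = S * ∫ p, Φ p := by
  rw [Measure.volume_eq_prod] at h1 h2 ⊢
  rw [integral_prod _ h2, integral_prod _ h1]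
  have : ∀ s : ℝ, ∫ r, Φ (s / S, s * t / S - r) = (fun l => ∫ r, Φ (l, r)) (s / S) := by
    intro s
    exact integral_sub_left_eq_self (fun r => Φ (s / S, r)) volume (s * t / S)
  simp only [this]
  rw [Measure.integral_comp_div (fun l => ∫ r, Φ (l, r)), abs_of_pos hS, smul_eq_mul]

def nu (n : ℕ) (α β : ℝ → ℝ) (p : ℝ × ℝ) : ℝ := p.1 ^ (n-1) * (α p.1 * β p.2)

lemma nu_supp (n : ℕ) {δ : ℝ} {α β : ℝ → ℝ} (ha : Bmp δ 1 α) (hb : Bmp δ 0 β) {p : ℝ × ℝ}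
    (h : nu n α β p ≠ 0) : |p.1 - 1| ≤ δ ∧ |p.2| ≤ δ := by
  constructor
  · by_contra hc; push Not at hc; exact h (by simp [nu, ha.sup _ hc])
  · by_contra hc; push Not at hc; exact h (by simp [nu, hb.sup p.2 (by simpa using hc)])

lemma nu_cs (n : ℕ) {δ : ℝ} {α β : ℝ → ℝ} (ha : Bmp δ 1 α) (hb : Bmp δ 0 β) :
    HasCompactSupport (nu n α β) := by
  refine HasCompactSupport.intro (K := Icc (1-δ) (1+δ) ×ˢ Icc (-δ) δ) (isCompact_Icc.prod isCompact_Icc) ?_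
  intro p hp
  by_contra hne
  obtain ⟨q1, q2⟩ := nu_supp n ha hb hne
  have q1 := abs_le.1 q1
  have q2 := abs_le.1 q2
  exact hp ⟨⟨by linarith, by linarith⟩, ⟨by linarith, by linarith⟩⟩

lemma nu_cont (n : ℕ) {δ : ℝ} {α β : ℝ → ℝ} (ha : Bmp δ 1 α) (hb : Bmp δ 0 β) :
    Continuous (nu n α β) := by
  have := ha.sm.continuous
  have := hb.sm.continuous
  unfold nu; fun_prop

lemma nu_nn (n : ℕ) {δ : ℝ} {α β : ℝ → ℝ} (hδ : δ ≤ 1/2) (ha : Bmp δ 1 α) (hb : Bmp δ 0 β) (p : ℝ × ℝ) :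
    0 ≤ nu n α β p := by
  by_cases h : nu n α β p = 0
  · rw [h]
  · have := abs_le.1 (nu_supp n ha hb h).1
    exact mul_nonneg (pow_nonneg (by linarith) _) (mul_nonneg (ha.nn _) (hb.nn _))

lemma nu_int (n : ℕ) {δ : ℝ} {α β : ℝ → ℝ} (ha : Bmp δ 1 α) (hb : Bmp δ 0 β) {G : ℝ × ℝ → ℝ} (hG : Continuous G) :
    Integrable (fun p => nu n α β p * G p) :=
  ((nu_cont n ha hb).mul hG).integrable_of_hasCompactSupport (nu_cs n ha hb).mul_right

lemma nu_pos (n : ℕ) {δ : ℝ} {α β : ℝ → ℝ} (hδ : δ ≤ 1/2) (ha : Bmp δ 1 α) (hb : Bmp δ 0 β) :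
    0 < ∫ p, nu n α β p := by
  refine (nu_cont n ha hb).integral_pos_of_hasCompactSupport_nonneg_nonzero (nu_cs n ha hb)
    (nu_nn n hδ ha hb) (x := (1,0)) ?_
  have h1 := ha.pos
  have h2 := hb.pos
  simp only [nu, one_pow, one_mul]
  positivity

lemma nu_avg (n : ℕ) {δ : ℝ} {α β : ℝ → ℝ} (hδ : δ ≤ 1/2) (ha : Bmp δ 1 α) (hb : Bmp δ 0 β)
    {G : ℝ × ℝ → ℝ} (hG : Continuous G) {g ε : ℝ}
    (h : ∀ p : ℝ × ℝ, |p.1 - 1| ≤ δ → |p.2| ≤ δ → |G p - g| ≤ ε) :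
    |(∫ p, nu n α β p)⁻¹ * (∫ p, nu n α β p * G p) - g| ≤ ε := by
  have hc := nu_pos n hδ ha hb
  set c := ∫ p, nu n α β p with hcd
  have i0 : Integrable (nu n α β) := (nu_cont n ha hb).integrable_of_hasCompactSupport (nu_cs n ha hb)
  have i1 := nu_int n ha hb hG
  have e : c⁻¹ * (∫ p, nu n α β p * G p) - g = c⁻¹ * ∫ p, (nu n α β p * G p - nu n α β p * g) := by
    rw [integral_sub i1 (i0.mul_const g), integral_mul_const, ← hcd]
    field_simp
  rw [e, abs_mul, abs_of_pos (inv_pos.2 hc)]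
  have : |∫ p, (nu n α β p * G p - nu n α β p * g)| ≤ ∫ p, nu n α β p * ε := by
    refine (abs_integral_le_integral_abs).trans ?_
    refine integral_mono (i1.sub (i0.mul_const g)).abs (i0.mul_const ε) ?_
    intro p
    show |nu n α β p * G p - nu n α β p * g| ≤ nu n α β p * ε
    rw [← mul_sub, abs_mul, abs_of_nonneg (nu_nn n hδ ha hb p)]
    by_cases h0 : nu n α β p = 0
    · simp [h0]
    · obtain ⟨q1, q2⟩ := nu_supp n ha hb h0
      exact mul_le_mul_of_nonneg_left (h p q1 q2) (nu_nn n hδ ha hb p)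
  calc c⁻¹ * _ ≤ c⁻¹ * ∫ p, nu n α β p * ε := mul_le_mul_of_nonneg_left this (inv_pos.2 hc).le
    _ = ε := by rw [integral_mul_const, ← hcd]; field_simp

lemma kern_nu (n : ℕ) (hn : 1 ≤ n) {δ : ℝ} {α β : ℝ → ℝ} (hδ : δ ≤ 1/2) (ha : Bmp δ 1 α) (hb : Bmp δ 0 β)
    {G : ℝ × ℝ → ℝ} (hG : Continuous G) {z : ℝ × ℝ} (hz : z ∈ P) :
    ∫ x, G x * kern n α β z x = ∫ p, nu n α β p * G (p.1 * z.1, p.1 * z.2 - p.2) := by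
  have hz0 : 0 < z.1 := hz
  have i1 := nu_int n ha hb (G := fun p => G (p.1 * z.1, p.1 * z.2 - p.2)) (by fun_prop)
  have e : ∀ x : ℝ × ℝ, G x * kern n α β z x = z.1⁻¹ *
      (fun p : ℝ × ℝ => nu n α β p * G (p.1 * z.1, p.1 * z.2 - p.2)) (x.1 / z.1, x.1 * z.2 / z.1 - x.2) := by
    intro x
    have e1 : x.1 / z.1 * z.1 = x.1 := by field_simp
    have e2 : x.1 / z.1 * z.2 - (x.1 * z.2 / z.1 - x.2) = x.2 := by ring
    simp only [nu, kern, e1, e2]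
    obtain ⟨m, rfl⟩ : ∃ m, n = m + 1 := ⟨n - 1, by omega⟩
    simp only [Nat.add_sub_cancel, Prod.mk.eta, div_pow]
    field_simp
    ring
  have i2 : Integrable (fun x => G x * kern n α β z x) := (good_kern n hδ ha hb).int hG hz
  have i3 : Integrable (fun x : ℝ × ℝ => (fun p : ℝ × ℝ => nu n α β p * G (p.1 * z.1, p.1 * z.2 - p.2)) (x.1 / z.1, x.1 * z.2 / z.1 - x.2)) := by
    have := i2.const_mul z.1
    refine this.congr (Eventually.of_forall fun x => ?_)
    simp only [e x]
    field_simp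
  rw [integral_congr_ae (Eventually.of_forall e), integral_const_mul, cvar hz0 i1 i3, ← mul_assoc, inv_mul_cancel₀ hz0.ne', one_mul]

def Dist (n : ℕ) (a F : ℝ × ℝ → ℝ) : Prop :=
  ∀ ψ : ℝ × ℝ → ℝ, ContDiff ℝ ∞ ψ → HasCompactSupport ψ → tsupport ψ ⊆ P →
    ∫ z, a z * z.1 ^ (n-1) * Lop n ψ z = - ∫ z, F z * z.1 ^ (n-1) * ψ z

lemma Dist.apx {n : ℕ} (hn : 1 ≤ n) {a F : ℝ × ℝ → ℝ} (ca : Continuous a) (cF : Continuous F)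
    (h : Dist n a F) : Apx n a F := by
  intro K hKP hK ε hε
  have hev : ∀ᶠ p : ℝ × ℝ in 𝓝 ((1:ℝ), (0:ℝ)), ∀ z ∈ K,
      |a (p.1 * z.1, p.1 * z.2 - p.2) - a z| ≤ ε ∧ |p.1 * F (p.1 * z.1, p.1 * z.2 - p.2) - F z| ≤ ε := by
    refine hK.eventually_forall_of_forall_eventually (P := fun (p : ℝ × ℝ) (z : ℝ × ℝ) =>
      |a (p.1 * z.1, p.1 * z.2 - p.2) - a z| ≤ ε ∧ |p.1 * F (p.1 * z.1, p.1 * z.2 - p.2) - F z| ≤ ε) ?_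
    intro z hz
    have c1 : Continuous (fun q : (ℝ × ℝ) × (ℝ × ℝ) => |a (q.1.1 * q.2.1, q.1.1 * q.2.2 - q.1.2) - a q.2|) := by fun_prop
    have c2 : Continuous (fun q : (ℝ × ℝ) × (ℝ × ℝ) => |q.1.1 * F (q.1.1 * q.2.1, q.1.1 * q.2.2 - q.1.2) - F q.2|) := by fun_prop
    have e1 : ∀ᶠ q in 𝓝 (((1:ℝ),(0:ℝ)), z), |a (q.1.1 * q.2.1, q.1.1 * q.2.2 - q.1.2) - a q.2| < ε :=
      c1.continuousAt.eventually (gt_mem_nhds (by simpa using hε))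
    have e2 : ∀ᶠ q in 𝓝 (((1:ℝ),(0:ℝ)), z), |q.1.1 * F (q.1.1 * q.2.1, q.1.1 * q.2.2 - q.1.2) - F q.2| < ε :=
      c2.continuousAt.eventually (gt_mem_nhds (by simpa using hε))
    filter_upwards [e1, e2] with q h1 h2 using ⟨h1.le, h2.le⟩
  obtain ⟨η, hη, hball⟩ := Metric.eventually_nhds_iff.1 hev
  set δ := min (η/2) (1/2) with hδd
  have hδ0 : 0 < δ := lt_min (by linarith) (by norm_num)
  have hδ : δ ≤ 1/2 := min_le_right _ _
  have hcl : ∀ p : ℝ × ℝ, |p.1 - 1| ≤ δ → |p.2| ≤ δ → ∀ z ∈ K,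
      |a (p.1 * z.1, p.1 * z.2 - p.2) - a z| ≤ ε ∧ |p.1 * F (p.1 * z.1, p.1 * z.2 - p.2) - F z| ≤ ε := by
    intro p h1 h2
    apply hball
    rw [Prod.dist_eq, Real.dist_eq, Real.dist_eq, sub_zero]
    have : δ < η := lt_of_le_of_lt (min_le_left _ _) (by linarith)
    exact max_lt (lt_of_le_of_lt h1 this) (lt_of_le_of_lt h2 this)
  obtain ⟨α, ha⟩ := exists_Bmp hδ0 1
  obtain ⟨β, hb⟩ := exists_Bmp hδ0 0
  have hg := good_kern n hδ ha hb
  set c := ∫ p, nu n α β p with hc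
  have cA : Continuous (fun x => c⁻¹ * a x) := by fun_prop
  refine ⟨fun z => ∫ x, (c⁻¹ * a x) * kern n α β z x, fun z hz =>
    (hg.cd cA 2).contDiffAt (isOpen_P.mem_nhds hz), fun z hz => ?_⟩
  have hzP := hKP hz
  have hz0 : 0 < z.1 := hzP
  constructor
  · show |(∫ x, (c⁻¹ * a x) * kern n α β z x) - a z| ≤ ε
    have : ∫ x, (c⁻¹ * a x) * kern n α β z x = c⁻¹ * ∫ p, nu n α β p * a (p.1 * z.1, p.1 * z.2 - p.2) := by
      simp only [mul_assoc]
      rw [integral_const_mul, kern_nu n hn hδ ha hb ca hzP]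
    rw [this]
    exact nu_avg n hδ ha hb (by fun_prop) (fun p h1 h2 => (hcl p h1 h2 z hz).1)
  · rw [hg.Lop cA hzP]
    obtain ⟨t1, t2, t3⟩ := tst_test n hδ ha hb hzP
    have E1 : ∫ x, (c⁻¹ * a x) * Lop n (fun y => kern n α β y x) z
        = c⁻¹ * ∫ x, a x * x.1 ^ (n-1) * Lop n (tst n α β z) x := by
      rw [← integral_const_mul]
      refine integral_congr_ae (Eventually.of_forall fun x => ?_)
      simp only [kern_Lop n ha.hd.1 ha.hd.2 hb.hd.1 hb.hd.2 hzP x]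
      ring
    have E2 : ∫ x, F x * x.1 ^ (n-1) * tst n α β z x = ∫ p, nu n α β p * (p.1 * F (p.1 * z.1, p.1 * z.2 - p.2)) := by
      have := kern_nu n hn hδ ha hb (G := fun x => x.1 / z.1 * F x) (by fun_prop) hzP
      have e3 : ∀ p : ℝ × ℝ, p.1 * z.1 / z.1 = p.1 := fun p => by field_simp
      simp only [e3] at this
      rw [← this]
      refine integral_congr_ae (Eventually.of_forall fun x => ?_)
      simp only [kern, tst]
      ring
    rw [E1, h _ t1 t2 t3, E2]
    have := nu_avg n hδ ha hb (G := fun p => p.1 * F (p.1 * z.1, p.1 * z.2 - p.2)) (by fun_prop)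
      (fun p h1 h2 => (hcl p h1 h2 z hz).2)
    rw [← abs_neg]
    convert this using 2
    ring

end HP

namespace HP
open scoped ContDiff
open Heisenberg
variable {n : ℕ}

/-- the horizontal frame -/
def vec (c : Fin n ⊕ Fin n) (ξ : H n) : H n :=
  Sum.elim (fun i => (Pi.single i 1, 0, 2 * ξ.2.1 i)) (fun i => (0, Pi.single i 1, -(2 * ξ.1 i))) c

def Dd (c : Fin n ⊕ Fin n) (φ : H n → ℝ) (ξ : H n) : ℝ := fderiv ℝ φ ξ (vec c ξ)

def Gc (G : H n → (Fin n → ℝ) × (Fin n → ℝ)) (c : Fin n ⊕ Fin n) (ξ : H n) : ℝ :=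
  Sum.elim (G ξ).1 (G ξ).2 c

lemma vec_cd (c : Fin n ⊕ Fin n) : ContDiff ℝ ∞ (vec c) := by
  rcases c with i | i
  · show ContDiff ℝ ∞ (fun ξ : H n => ((Pi.single i 1, 0, 2 * ξ.2.1 i) : H n))
    fun_prop
  · show ContDiff ℝ ∞ (fun ξ : H n => ((0, Pi.single i 1, -(2 * ξ.1 i)) : H n))
    fun_prop

def Ts (φ : H n → ℝ) : Prop := ContDiff ℝ ∞ φ ∧ HasCompactSupport φ

lemma Ts.test {φ : H n → ℝ} (h : Ts φ) : IsTest Set.univ φ :=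
  ⟨contDiff_infty.1 h.1 1, h.2, subset_univ _⟩

lemma Ts.add {φ ψ : H n → ℝ} (h : Ts φ) (h' : Ts ψ) : Ts (fun ξ => φ ξ + ψ ξ) :=
  ⟨h.1.add h'.1, h.2.add h'.2⟩

lemma Ts.D {φ : H n → ℝ} (h : Ts φ) (c : Fin n ⊕ Fin n) : Ts (Dd c φ) := by
  refine ⟨(h.1.fderiv_right (m := ∞) (by simp)).clm_apply (vec_cd c), ?_⟩
  refine (h.2.fderiv ℝ).mono' ?_
  intro ξ hξ
  apply subset_closure
  intro h0
  exact hξ (by simp [Dd, h0])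

lemma Dd_add {φ ψ : H n → ℝ} (h : Ts φ) (h' : Ts ψ) (c : Fin n ⊕ Fin n) (ξ : H n) :
    Dd c (fun ξ => φ ξ + ψ ξ) ξ = Dd c φ ξ + Dd c ψ ξ := by
  unfold Dd
  rw [fderiv_fun_add (h.1.differentiable (by simp) ξ) (h'.1.differentiable (by simp) ξ)]
  rfl

lemma Ts.int {φ : H n → ℝ} (h : Ts φ) {u : H n → ℝ} (hu : Continuous u) :
    Integrable (fun ξ => u ξ * φ ξ) :=
  (hu.mul h.1.continuous).integrable_of_hasCompactSupport h.2.mul_left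

lemma hdot_eq (G : H n → (Fin n → ℝ) × (Fin n → ℝ)) (φ : H n → ℝ) (ξ : H n) :
    hdot (G ξ) (hGrad φ ξ) = ∑ c, Gc G c ξ * Dd c φ ξ := by
  rw [Fintype.sum_sum_type]; rfl

lemma zero_of_nonint {I : (H n → ℝ) → H n → ℝ} {l : (H n → ℝ) → ℝ}
    (hI : ∀ φ ψ, Ts φ → Ts ψ → ∀ ξ, I (fun ξ => φ ξ + ψ ξ) ξ = I φ ξ + I ψ ξ)
    (hl : ∀ φ ψ, Ts φ → Ts ψ → l (fun ξ => φ ξ + ψ ξ) = l φ + l ψ)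
    (h : ∀ φ, Ts φ → ∫ ξ, I φ ξ = l φ) {φ0 : H n → ℝ} (h0 : Ts φ0) (hni : ¬ Integrable (I φ0))
    {φ : H n → ℝ} (hφ : Ts φ) : l φ = 0 := by
  have e0 : l φ0 = 0 := by rw [← h _ h0, integral_undef hni]
  by_cases hi : Integrable (I φ)
  · have : ¬ Integrable (I (fun ξ => φ ξ + φ0 ξ)) := by
      intro hc
      apply hni
      refine (hc.sub hi).congr (Eventually.of_forall fun ξ => ?_)
      simp only [Pi.sub_apply, hI φ φ0 hφ h0 ξ]; ring
    have e1 : l (fun ξ => φ ξ + φ0 ξ) = 0 := by rw [← h _ (hφ.add h0), integral_undef this]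
    rw [hl _ _ hφ h0, e0] at e1
    linarith
  · rw [← h _ hφ, integral_undef hi]

def lin (c : Fin n ⊕ Fin n) (ξ : H n) : ℝ := Sum.elim ξ.1 ξ.2.1 c

lemma lin_hd (c : Fin n ⊕ Fin n) (ξ : H n) : ∃ L : H n →L[ℝ] ℝ, HasFDerivAt (lin c) L ξ ∧ ∀ v, L v = lin c v := by
  rcases c with i | i
  · refine ⟨(ContinuousLinearMap.proj i).comp (ContinuousLinearMap.fst ℝ _ _), ?_, fun v => rfl⟩
    exact ((ContinuousLinearMap.proj i).comp (ContinuousLinearMap.fst ℝ (Fin n → ℝ) ((Fin n → ℝ) × ℝ))).hasFDerivAt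
  · refine ⟨(ContinuousLinearMap.proj i).comp ((ContinuousLinearMap.fst ℝ _ _).comp (ContinuousLinearMap.snd ℝ _ _)), ?_, fun v => rfl⟩
    exact ((ContinuousLinearMap.proj (φ := fun _ : Fin n => ℝ) i).comp ((ContinuousLinearMap.fst ℝ (Fin n → ℝ) ℝ).comp (ContinuousLinearMap.snd ℝ (Fin n → ℝ) ((Fin n → ℝ) × ℝ)))).hasFDerivAt

lemma lin_cd (c : Fin n ⊕ Fin n) : ContDiff ℝ ∞ (lin c) := by
  rcases c with i | i
  · show ContDiff ℝ ∞ (fun ξ : H n => ξ.1 i)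
    fun_prop
  · show ContDiff ℝ ∞ (fun ξ : H n => ξ.2.1 i)
    fun_prop

lemma lin_vec (c c' : Fin n ⊕ Fin n) (ξ : H n) : lin c (vec c' ξ) = if c' = c then 1 else 0 := by
  rcases c with i | i <;> rcases c' with j | j <;> simp [lin, vec, Pi.single_apply, eq_comm]

lemma comp_int {G : H n → (Fin n → ℝ) × (Fin n → ℝ)}
    (h : ∀ φ, Ts φ → Integrable (fun ξ => ∑ c, Gc G c ξ * Dd c φ ξ)) (c : Fin n ⊕ Fin n)
    {ψ : H n → ℝ} (hψ : Ts ψ) : Integrable (fun ξ => Gc G c ξ * ψ ξ) := by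
  obtain ⟨R, hR0, hR⟩ : ∃ R : ℝ, 0 < R ∧ tsupport ψ ⊆ Metric.ball 0 R := by
    obtain ⟨R, hR⟩ := hψ.2.isCompact.isBounded.subset_ball (0 : H n)
    exact ⟨max R 1, by positivity, hR.trans (Metric.ball_subset_ball (le_max_left _ _))⟩
  let χ : ContDiffBump (0 : H n) := ⟨R, R+1, hR0, by linarith⟩
  have hφ : Ts (fun ξ => lin c ξ * χ ξ) :=
    ⟨(lin_cd c).mul χ.contDiff, χ.hasCompactSupport.mul_left⟩
  have hi := h _ hφ
  obtain ⟨C, hC⟩ := hψ.2.exists_bound_of_continuous hψ.1.continuous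
  have := hi.mul_bdd (g := ψ) hψ.1.continuous.aestronglyMeasurable (Eventually.of_forall hC)
  refine this.congr (Eventually.of_forall fun ξ => ?_)
  show (∑ c', Gc G c' ξ * Dd c' (fun ξ => lin c ξ * χ ξ) ξ) * ψ ξ = Gc G c ξ * ψ ξ
  by_cases h0 : ψ ξ = 0
  · simp [h0]
  · have hb : ξ ∈ Metric.ball (0 : H n) R := hR (subset_closure h0)
    have hev : (fun ξ => lin c ξ * χ ξ) =ᶠ[𝓝 ξ] lin c := by
      filter_upwards [Metric.isOpen_ball.mem_nhds hb] with η hη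
      rw [χ.one_of_mem_closedBall (Metric.ball_subset_closedBall hη), mul_one]
    obtain ⟨L, hL, hLv⟩ := lin_hd c ξ
    congr 1
    have : ∀ c', Dd c' (fun ξ => lin c ξ * χ ξ) ξ = if c' = c then 1 else 0 := by
      intro c'
      unfold Dd
      rw [hev.fderiv_eq, hL.fderiv, hLv, lin_vec]
    simp [this]

lemma haar_H : (volume : Measure (H n)).IsAddHaarMeasure := by
  have h1 : (volume : Measure ((Fin n → ℝ) × ℝ)).IsAddHaarMeasure :=
    Measure.prod.instIsAddHaarMeasure (volume : Measure (Fin n → ℝ)) (volume : Measure ℝ)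
  exact Measure.prod.instIsAddHaarMeasure (volume : Measure (Fin n → ℝ)) (volume : Measure ((Fin n → ℝ) × ℝ))

/-- finite order linear maps preserve the measure -/
lemma mp_of_order {R : H n →ₗ[ℝ] H n} (h : R ^ 4 = 1) : MeasurePreserving R := by
  have hd : LinearMap.det R ^ 4 = 1 := by rw [← map_pow, h, map_one]
  have hd' : |LinearMap.det R| = 1 := by
    have : |LinearMap.det R| ^ 4 = 1 := by rw [← abs_pow, hd, abs_one]
    exact (pow_eq_one_iff_of_nonneg (abs_nonneg _) (by norm_num)).1 this
  have hne : LinearMap.det R ≠ 0 := by intro h0; simp [h0] at hd'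
  refine ⟨(LinearMap.continuous_of_finiteDimensional R).measurable, ?_⟩
  have := haar_H (n := n)
  rw [Measure.map_linearMap_addHaar_eq_smul_addHaar _ hne, abs_inv, hd']
  simp

lemma symm_step {u : H n → ℝ} {R : H n →ₗ[ℝ] H n} (h4 : R ^ 4 = 1) (hu : ∀ ξ, u (R ξ) = u ξ)
    {c c' : Fin n ⊕ Fin n} {e : ℝ} (hv : ∀ ξ, R (vec c ξ) = e • vec c' (R ξ)) (he : e ≠ 0)
    (h : ∀ φ, Ts φ → ∫ ξ, u ξ * Dd c φ ξ = 0) {φ : H n → ℝ} (hφ : Ts φ) : ∫ ξ, u ξ * Dd c' φ ξ = 0 := by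
  have hmp := mp_of_order h4
  have hinv : ∀ ξ, (R ^ 3) (R ξ) = ξ := by
    intro ξ
    have : (R ^ 3 * R) ξ = ξ := by rw [← pow_succ, h4]; rfl
    exact this
  have hinv' : ∀ ξ, R ((R ^ 3) ξ) = ξ := by
    intro ξ
    have : (R * R ^ 3) ξ = ξ := by rw [← pow_succ', h4]; rfl
    exact this
  let e1 : H n ≃L[ℝ] H n := (LinearEquiv.ofLinearMap R (R^3) (LinearMap.ext hinv') (LinearMap.ext hinv)).toContinuousLinearEquiv
  have hme : MeasurableEmbedding R := e1.toHomeomorph.measurableEmbedding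
  have hcd : ContDiff ℝ ∞ (R : H n → H n) := e1.contDiff
  have hcomp : Ts (fun ξ => φ (R ξ)) := ⟨hφ.1.comp hcd, hφ.2.comp_homeomorph e1.toHomeomorph⟩
  have key : ∀ ξ, Dd c (fun ξ => φ (R ξ)) ξ = e * Dd c' φ (R ξ) := by
    intro ξ
    have h1 : HasFDerivAt (fun ξ => φ (R ξ)) ((fderiv ℝ φ (R ξ)).comp (e1 : H n →L[ℝ] H n)) ξ :=
      HasFDerivAt.comp ξ ((hφ.1.differentiable (by simp) (R ξ)).hasFDerivAt) e1.hasFDerivAt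
    unfold Dd
    rw [h1.fderiv]
    show fderiv ℝ φ (R ξ) (R (vec c ξ)) = _
    rw [hv, map_smul, smul_eq_mul]
  have := h _ hcomp
  rw [← hmp.integral_comp hme]
  have e2 : ∀ ξ, u ξ * Dd c (fun ξ => φ (R ξ)) ξ = e * (u (R ξ) * Dd c' φ (R ξ)) := by
    intro ξ; rw [key, hu]; ring
  rw [integral_congr_ae (Eventually.of_forall e2), integral_const_mul] at this
  exact (mul_eq_zero.1 this).resolve_left he

def swp (i j : Fin n) : H n →ₗ[ℝ] H n where
  toFun ξ := (ξ.1 ∘ Equiv.swap i j, ξ.2.1 ∘ Equiv.swap i j, ξ.2.2)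
  map_add' _ _ := rfl
  map_smul' _ _ := rfl

def rot : H n →ₗ[ℝ] H n where
  toFun ξ := (ξ.2.1, -ξ.1, ξ.2.2)
  map_add' a b := by ext <;> simp; ring
  map_smul' a b := by ext <;> simp

lemma swp_apply (i j : Fin n) (ξ : H n) : swp i j ξ = (ξ.1 ∘ Equiv.swap i j, ξ.2.1 ∘ Equiv.swap i j, ξ.2.2) := rfl
lemma rot_apply (ξ : H n) : rot ξ = (ξ.2.1, -ξ.1, ξ.2.2) := rfl

lemma swp4 (i j : Fin n) : swp i j ^ 4 = 1 := by
  have : ∀ ξ, swp i j (swp i j ξ) = ξ := by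
    intro ξ
    simp only [swp_apply]
    ext k <;> simp
  refine LinearMap.ext fun ξ => ?_
  simp only [pow_succ, pow_zero, one_mul, Module.End.mul_apply, this, Module.End.one_apply]

lemma rot4 : (rot : H n →ₗ[ℝ] H n) ^ 4 = 1 := by
  refine LinearMap.ext fun ξ => ?_
  simp only [pow_succ, pow_zero, one_mul, Module.End.mul_apply, rot_apply, neg_neg, Module.End.one_apply]

lemma swp_cyl {u : H n → ℝ} (hu : IsCylindrical u) (i j : Fin n) (ξ : H n) : u (swp i j ξ) = u ξ := by
  refine hu _ _ ?_ rfl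
  unfold rsq
  rw [swp_apply]
  congr 1
  · exact Equiv.sum_comp (Equiv.swap i j) (fun k => ξ.1 k ^ 2)
  · exact Equiv.sum_comp (Equiv.swap i j) (fun k => ξ.2.1 k ^ 2)

lemma rot_cyl {u : H n → ℝ} (hu : IsCylindrical u) (ξ : H n) : u (rot ξ) = u ξ := by
  refine hu _ _ ?_ rfl
  unfold rsq
  rw [rot_apply]
  simp [add_comm]

lemma single_swap (i j : Fin n) : (Pi.single i (1:ℝ) : Fin n → ℝ) ∘ Equiv.swap i j = Pi.single j 1 := by
  ext k
  simp only [Function.comp_apply, Pi.single_apply]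
  congr 1
  rw [Equiv.swap_apply_eq_iff, Equiv.swap_apply_left]

lemma all_zero {u : H n → ℝ} (hu : IsCylindrical u) {c : Fin n ⊕ Fin n}
    (h : ∀ φ, Ts φ → ∫ ξ, u ξ * Dd c φ ξ = 0) (c' : Fin n ⊕ Fin n) :
    ∀ φ, Ts φ → ∫ ξ, u ξ * Dd c' φ ξ = 0 := by
  have s1 : ∀ i, (∀ φ, Ts φ → ∫ ξ, u ξ * Dd (Sum.inr i) φ ξ = 0) → ∀ φ, Ts φ → ∫ ξ, u ξ * Dd (Sum.inl i) φ ξ = 0 := by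
    intro i h φ hφ
    refine symm_step rot4 (rot_cyl hu) (e := 1) (fun ξ => ?_) one_ne_zero h hφ
    rw [one_smul]
    simp [vec, rot_apply]
  have s2 : ∀ i, (∀ φ, Ts φ → ∫ ξ, u ξ * Dd (Sum.inl i) φ ξ = 0) → ∀ φ, Ts φ → ∫ ξ, u ξ * Dd (Sum.inr i) φ ξ = 0 := by
    intro i h φ hφ
    refine symm_step rot4 (rot_cyl hu) (e := -1) (fun ξ => ?_) (by norm_num) h hφ
    simp [vec, rot_apply]
  have s3 : ∀ i j, (∀ φ, Ts φ → ∫ ξ, u ξ * Dd (Sum.inl i) φ ξ = 0) → ∀ φ, Ts φ → ∫ ξ, u ξ * Dd (Sum.inl j) φ ξ = 0 := by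
    intro i j h φ hφ
    refine symm_step (swp4 i j) (swp_cyl hu i j) (e := 1) (fun ξ => ?_) (by norm_num) h hφ
    rw [one_smul]
    simp only [vec, swp_apply, Sum.elim_inl, single_swap, Function.comp_apply, Equiv.swap_apply_right]
    rfl
  have s0 : ∃ i, ∀ φ, Ts φ → ∫ ξ, u ξ * Dd (Sum.inl i) φ ξ = 0 := by
    rcases c with i | i
    · exact ⟨i, h⟩
    · exact ⟨i, s1 i h⟩
  obtain ⟨i, hi⟩ := s0
  rcases c' with j | j
  · exact s3 i j hi
  · exact s2 j (s3 i j hi)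

lemma stepH {u F : H n → ℝ} (hu : Continuous u) (hF : Continuous F) (hc : IsCylindrical u)
    (h : IsWeakSol Set.univ u F) {φ : H n → ℝ} (hφ : Ts φ) :
    ∫ ξ, u ξ * ∑ c, Dd c (Dd c φ) ξ = - ∫ ξ, F ξ * φ ξ := by
  obtain ⟨G, hG, hw⟩ := h
  have ibp : ∀ c, ∀ φ, Ts φ → ∫ ξ, u ξ * Dd c φ ξ = - ∫ ξ, Gc G c ξ * φ ξ := by
    intro c φ hφ
    rcases c with i | i
    · exact hG.ibpX i φ hφ.test
    · exact hG.ibpY i φ hφ.test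
  have hw' : ∀ φ, Ts φ → ∫ ξ, ∑ c, Gc G c ξ * Dd c φ ξ = ∫ ξ, F ξ * φ ξ := by
    intro φ hφ
    rw [← hw φ hφ.test]
    simp only [hdot_eq]
  have hsum : ∫ ξ, u ξ * ∑ c, Dd c (Dd c φ) ξ = ∑ c, ∫ ξ, u ξ * Dd c (Dd c φ) ξ := by
    simp only [Finset.mul_sum]
    exact integral_finsetSum _ (fun c _ => ((hφ.D c).D c).int hu)
  rw [hsum]
  by_cases hall : ∀ c, ∀ ψ, Ts ψ → Integrable (fun ξ => Gc G c ξ * ψ ξ)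
  · rw [← hw' φ hφ, integral_finsetSum _ (fun c _ => hall c _ (hφ.D c)), ← Finset.sum_neg_distrib]
    exact Finset.sum_congr rfl fun c _ => ibp c _ (hφ.D c)
  · push Not at hall
    obtain ⟨c, ψ, hψ, hni⟩ := hall
    have Z1 : ∀ φ, Ts φ → ∫ ξ, u ξ * Dd c φ ξ = 0 := by
      intro φ hφ
      have := zero_of_nonint (I := fun φ ξ => Gc G c ξ * φ ξ) (l := fun φ => -∫ ξ, u ξ * Dd c φ ξ)
        (fun φ ψ _ _ ξ => mul_add _ _ _)
        (fun φ ψ h1 h2 => by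
          simp only [Dd_add h1 h2, mul_add]
          rw [integral_add ((h1.D c).int hu) ((h2.D c).int hu)]; ring)
        (fun φ h1 => by rw [ibp c φ h1, neg_neg]) hψ hni hφ
      simpa using this
    have hex : ∃ φ0, Ts φ0 ∧ ¬ Integrable (fun ξ => ∑ c, Gc G c ξ * Dd c φ0 ξ) := by
      by_contra hcon
      push Not at hcon
      exact hni (comp_int hcon c hψ)
    obtain ⟨φ0, h0, hn0⟩ := hex
    have Z2 : ∫ ξ, F ξ * φ ξ = 0 :=
      zero_of_nonint (I := fun φ ξ => ∑ c, Gc G c ξ * Dd c φ ξ) (l := fun φ => ∫ ξ, F ξ * φ ξ)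
        (fun φ ψ h1 h2 ξ => by simp only [Dd_add h1 h2, mul_add, Finset.sum_add_distrib])
        (fun φ ψ h1 h2 => by
          simp only [mul_add]
          rw [integral_add (h1.int hF) (h2.int hF)])
        hw' h0 hn0 hφ
    rw [Z2, neg_zero]
    exact Finset.sum_eq_zero fun c' _ => all_zero hc Z1 c' _ (hφ.D c')

end HP

namespace HP
open scoped ContDiff
open Heisenberg
variable {n : ℕ}

def pj (ξ : H n) : ℝ × ℝ := (rsq ξ, ξ.2.2)

lemma rsq_eq (ξ : H n) : rsq ξ = ∑ c, lin c ξ ^ 2 := by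
  rw [Fintype.sum_sum_type]; rfl

lemma rsq_cd : ContDiff ℝ ∞ (rsq : H n → ℝ) := by
  have : (rsq : H n → ℝ) = fun ξ => ∑ c, lin c ξ ^ 2 := funext rsq_eq
  rw [this]
  exact ContDiff.sum fun c _ => (lin_cd c).pow 2

lemma pj_cd : ContDiff ℝ ∞ (pj : H n → ℝ × ℝ) := by
  refine rsq_cd.prodMk ?_
  fun_prop

lemma Dd_lin (c c' : Fin n ⊕ Fin n) (ξ : H n) : Dd c' (lin c) ξ = if c' = c then 1 else 0 := by
  obtain ⟨L, hL, hLv⟩ := lin_hd c ξ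
  unfold Dd
  rw [hL.fderiv, hLv, lin_vec]

lemma Dd_mul {f g : H n → ℝ} {ξ : H n} (hf : DifferentiableAt ℝ f ξ) (hg : DifferentiableAt ℝ g ξ) (c : Fin n ⊕ Fin n) :
    Dd c (fun ξ => f ξ * g ξ) ξ = f ξ * Dd c g ξ + g ξ * Dd c f ξ := by
  unfold Dd
  rw [fderiv_fun_mul hf hg]; rfl

lemma Dd_add' {f g : H n → ℝ} {ξ : H n} (hf : DifferentiableAt ℝ f ξ) (hg : DifferentiableAt ℝ g ξ) (c : Fin n ⊕ Fin n) :
    Dd c (fun ξ => f ξ + g ξ) ξ = Dd c f ξ + Dd c g ξ := by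
  unfold Dd
  rw [fderiv_fun_add hf hg]; rfl

lemma Dd_rsq (c : Fin n ⊕ Fin n) (ξ : H n) : Dd c rsq ξ = 2 * lin c ξ := by
  have : (rsq : H n → ℝ) = fun ξ => ∑ c, lin c ξ ^ 2 := funext rsq_eq
  have hd : ∀ c, DifferentiableAt ℝ (lin c) ξ := fun c => (lin_cd c).differentiable (by simp) ξ
  have e : Dd c rsq ξ = ∑ c', Dd c (fun ξ => lin c' ξ ^ 2) ξ := by
    rw [this]
    unfold Dd
    rw [fderiv_fun_sum (A := fun c ξ => lin c ξ ^ 2) (fun c _ => (hd c).pow 2)]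
    simp
  have e2 : ∀ c', Dd c (fun ξ => lin c' ξ ^ 2) ξ = 2 * lin c' ξ * if c = c' then 1 else 0 := by
    intro c'
    simp only [pow_two]
    rw [Dd_mul (hd c') (hd c'), Dd_lin]; ring
  rw [e]
  simp [e2]

def qv (c : Fin n ⊕ Fin n) (ξ : H n) : ℝ := (vec c ξ).2.2

lemma qv_cd (c : Fin n ⊕ Fin n) : ContDiff ℝ ∞ (qv c) := by
  have := vec_cd c
  unfold qv; fun_prop

lemma Dd_qv (c : Fin n ⊕ Fin n) (ξ : H n) : Dd c (qv c) ξ = 0 := by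
  rcases c with i | i
  · have e : qv (Sum.inl i) = fun ξ : H n => 2 * lin (Sum.inr i) ξ := rfl
    rw [e, Dd_mul (by fun_prop) ((lin_cd _).differentiable (by simp) ξ), Dd_lin]
    simp [Dd]
  · have e : qv (Sum.inr i) = fun ξ : H n => (-2) * lin (Sum.inl i) ξ := by
      ext ξ; simp [qv, vec, lin]
    rw [e, Dd_mul (by fun_prop) ((lin_cd _).differentiable (by simp) ξ), Dd_lin]
    simp [Dd]

lemma Dd_comp {w : ℝ × ℝ → ℝ} (hw : ContDiff ℝ ∞ w) (c : Fin n ⊕ Fin n) (ξ : H n) :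
    Dd c (fun ξ => w (pj ξ)) ξ = d1 w (pj ξ) * (2 * lin c ξ) + d2 w (pj ξ) * qv c ξ := by
  have hw1 : DifferentiableAt ℝ w (pj ξ) := hw.differentiable (by simp) _
  rw [d1_eq hw1, d2_eq hw1]
  have h1 : HasFDerivAt (rsq : H n → ℝ) (fderiv ℝ rsq ξ) ξ := (rsq_cd.differentiable (by simp) ξ).hasFDerivAt
  have h2 : HasFDerivAt (fun ξ : H n => ξ.2.2) ((ContinuousLinearMap.snd ℝ (Fin n → ℝ) ℝ).comp (ContinuousLinearMap.snd ℝ (Fin n → ℝ) ((Fin n → ℝ) × ℝ))) ξ :=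
    ((ContinuousLinearMap.snd ℝ (Fin n → ℝ) ℝ).comp (ContinuousLinearMap.snd ℝ (Fin n → ℝ) ((Fin n → ℝ) × ℝ))).hasFDerivAt
  have h3 := HasFDerivAt.comp (f := pj) ξ hw1.hasFDerivAt (h1.prodMk h2)
  have h3' : fderiv ℝ (fun ξ => w (pj ξ)) ξ = _ := h3.fderiv
  unfold Dd
  rw [h3']
  show fderiv ℝ w (pj ξ) (Dd c rsq ξ, qv c ξ) = _
  rw [Dd_rsq]
  have : ((2 * lin c ξ, qv c ξ) : ℝ × ℝ) = (2 * lin c ξ) • ((1:ℝ),(0:ℝ)) + (qv c ξ) • ((0:ℝ),(1:ℝ)) := by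
    ext <;> simp
  rw [this, map_add, map_smul, map_smul, smul_eq_mul, smul_eq_mul]
  ring

lemma cd_d1 {w : ℝ × ℝ → ℝ} (hw : ContDiff ℝ ∞ w) : ContDiff ℝ ∞ (d1 w) := by
  have : d1 w = fun z => fderiv ℝ w z (1,0) := funext fun z => d1_eq (hw.differentiable (by simp) z)
  rw [this]
  exact (hw.fderiv_right (m := ∞) (by simp)).clm_apply contDiff_const
lemma cd_d2 {w : ℝ × ℝ → ℝ} (hw : ContDiff ℝ ∞ w) : ContDiff ℝ ∞ (d2 w) := by
  have : d2 w = fun z => fderiv ℝ w z (0,1) := funext fun z => d2_eq (hw.differentiable (by simp) z)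
  rw [this]
  exact (hw.fderiv_right (m := ∞) (by simp)).clm_apply contDiff_const

lemma lap_comp {w : ℝ × ℝ → ℝ} (hw : ContDiff ℝ ∞ w) (ξ : H n) :
    ∑ c, Dd c (Dd c (fun ξ => w (pj ξ))) ξ = 4 * Lop n w (pj ξ) := by
  have dl : ∀ c, DifferentiableAt ℝ (lin c) ξ := fun c => (lin_cd c).differentiable (by simp) ξ
  have dq : ∀ c, DifferentiableAt ℝ (qv c) ξ := fun c => (qv_cd c).differentiable (by simp) ξ
  have dc : ∀ {w : ℝ × ℝ → ℝ}, ContDiff ℝ ∞ w → DifferentiableAt ℝ (fun ξ : H n => w (pj ξ)) ξ :=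
    fun h => (h.comp pj_cd).differentiable (by simp) ξ
  have key : ∀ c : Fin n ⊕ Fin n, Dd c (Dd c (fun ξ => w (pj ξ))) ξ =
      4 * d1 (d1 w) (pj ξ) * lin c ξ ^ 2 + 2 * d1 w (pj ξ) + d2 (d2 w) (pj ξ) * qv c ξ ^ 2
        + 2 * (d2 (d1 w) (pj ξ) + d1 (d2 w) (pj ξ)) * (lin c ξ * qv c ξ) := by
    intro c
    have e : Dd c (fun ξ => w (pj ξ)) = fun ξ => d1 w (pj ξ) * (2 * lin c ξ) + d2 w (pj ξ) * qv c ξ :=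
      funext fun ξ => Dd_comp hw c ξ
    rw [e, Dd_add' (f := fun ξ => d1 w (pj ξ) * (2 * lin c ξ)) (g := fun ξ => d2 w (pj ξ) * qv c ξ)
      ((dc (cd_d1 hw)).mul ((dl c).const_mul 2)) ((dc (cd_d2 hw)).mul (dq c)),
      Dd_mul (dc (cd_d1 hw)) ((dl c).const_mul 2), Dd_mul (dc (cd_d2 hw)) (dq c),
      Dd_mul (by fun_prop) (dl c), Dd_comp (cd_d1 hw), Dd_comp (cd_d2 hw), Dd_qv, Dd_lin]
    have : Dd c (fun _ : H n => (2:ℝ)) ξ = 0 := by simp [Dd]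
    rw [this]
    simp only [if_true]
    ring
  have s1 : ∑ c : Fin n ⊕ Fin n, lin c ξ ^ 2 = rsq ξ := (rsq_eq ξ).symm
  have s2 : ∑ c : Fin n ⊕ Fin n, qv c ξ ^ 2 = 4 * rsq ξ := by
    rw [Fintype.sum_sum_type]
    simp only [qv, vec, Sum.elim_inl, Sum.elim_inr, rsq, neg_sq, mul_pow]
    rw [← Finset.mul_sum, ← Finset.mul_sum]
    ring
  have s3 : ∑ c : Fin n ⊕ Fin n, lin c ξ * qv c ξ = 0 := by
    rw [Fintype.sum_sum_type, ← Finset.sum_add_distrib]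
    refine Finset.sum_eq_zero fun i _ => ?_
    simp only [qv, vec, Sum.elim_inl, Sum.elim_inr, lin]
    ring
  simp only [key]
  rw [Finset.sum_add_distrib, Finset.sum_add_distrib, Finset.sum_add_distrib, ← Finset.mul_sum, ← Finset.mul_sum,
    ← Finset.mul_sum, ← Finset.mul_sum, s1, s2, s3]
  simp only [Finset.sum_const, Finset.card_univ, Fintype.card_sum, Fintype.card_fin, nsmul_eq_mul, Lop, pj]
  push_cast
  ring

lemma pj_cs {Φ : ℝ × ℝ → ℝ} (h : HasCompactSupport Φ) : HasCompactSupport (fun ξ : H n => Φ (pj ξ)) := by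
  obtain ⟨M, hM⟩ := h.isCompact.isBounded.subset_closedBall (0 : ℝ × ℝ)
  refine HasCompactSupport.intro (K := Metric.closedBall (0 : H n) (1 + |M|)) (isCompact_closedBall _ _) ?_
  intro ξ hξ
  by_contra hne
  apply hξ
  have h1 := hM (subset_closure hne)
  rw [mem_closedBall_zero_iff, Prod.norm_def, max_le_iff] at h1
  have hr : rsq ξ ≤ |M| := (le_abs_self _).trans (h1.1.trans (le_abs_self M))
  have ht : |ξ.2.2| ≤ |M| := h1.2.trans (le_abs_self M)
  have hl : ∀ c, |lin c ξ| ≤ 1 + |M| := by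
    intro c
    have : lin c ξ ^ 2 ≤ rsq ξ := by
      rw [rsq_eq]
      exact Finset.single_le_sum (f := fun c => lin c ξ ^ 2) (fun c _ => sq_nonneg _) (Finset.mem_univ c)
    rw [← sq_abs] at this
    nlinarith [sq_nonneg (|lin c ξ| - 1), abs_nonneg (lin c ξ)]
  have hM0 := abs_nonneg M
  rw [mem_closedBall_zero_iff, Prod.norm_def, Prod.norm_def]
  refine max_le ((pi_norm_le_iff_of_nonneg (by linarith)).2 fun i => hl (Sum.inl i)) (max_le ((pi_norm_le_iff_of_nonneg (by linarith)).2 fun i => hl (Sum.inr i)) ?_)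
  rw [Real.norm_eq_abs]; linarith

abbrev EE (n : ℕ) := EuclideanSpace ℝ (Fin n ⊕ Fin n)

/-- `E × ℝ ≃ ℍⁿ` -/
def eqv (n : ℕ) : EE n × ℝ ≃ᵐ H n :=
  (MeasurableEquiv.prodCongr ((MeasurableEquiv.toLp 2 (Fin n ⊕ Fin n → ℝ)).symm.trans
    (MeasurableEquiv.sumPiEquivProdPi (fun _ => ℝ))) (MeasurableEquiv.refl ℝ)).trans MeasurableEquiv.prodAssoc

lemma eqv_mp (n : ℕ) : MeasurePreserving (eqv n) := by
  have h1 : MeasurePreserving (MeasurableEquiv.toLp 2 (Fin n ⊕ Fin n → ℝ)).symm :=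
    EuclideanSpace.volume_preserving_symm_measurableEquiv_toLp _
  have h2 : MeasurePreserving (MeasurableEquiv.sumPiEquivProdPi (fun _ : Fin n ⊕ Fin n => ℝ)) :=
    volume_measurePreserving_sumPiEquivProdPi _
  have h3 := (h2.comp h1).prod (MeasurePreserving.id (volume : Measure ℝ))
  have h4 : MeasurePreserving (MeasurableEquiv.prodAssoc : ((Fin n → ℝ) × (Fin n → ℝ)) × ℝ ≃ᵐ _) :=
    volume_preserving_prodAssoc
  exact h4.comp h3

lemma eqv_pj (n : ℕ) (x : EE n × ℝ) : pj (eqv n x) = (‖x.1‖ ^ 2, x.2) := by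
  rw [EuclideanSpace.norm_sq_eq]
  ext
  · show rsq (eqv n x) = _
    rw [rsq_eq]
    refine Finset.sum_congr rfl fun c _ => ?_
    rw [Real.norm_eq_abs, sq_abs]
    rcases c with i | i <;> rfl
  · rfl

lemma polar (n : ℕ) (hn : 1 ≤ n) : ∃ κ : ℝ, 0 < κ ∧ ∀ Φ : ℝ × ℝ → ℝ, Continuous Φ → HasCompactSupport Φ →
    tsupport Φ ⊆ P → ∫ ξ : H n, Φ (pj ξ) = κ * ∫ z, Φ z * z.1 ^ (n-1) := by
  refine ⟨(Module.finrank ℝ (EE n)) * (volume : Measure (EE n)).real (Metric.ball 0 1) / 2, ?_, ?_⟩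
  · have h1 : (0:ℝ) < Module.finrank ℝ (EE n) := by
      rw [finrank_euclideanSpace, Fintype.card_sum, Fintype.card_fin]
      exact_mod_cast (by omega : 0 < n + n)
    have h2 : 0 < (volume : Measure (EE n)).real (Metric.ball 0 1) :=
      ENNReal.toReal_pos (Metric.measure_ball_pos _ _ one_pos).ne' measure_ball_lt_top.ne
    positivity
  · intro Φ hc hs hP
    have hInt0 : Integrable (fun ξ : H n => Φ (pj ξ)) :=
      (hc.comp pj_cd.continuous).integrable_of_hasCompactSupport (pj_cs hs)
    have hint2 : Integrable (fun x : EE n × ℝ => Φ (‖x.1‖ ^ 2, x.2)) := by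
      have := (eqv_mp n).integrable_comp_of_integrable hInt0
      refine this.congr (Eventually.of_forall fun x => ?_)
      simp only [Function.comp_apply, eqv_pj]
    have hint3 : Integrable (fun z : ℝ × ℝ => Φ z * z.1 ^ (n-1)) :=
      (hc.mul (by fun_prop)).integrable_of_hasCompactSupport hs.mul_right
    rw [← (eqv_mp n).integral_comp (eqv n).measurableEmbedding]
    simp only [eqv_pj]
    rw [Measure.volume_eq_prod] at hint2 hint3 ⊢
    rw [integral_prod_symm _ hint2, Measure.volume_eq_prod, integral_prod_symm _ hint3, ← integral_const_mul]
    refine integral_congr_ae (Eventually.of_forall fun t => ?_)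
    show ∫ x : EE n, Φ (‖x‖ ^ 2, t) = _ * ∫ s : ℝ, Φ (s, t) * s ^ (n-1)
    have : Nontrivial (EE n) := by
      have : 0 < Module.finrank ℝ (EE n) := by
        rw [finrank_euclideanSpace, Fintype.card_sum, Fintype.card_fin]; omega
      exact Module.nontrivial_of_finrank_pos this
    rw [integral_fun_norm_addHaar (volume : Measure (EE n)) (fun y => Φ (y ^ 2, t))]
    have e1 : ∫ s : ℝ, Φ (s, t) * s ^ (n-1) = ∫ s in Ioi (0:ℝ), Φ (s, t) * s ^ (n-1) := by
      symm
      refine setIntegral_eq_integral_of_forall_compl_eq_zero fun s hs => ?_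
      have : Φ (s, t) = 0 := by
        by_contra hne
        exact hs (hP (subset_closure hne))
      rw [this, zero_mul]
    rw [e1, ← integral_comp_rpow_Ioi_of_pos (g := fun s => Φ (s, t) * s ^ (n-1)) (two_pos)]
    have e2 : ∫ x in Ioi (0:ℝ), ((2:ℝ) * x ^ ((2:ℝ) - 1)) • (Φ (x ^ (2:ℝ), t) * (x ^ (2:ℝ)) ^ (n-1))
        = 2 * ∫ y in Ioi (0:ℝ), y ^ (Module.finrank ℝ (EE n) - 1) • Φ (y ^ 2, t) := by
      rw [← integral_const_mul]
      refine setIntegral_congr_fun measurableSet_Ioi fun y hy => ?_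
      have hy0 : (0:ℝ) < y := hy
      have hf : Module.finrank ℝ (EE n) - 1 = 1 + 2 * (n-1) := by
        rw [finrank_euclideanSpace, Fintype.card_sum, Fintype.card_fin]; omega
      have a1 : (2:ℝ) - 1 = 1 := by norm_num
      simp only [hf, smul_eq_mul, a1, Real.rpow_one, Real.rpow_two, pow_add, pow_mul, pow_one]
      ring
    rw [e2, nsmul_eq_mul, smul_eq_mul]
    ring

end HP

namespace HP
open scoped ContDiff
open Heisenberg
variable {n : ℕ}

def red (hn : 1 ≤ n) (u : H n → ℝ) (z : ℝ × ℝ) : ℝ := u (Pi.single ⟨0, hn⟩ (√z.1), 0, z.2)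

lemma red_cont (hn : 1 ≤ n) {u : H n → ℝ} (hu : Continuous u) : Continuous (red hn u) := by
  refine hu.comp ?_
  refine Continuous.prodMk ?_ (by fun_prop)
  exact (continuous_single (A := fun _ : Fin n => ℝ) (⟨0, hn⟩ : Fin n)).comp (by fun_prop)

lemma rsq_nonneg (ξ : H n) : 0 ≤ rsq ξ := by
  rw [rsq_eq]; exact Finset.sum_nonneg fun _ _ => sq_nonneg _

lemma red_pj (hn : 1 ≤ n) {u : H n → ℝ} (hu : IsCylindrical u) (ξ : H n) : red hn u (pj ξ) = u ξ := by
  refine hu _ _ ?_ rfl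
  have h0 := rsq_nonneg ξ
  show rsq ((Pi.single ⟨0, hn⟩ (√(rsq ξ)), 0, ξ.2.2) : H n) = rsq ξ
  unfold rsq
  rw [Finset.sum_eq_single (⟨0, hn⟩ : Fin n)]
  · simp only [Pi.single_eq_same, Pi.zero_apply]
    rw [Real.sq_sqrt (by exact h0)]
    simp
  · intro b _ hb
    simp [Pi.single_apply, hb]
  · simp

lemma Lop_ts {ψ : ℝ × ℝ → ℝ} : ∀ z, z ∉ tsupport ψ → Lop n ψ z = 0 := by
  intro z hz
  have : ψ =ᶠ[𝓝 z] fun _ => 0 := notMem_tsupport_iff_eventuallyEq.1 hz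
  rw [Lop_congr n this]
  simp [Lop, d1, d2]

lemma weak_dist (hn : 1 ≤ n) {u F : H n → ℝ} (hu : Continuous u) (hF : Continuous F) (cu : IsCylindrical u)
    {Fh : ℝ × ℝ → ℝ} (hFh : Continuous Fh) (hFe : ∀ ξ, F ξ = Fh (pj ξ))
    (h : IsWeakSol Set.univ u F) : Dist n (red hn u) (fun z => Fh z / 4) := by
  intro ψ hψ hs hP
  have hT : Ts (fun ξ : H n => ψ (pj ξ)) := ⟨hψ.comp pj_cd, pj_cs hs⟩
  have hH := stepH hu hF cu h hT
  simp only [lap_comp hψ] at hH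
  obtain ⟨κ, hκ, hpol⟩ := polar n hn
  have hLc : Continuous (Lop n ψ) := by
    have h1 := (cd_d1 hψ).continuous
    have h2 := (cd_d1 (cd_d1 hψ)).continuous
    have h3 := (cd_d2 (cd_d2 hψ)).continuous
    unfold Lop; fun_prop
  have hca := red_cont hn hu
  have z1 : ∀ z, z ∉ tsupport ψ → red hn u z * (4 * Lop n ψ z) = 0 := by
    intro z hz; rw [Lop_ts z hz]; ring
  have z2 : ∀ z, z ∉ tsupport ψ → Fh z * ψ z = 0 := by
    intro z hz; rw [image_eq_zero_of_notMem_tsupport hz, mul_zero]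
  have cl : ∀ {Φ : ℝ × ℝ → ℝ}, (∀ z, z ∉ tsupport ψ → Φ z = 0) → HasCompactSupport Φ ∧ tsupport Φ ⊆ P := by
    intro Φ hΦ
    refine ⟨HasCompactSupport.intro hs hΦ, Subset.trans (closure_minimal ?_ (isClosed_tsupport ψ)) hP⟩
    intro z hz
    by_contra hc
    exact hz (hΦ z hc)
  have p1 := hpol (fun z => red hn u z * (4 * Lop n ψ z)) (by fun_prop) (cl z1).1 (cl z1).2
  have p2 := hpol (fun z => Fh z * ψ z) (hFh.mul hψ.continuous) (cl z2).1 (cl z2).2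
  simp only [red_pj hn cu] at p1
  simp only [← hFe] at p2
  rw [p1, p2] at hH
  have q1 : ∫ z, red hn u z * (4 * Lop n ψ z) * z.1 ^ (n-1) = 4 * ∫ z, red hn u z * z.1 ^ (n-1) * Lop n ψ z := by
    rw [← integral_const_mul]
    refine integral_congr_ae (Eventually.of_forall fun z => ?_)
    simp only; ring
  have q2 : ∫ z, Fh z * ψ z * z.1 ^ (n-1) = 4 * ∫ z, Fh z / 4 * z.1 ^ (n-1) * ψ z := by
    rw [← integral_const_mul]
    refine integral_congr_ae (Eventually.of_forall fun z => ?_)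
    simp only; ring
  rw [q1, q2] at hH
  have : 4 * κ ≠ 0 := by positivity
  apply mul_left_cancel₀ this
  linarith

lemma red_even_crInv (hn : 1 ≤ n) {u : H n → ℝ} (cu : IsCylindrical u)
    (h : ∀ S t, 0 ≤ S → red hn u (S, t) = red hn u (S, -t)) (x y : Fin n → ℝ) (t : ℝ) :
    crInv u ((x, y, t) : H n) = crInv u ((x, y, -t) : H n) := by
  have hr : rsq ((x, y, -t) : H n) = rsq ((x, y, t) : H n) := rfl
  have hg : gaugeH ((x, y, -t) : H n) = gaugeH ((x, y, t) : H n) := by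
    unfold gaugeH; rw [hr]; simp
  set g := gaugeH ((x, y, t) : H n) with hgd
  have e : ∀ s, rsq ((x, y, s) : H n) = rsq ((x, y, t) : H n) := fun s => rfl
  have key : ∀ s, s ^ 2 = t ^ 2 → gaugeH ((x, y, s) : H n) = g → rsq (tilde ((x, y, s) : H n)) =
      rsq ((x,y,t) : H n) * (t ^ 2 + rsq ((x,y,t) : H n) ^ 2) / (g^4)^2 := by
    intro s hs hgs
    set r := rsq ((x, y, t) : H n) with hrd
    have : rsq (tilde ((x, y, s) : H n)) = ∑ i, ((x i * s + y i * r) / g^4)^2 + ∑ i, ((y i * s - x i * r) / g^4)^2 := by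
      rw [← hgs]; rfl
    rw [this, ← Finset.sum_add_distrib]
    have e2 : ∀ i, ((x i * s + y i * r) / g^4)^2 + ((y i * s - x i * r) / g^4)^2 = (t^2 + r^2) / (g^4)^2 * (x i ^2 + y i ^2) := by
      intro i; rw [← hs]; ring
    simp only [e2]
    rw [← Finset.mul_sum, Finset.sum_add_distrib]
    have : ∑ i, x i ^ 2 + ∑ i, y i ^ 2 = r := rfl
    rw [this]; ring
  have k1 := key t rfl rfl
  have k2 := key (-t) (by ring) hg
  unfold crInv
  rw [hg, ← hgd, ← red_pj hn cu (tilde ((x, y, t) : H n)), ← red_pj hn cu (tilde ((x, y, -t) : H n))]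
  have hp : pj (tilde ((x, y, -t) : H n)) = (rsq (tilde ((x, y, t) : H n)), -(tilde ((x, y, t) : H n)).2.2) := by
    unfold pj
    rw [k2, ← k1]
    congr 1
    show -(-t) / gaugeH ((x, y, -t) : H n) ^ 4 = -(-t / gaugeH ((x, y, t) : H n) ^ 4)
    rw [hg]; ring
  rw [hp]
  congr 1
  exact h _ _ (rsq_nonneg _)

lemma nc_of (hn : 1 ≤ n) {v : H n → ℝ} (cv : IsCylindrical v) {f : ℝ → ℝ}
    (h : ∃ s ∈ Set.Ioo (0 : ℝ) (⨆ ξ, v ξ), ∃ t ∈ Set.Ioo (0 : ℝ) (⨆ ξ, v ξ),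
        f s / s ^ tau n ≠ f t / t ^ tau n) : NC1 n f (red hn v) := by
  obtain ⟨s, hs, t, ht, hne⟩ := h
  have : ∀ s, s < (⨆ ξ, v ξ) → ∃ z : ℝ × ℝ, 0 ≤ z.1 ∧ s < red hn v z := by
    intro s hs
    obtain ⟨ξ, hξ⟩ := exists_lt_of_lt_ciSup hs
    exact ⟨pj ξ, rsq_nonneg ξ, by rw [red_pj hn cv]; exact hξ⟩
  exact ⟨s, t, hs.1, ht.1, this s hs.2, this t ht.2, hne⟩

end HP

namespace Heisenberg

/-- **Lemma 3.5.** Under the assumptions of Theorem 1.1 (including the non-constancy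
condition (iii)), the CR inversions `ū` and `v̄` are symmetric with respect to the plane
`T₀ = {t = 0}`, i.e. they are even functions of the `t`-variable away from the origin. -/
theorem crInv_even_in_t (n : ℕ) (hn : 1 ≤ n)
    (u v : H n → ℝ) (f g : ℝ → ℝ)
    (hu_cont : Continuous u) (hv_cont : Continuous v)
    (hu_pos : ∀ ξ, 0 < u ξ) (hv_pos : ∀ ξ, 0 < v ξ)
    (hu_cyl : IsCylindrical u) (hv_cyl : IsCylindrical v)
    (hu_sol : IsWeakSol Set.univ u (fun ξ => f (v ξ)))
    (hv_sol : IsWeakSol Set.univ v (fun ξ => g (u ξ)))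
    (hf_cont : ContinuousOn f (Set.Ici 0))
    (hg_cont : ContinuousOn g (Set.Ici 0))
    (hf_mono : ∀ s t : ℝ, 0 < s → s ≤ t → f s ≤ f t)
    (hg_mono : ∀ s t : ℝ, 0 < s → s ≤ t → g s ≤ g t)
    (hh_anti : ∀ s t : ℝ, 0 < s → s ≤ t → f t / t ^ tau n ≤ f s / s ^ tau n)
    (hk_anti : ∀ s t : ℝ, 0 < s → s ≤ t → g t / t ^ tau n ≤ g s / s ^ tau n)
    (h_notconst :
      (∃ s ∈ Set.Ioo (0 : ℝ) (⨆ ξ, v ξ), ∃ t ∈ Set.Ioo (0 : ℝ) (⨆ ξ, v ξ),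
        f s / s ^ tau n ≠ f t / t ^ tau n) ∨
      (∃ s ∈ Set.Ioo (0 : ℝ) (⨆ ξ, u ξ), ∃ t ∈ Set.Ioo (0 : ℝ) (⨆ ξ, u ξ),
        g s / s ^ tau n ≠ g t / t ^ tau n)) :
    ∀ x y : Fin n → ℝ, ∀ t : ℝ, ((x, y, t) : H n) ≠ 0 →
      crInv u (x, y, t) = crInv u (x, y, -t) ∧
      crInv v (x, y, t) = crInv v (x, y, -t) := by
  have fa : ∀ {f : ℝ → ℝ} {w : H n → ℝ}, ContinuousOn f (Set.Ici 0) → Continuous w → (∀ ξ, 0 < w ξ) →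
      Continuous (fun ξ => f (w ξ)) := fun hf hw hp =>
    hf.comp_continuous hw (fun ξ => (hp ξ).le)
  have fb : ∀ {f : ℝ → ℝ} {w : H n → ℝ}, ContinuousOn f (Set.Ici 0) → Continuous w → (∀ ξ, 0 < w ξ) →
      Continuous (fun z => f (HP.red hn w z)) := fun hf hw hp =>
    hf.comp_continuous (HP.red_cont hn hw) (fun z => (hp _).le)
  have du := HP.weak_dist hn hu_cont (fa hf_cont hv_cont hv_pos) hu_cyl (fb hf_cont hv_cont hv_pos)
    (fun ξ => by rw [HP.red_pj hn hv_cyl]) hu_sol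
  have dv := HP.weak_dist hn hv_cont (fa hg_cont hu_cont hu_pos) hv_cyl (fb hg_cont hu_cont hu_pos)
    (fun ξ => by rw [HP.red_pj hn hu_cyl]) hv_sol
  have hsys : HP.Sys n f g (HP.red hn u) (HP.red hn v) :=
    ⟨hn, ⟨hf_cont, hf_mono, hh_anti⟩, ⟨hg_cont, hg_mono, hk_anti⟩, HP.red_cont hn hu_cont,
      HP.red_cont hn hv_cont, fun z => hu_pos _, fun z => hv_pos _,
      du.apx hn (HP.red_cont hn hu_cont) ((fb hf_cont hv_cont hv_pos).div_const 4),
      dv.apx hn (HP.red_cont hn hv_cont) ((fb hg_cont hu_cont hu_pos).div_const 4)⟩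
  have hnc : HP.NC1 n f (HP.red hn v) ∨ HP.NC1 n g (HP.red hn u) :=
    h_notconst.imp (HP.nc_of hn hv_cyl) (HP.nc_of hn hu_cyl)
  intro x y t _
  exact ⟨HP.red_even_crInv hn hu_cyl (hsys.even hnc) x y t,
    HP.red_even_crInv hn hv_cyl (hsys.symm.even hnc.symm) x y t⟩

end Heisenberg
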